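/- arXiv:1708.00217 — 4 statements merged into one kernel-verified Lean document; each statement's English description precedes it below -/
import Mathlib

section
/- Let f : ℂ → ℂ be the entire function f(z) = Σ_{n≥0} (n² · binom(2n,n) / (n+1)²) · (z/2)^{n+1} / n!. Then for an algebraic number α, f(α) is algebraic if and only if α ∈ {0, 1}; moreover f(0) = 0 and f(1) = 1/2, i.e., Σ_{n≥0} n² · binom(2n,n) / ((n+1)² · n! · 2^{n+1}) = 1/2. -/
noncomputable section

open scoped Nat

section

open Polynomial
open scoped Differential

/-- The Euler derivation `z d/dz` on `ℤ[z]`. -/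
instance polyEuler : Differential ℤ[X] :=
  ⟨(X : ℤ[X]) • (Polynomial.derivative' : Derivation ℤ ℤ[X] ℤ[X])⟩

/-- A differential ring structure from an additive map satisfying the Leibniz rule. -/
abbrev differentialOfLeibniz {R : Type*} [CommRing R] (D : R →+ R)
    (h : ∀ a b, D (a * b) = a * D b + b * D a) : Differential R :=
  ⟨Derivation.mk' D.toIntLinearMap fun a b ↦ h a b⟩

/-- The Euler derivation `z d/dz` on `ℚ⟦z⟧`. -/
instance seriesEuler : Differential (PowerSeries ℚ) :=
  differentialOfLeibniz
    ((PowerSeries.X : PowerSeries ℚ) • PowerSeries.derivative ℚ).toLinearMap.toAddMonoidHom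
    fun a b ↦ ((PowerSeries.X : PowerSeries ℚ) • PowerSeries.derivative ℚ).leibniz a b

lemma polyEuler_def (p : ℤ[X]) : p′ = X * derivative p := rfl

lemma seriesEuler_def (f : PowerSeries ℚ) : f′ = PowerSeries.X * PowerSeries.derivative ℚ f := rfl

lemma coeff_polyEuler (p : ℤ[X]) (n : ℕ) : (p′).coeff n = n * p.coeff n := by
  rw [polyEuler_def]
  cases n with
  | zero => simp
  | succ n => rw [coeff_X_mul, coeff_derivative]; push_cast; ring

lemma coeff_seriesEuler (f : PowerSeries ℚ) (n : ℕ) :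
    PowerSeries.coeff n (f′) = n * PowerSeries.coeff n f := by
  rw [seriesEuler_def]
  cases n with
  | zero => simp
  | succ n => rw [PowerSeries.coeff_succ_X_mul, PowerSeries.coeff_derivative]; push_cast; ring

lemma coeff_algebraMap_series (p : ℤ[X]) (n : ℕ) :
    PowerSeries.coeff n (algebraMap ℤ[X] (PowerSeries ℚ) p) = (p.coeff n : ℚ) := by
  rw [PowerSeries.algebraMap_apply']
  simp

lemma algebraMap_series_injective : Function.Injective (algebraMap ℤ[X] (PowerSeries ℚ)) := by
  intro p q h
  ext n
  have := congrArg (PowerSeries.coeff n) h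
  rw [coeff_algebraMap_series, coeff_algebraMap_series] at this
  exact_mod_cast this

instance : FaithfulSMul ℤ[X] (PowerSeries ℚ) :=
  (faithfulSMul_iff_algebraMap_injective _ _).2 algebraMap_series_injective

instance : DifferentialAlgebra ℤ[X] (PowerSeries ℚ) where
  deriv_algebraMap p := by
    ext n
    rw [coeff_seriesEuler, coeff_algebraMap_series, coeff_algebraMap_series, coeff_polyEuler]
    push_cast; ring

lemma algebraMap_X_series : algebraMap ℤ[X] (PowerSeries ℚ) X = PowerSeries.X := by
  ext n
  rw [coeff_algebraMap_series, PowerSeries.coeff_X, coeff_X]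
  simp [eq_comm]

/-- The series `∑ C(2n,n) zⁿ / n!`. -/
def besselSeries : PowerSeries ℚ := PowerSeries.mk fun n ↦ (n.centralBinom : ℚ) / n !

/-- Coefficients of the non-logarithmic part of the second solution. -/
def secondCoeff : ℕ → ℚ
  | 0 => 0
  | n + 1 => ((4 * n + 2) * secondCoeff n + 4 * PowerSeries.coeff n besselSeries
      - 2 * (n + 1) * PowerSeries.coeff (n + 1) besselSeries) / (n + 1) ^ 2

/-- The non-logarithmic part of the second solution. -/
def secondSeries : PowerSeries ℚ := PowerSeries.mk secondCoeff

lemma coeff_besselSeries_succ (n : ℕ) : ((n : ℚ) + 1) ^ 2 * PowerSeries.coeff (n + 1) besselSeries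
    = (4 * n + 2) * PowerSeries.coeff n besselSeries := by
  have h : ((n : ℚ) + 1) * ((n + 1).centralBinom : ℚ) = 2 * (2 * n + 1) * n.centralBinom := by
    exact_mod_cast Nat.succ_mul_centralBinom_succ n
  simp only [besselSeries, PowerSeries.coeff_mk, Nat.factorial_succ]
  have h1 : (n ! : ℚ) ≠ 0 := by positivity
  have h2 : (n : ℚ) + 1 ≠ 0 := by positivity
  push_cast
  field_simp
  linear_combination h

lemma constantCoeff_besselSeries : PowerSeries.constantCoeff besselSeries = 1 := by
  simp [besselSeries]

lemma euler_euler_besselSeries : besselSeries′′ =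
    PowerSeries.X * (4 * besselSeries′ + 2 * besselSeries) := by
  ext n
  rw [coeff_seriesEuler, coeff_seriesEuler]
  cases n with
  | zero => simp
  | succ n =>
    rw [PowerSeries.coeff_succ_X_mul, map_add]
    have h4 : (4 : PowerSeries ℚ) = PowerSeries.C 4 := (map_ofNat PowerSeries.C 4).symm
    have h2 : (2 : PowerSeries ℚ) = PowerSeries.C 2 := (map_ofNat PowerSeries.C 2).symm
    rw [h4, h2, PowerSeries.coeff_C_mul, PowerSeries.coeff_C_mul, coeff_seriesEuler]
    have := coeff_besselSeries_succ n
    push_cast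
    linear_combination this

lemma euler_euler_secondSeries : secondSeries′′ + 2 * besselSeries′ =
    PowerSeries.X * (4 * besselSeries + 4 * secondSeries′ + 2 * secondSeries) := by
  have h4 : (4 : PowerSeries ℚ) = PowerSeries.C 4 := (map_ofNat PowerSeries.C 4).symm
  have h2 : (2 : PowerSeries ℚ) = PowerSeries.C 2 := (map_ofNat PowerSeries.C 2).symm
  rw [h4, h2]
  ext n
  rw [map_add, coeff_seriesEuler, coeff_seriesEuler, PowerSeries.coeff_C_mul, coeff_seriesEuler]
  cases n with
  | zero => simp
  | succ n =>
    rw [PowerSeries.coeff_succ_X_mul, map_add, map_add]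
    rw [PowerSeries.coeff_C_mul, PowerSeries.coeff_C_mul, PowerSeries.coeff_C_mul,
      coeff_seriesEuler]
    have h3 : PowerSeries.coeff (n + 1) secondSeries * ((n : ℚ) + 1) ^ 2 =
        ((4 * n + 2) * PowerSeries.coeff n secondSeries + 4 * PowerSeries.coeff n besselSeries
      - 2 * (n + 1) * PowerSeries.coeff (n + 1) besselSeries) := by
      simp only [secondSeries, PowerSeries.coeff_mk]
      rw [secondCoeff, div_mul_cancel₀]
      positivity
    push_cast
    linear_combination h3

/-- Two coupled first-order recursions that both terminate pin down the parameter `e`. -/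
lemma two_mul_eq_of_terminating_recursion {k : ℕ} {S R : ℕ → ℤ} {a e m : ℤ}
    (hS0 : S 0 = 0) (hS1 : S 1 ≠ 0) (hSk : S (k + 2) = 0) (hRk : R (k + 2) = 0)
    (hS : ∀ j ≤ k, (j + 1 : ℤ) * S (j + 2) = (a - 4 * (k - j)) * S (j + 1))
    (hR : ∀ j ≤ k, (j + 1 : ℤ) * R (j + 2) = (a - 4 * (k - j)) * R (j + 1)
      + (e - m - j) * S (j + 1) - 2 * (k - j + 1) * S j) : 2 * e = 2 * m + k := by
  classical
  have hex : ∃ j, S (j + 2) = 0 := ⟨k, hSk⟩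
  obtain ⟨j0, hj0, hmin⟩ : ∃ j0, S (j0 + 2) = 0 ∧ ∀ j < j0, S (j + 2) ≠ 0 :=
    ⟨Nat.find hex, Nat.find_spec hex, fun j hj ↦ Nat.find_min hex hj⟩
  have hj0k : j0 ≤ k := by
    by_contra! h
    exact hmin k h hSk
  have hne : S (j0 + 1) ≠ 0 := by
    cases j0 with
    | zero => exact hS1
    | succ j => exact hmin j (Nat.lt_succ_self j)
  have ha : a = 4 * (k - j0) := by
    have := hS j0 hj0k
    rw [hj0, mul_zero, eq_comm, mul_eq_zero] at this
    have := this.resolve_right hne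
    linarith
  have hprev : (j0 : ℤ) * S (j0 + 1) = -4 * S j0 := by
    cases j0 with
    | zero => simp [hS0]
    | succ j =>
      have := hS j (by omega)
      rw [ha] at this
      push_cast at this ⊢
      linear_combination this
  have hzero : ∀ j, j0 + j ≤ k → S (j0 + j + 2) = 0 := by
    intro j
    induction j with
    | zero => intro _; exact hj0
    | succ j ih =>
      intro hj
      have h1 := hS (j0 + (j + 1)) hj
      have h2 := ih (by omega)
      rw [show j0 + (j + 1) + 1 = j0 + j + 2 by ring, h2, mul_zero, mul_eq_zero] at h1
      exact h1.resolve_left (by positivity)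
  have hr : 4 * R (j0 + 2) = 2 * (k - j0) * S (j0 + 1) := by
    rcases hj0k.eq_or_lt with h | h
    · subst h
      simp [hRk]
    · have key : ∀ i, i + (j0 + 1) ≤ k → R (k - i + 2) = 0 := by
        intro i
        induction i with
        | zero => intro _; exact hRk
        | succ i ih =>
          intro hi
          have h1 := hR (k - i) (by omega)
          obtain ⟨t, ht⟩ : ∃ t, k - i = j0 + (t + 1) + 1 := ⟨k - i - j0 - 2, by omega⟩
          have ht2 : k - (i + 1) = j0 + (t + 1) := by omega
          rw [ih (by omega), ht, show S (j0 + (t + 1) + 1 + 1) = 0 from hzero (t + 1) (by omega),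
            show S (j0 + (t + 1) + 1) = 0 from hzero t (by omega), ha] at h1
          rw [ht2]
          rw [show j0 + (t + 1) + 1 + 1 = j0 + (t + 1) + 2 by ring] at h1
          generalize R (j0 + (t + 1) + 2) = x at h1 ⊢
          have : 4 * ((t : ℤ) + 2) * x = 0 := by
            push_cast at h1
            linear_combination -h1
          exact (mul_eq_zero.1 this).resolve_left (by positivity)
      have h1 := hR (j0 + 1) h
      have h2 := key (k - (j0 + 1)) (by omega)
      rw [show k - (k - (j0 + 1)) = j0 + 1 by omega] at h2
      rw [h2, ha, show S (j0 + 1 + 1) = 0 from hj0] at h1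
      push_cast at h1
      linear_combination -h1
  have h3 := hR j0 hj0k
  rw [ha] at h3
  apply mul_left_cancel₀ (mul_ne_zero two_ne_zero hne)
  linear_combination (j0 + 1) * hr - 4 * h3 + 2 * (k - j0 + 1) * hprev

/-- The polynomial recursion attached to a Darboux polynomial of the Riccati equation
has no nonzero terminating solution. -/
lemma false_of_terminating_poly_recursion {k : ℕ} (hk : 1 ≤ k) {P : ℕ → ℤ[X]} {l : ℤ[X]}
    (hP0 : P 0 = 0) (hP1 : P 1 ≠ 0) (hPk : P (k + 2) = 0)
    (hP : ∀ j ≤ k, C (j + 1 : ℤ) * P (j + 2) = l * P (j + 1)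
      - C (4 * (k - j) : ℤ) * (X * P (j + 1)) - (P (j + 1))′
      - C (2 * (k - j + 1) : ℤ) * (X * P j)) : False := by
  classical
  have hdeg : l.natDegree ≤ 1 := by
    by_contra! hl
    obtain ⟨j, hj, hmax⟩ := Finset.exists_max_image (Finset.range (k + 1))
      (fun j ↦ (P (j + 1)).natDegree) ⟨0, by simp⟩
    rw [Finset.mem_range] at hj
    obtain ⟨M, hM⟩ : ∃ M, M = (P (j + 1)).natDegree := ⟨_, rfl⟩
    obtain ⟨j, hj, hM, hne⟩ : ∃ j ≤ k, (P (j + 1)).natDegree = M ∧ P (j + 1) ≠ 0 := by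
      by_cases h0 : P (j + 1) = 0
      · refine ⟨0, by omega, ?_, hP1⟩
        have := hmax 0 (by simp)
        simp only [h0, natDegree_zero, hM] at this ⊢
        omega
      · exact ⟨j, by omega, hM.symm, h0⟩
    have hall : ∀ i ≤ k + 2, ∀ n > M, (P i).coeff n = 0 := by
      intro i hi n hn
      rcases Nat.eq_zero_or_pos i with h | h
      · simp [h, hP0]
      rcases hi.eq_or_lt with h' | h'
      · simp [h', hPk]
      obtain ⟨i, rfl⟩ : ∃ t, i = t + 1 := ⟨i - 1, by omega⟩
      apply coeff_eq_zero_of_natDegree_lt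
      have := hmax i (by simp; omega)
      omega
    have h1 := congrArg (fun p ↦ p.coeff (l.natDegree + M)) (hP j hj)
    obtain ⟨t, ht⟩ : ∃ t, l.natDegree + M = t + 1 := ⟨l.natDegree + M - 1, by omega⟩
    simp only [coeff_sub, coeff_C_mul, coeff_polyEuler] at h1
    rw [← hM, coeff_mul_degree_add_degree, hM, ht, coeff_X_mul, coeff_X_mul,
      hall (j + 2) (by omega) _ (by omega), hall (j + 1) (by omega) _ (by omega),
      hall (j + 1) (by omega) _ (by omega), hall j (by omega) _ (by omega)] at h1
    have : l.leadingCoeff * (P (j + 1)).leadingCoeff = 0 := by linear_combination -h1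
    rcases mul_eq_zero.1 this with h | h
    · rw [leadingCoeff_eq_zero] at h
      simp [h] at hl
    · exact hne (leadingCoeff_eq_zero.1 h)
  obtain ⟨a, e, hl⟩ := exists_eq_X_add_C_of_natDegree_le_one hdeg
  have hc0 : ∀ j ≤ k, (j + 1 : ℤ) * (P (j + 2)).coeff 0 = e * (P (j + 1)).coeff 0 := by
    intro j hj
    have := congrArg (fun p ↦ p.coeff 0) (hP j hj)
    simp only [coeff_sub, coeff_C_mul, coeff_polyEuler, hl, add_mul, mul_assoc, coeff_add] at this
    simp only [mul_coeff_zero, coeff_X_zero] at this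
    push_cast at this
    linear_combination this
  have hc : ∀ j ≤ k, ∀ n, (j + 1 : ℤ) * (P (j + 2)).coeff (n + 1) = (a - 4 * (k - j)) *
      (P (j + 1)).coeff n + (e - (n + 1)) * (P (j + 1)).coeff (n + 1)
      - 2 * (k - j + 1) * (P j).coeff n := by
    intro j hj n
    have := congrArg (fun p ↦ p.coeff (n + 1)) (hP j hj)
    simp only [coeff_sub, coeff_C_mul, coeff_polyEuler, hl, add_mul, mul_assoc, coeff_add,
      coeff_X_mul] at this
    push_cast at this
    linear_combination this
  clear hP hdeg
  set m := (P 1).natDegree with hm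
  have he : e ≤ m := by
    have hex : ∃ n, ∃ j ≤ k, (P (j + 1)).coeff n ≠ 0 :=
      ⟨m, 0, by omega, by rw [hm]; simpa using hP1⟩
    obtain ⟨o, ⟨j1, hj1, hj1'⟩, hmin⟩ :
        ∃ o, (∃ j ≤ k, (P (j + 1)).coeff o ≠ 0) ∧
          ∀ n < o, ¬ ∃ j ≤ k, (P (j + 1)).coeff n ≠ 0 :=
      ⟨Nat.find hex, Nat.find_spec hex, fun n hn ↦ Nat.find_min hex hn⟩
    have hom : o ≤ m := by
      by_contra! h
      exact hmin m h ⟨0, by omega, by rw [hm]; simpa using hP1⟩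
    obtain ⟨j, hj, hjmax⟩ := Finset.exists_max_image
      ((Finset.range (k + 1)).filter fun j ↦ (P (j + 1)).coeff o ≠ 0) id
      ⟨j1, by simp [hj1']; omega⟩
    simp only [Finset.mem_filter, Finset.mem_range, id] at hj hjmax
    have hnext : (P (j + 2)).coeff o = 0 := by
      by_cases h : j = k
      · rw [h, hPk, coeff_zero]
      · by_contra h0
        have := hjmax (j + 1) ⟨by omega, h0⟩
        omega
    have heo : e = o := by
      cases o with
      | zero =>
        have := hc0 j (by omega)
        rw [hnext, mul_zero, eq_comm, mul_eq_zero] at this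
        exact this.resolve_right hj.2
      | succ o =>
        have h1 := hc j (by omega) o
        have h2 : ∀ i ≤ k + 1, (P i).coeff o = 0 := by
          intro i hi
          cases i with
          | zero => simp [hP0]
          | succ i =>
            by_contra h
            exact hmin o (by omega) ⟨i, by omega, h⟩
        rw [hnext, h2 _ (by omega), h2 _ (by omega)] at h1
        have : (e - (o + 1)) * (P (j + 1)).coeff (o + 1) = 0 := by linear_combination -h1
        have := (mul_eq_zero.1 this).resolve_right hj.2
        push_cast
        linarith
    omega
  have hdeg : ∀ j ≤ k + 1, (∀ n > m + j, (P (j + 1)).coeff n = 0) ∧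
      (∀ n ≥ m + j, (P j).coeff n = 0) := by
    intro j
    induction j with
    | zero =>
      intro _
      refine ⟨fun n hn ↦ coeff_eq_zero_of_natDegree_lt (by simpa using hn), by simp [hP0]⟩
    | succ j ih =>
      intro hj
      obtain ⟨h1, h2⟩ := ih (by omega)
      refine ⟨fun n hn ↦ ?_, fun n hn ↦ h1 n (by omega)⟩
      obtain ⟨n, rfl⟩ : ∃ t, n = t + 1 := ⟨n - 1, by omega⟩
      have := hc j (by omega) n
      rw [h1 n (by omega), h1 (n + 1) (by omega), h2 n (by omega)] at this
      simp only [mul_zero, add_zero, sub_zero] at this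
      exact (mul_eq_zero.1 this).resolve_left (by positivity)
  have key := two_mul_eq_of_terminating_recursion (k := k) (a := a) (e := e) (m := m)
    (S := fun j ↦ (X * P j).coeff (m + j)) (R := fun j ↦ (X * X * P j).coeff (m + j))
  have key := key (by simp [hP0]) (by simpa [hm] using hP1) (by simp [hPk]) (by simp [hPk])
    (by
      intro j hj
      have := hc j hj (m + j)
      have h2 := (hdeg j (by omega))
      rw [h2.2 _ le_rfl, h2.1 (m + j + 1) (by omega)] at this
      rw [← add_assoc, ← add_assoc, show m + j + 2 = m + j + 1 + 1 by ring, coeff_X_mul,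
        coeff_X_mul]
      linear_combination this)
    (by
      intro j hj
      rw [← add_assoc, ← add_assoc, show m + j + 2 = m + j + 1 + 1 by ring, mul_assoc X X,
        mul_assoc X X, coeff_X_mul, coeff_X_mul, coeff_X_mul, coeff_X_mul]
      rcases Nat.eq_zero_or_pos (m + j) with h | h
      · obtain ⟨rfl, hm0⟩ : j = 0 ∧ m = 0 := by omega
        have := hc0 0 (by omega)
        simp only [hm0, hP0] at this ⊢
        simpa using this
      · obtain ⟨n, hn⟩ : ∃ t, m + j = t + 1 := ⟨m + j - 1, by omega⟩
        have := hc j hj n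
        rw [hn, coeff_X_mul, coeff_X_mul]
        have hn' : (m : ℤ) + j = n + 1 := by exact_mod_cast hn
        rw [show e - (m : ℤ) - j = e - (n + 1) by linarith]
        linear_combination this)
  omega

/-- The derivation of `ℤ[z][T]` extending `z d/dz` with `T ↦ 4zT + 2z - T²`. -/
def riccatiDeriv (q : ℤ[X][X]) : ℤ[X][X] :=
  Differential.mapCoeffs q + (C (4 * X) * X + C (2 * X) - X * X) * derivative q

lemma riccatiDeriv_mul (p q : ℤ[X][X]) :
    riccatiDeriv (p * q) = p * riccatiDeriv q + q * riccatiDeriv p := by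
  simp only [riccatiDeriv, derivative_mul, Derivation.leibniz, smul_eq_mul]
  ring

lemma riccatiDeriv_C (a : ℤ[X]) : riccatiDeriv (C a) = C a′ := by
  simp [riccatiDeriv]

lemma coeff_riccatiDeriv_zero (q : ℤ[X][X]) :
    (riccatiDeriv q).coeff 0 = (q.coeff 0)′ + 2 * X * q.coeff 1 := by
  simp only [riccatiDeriv, sub_mul, add_mul, mul_assoc, coeff_add, coeff_sub, coeff_C_mul,
    coeff_X_mul_zero, coeff_derivative, Differential.coeff_mapCoeffs]
  push_cast
  ring

lemma coeff_riccatiDeriv_succ (q : ℤ[X][X]) (i : ℕ) :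
    (riccatiDeriv q).coeff (i + 1) = (q.coeff (i + 1))′ + 4 * X * ((i : ℤ[X]) + 1) * q.coeff (i + 1)
      + 2 * X * ((i : ℤ[X]) + 2) * q.coeff (i + 2) - (i : ℤ[X]) * q.coeff i := by
  simp only [riccatiDeriv, sub_mul, add_mul, mul_assoc, coeff_add, coeff_sub, coeff_C_mul,
    coeff_X_mul, coeff_derivative, Differential.coeff_mapCoeffs]
  cases i with
  | zero => simp only [coeff_X_mul_zero]; push_cast; ring
  | succ i => simp only [coeff_X_mul, coeff_derivative]; push_cast; ring

/-- The Riccati derivation has no Darboux polynomial of positive degree with the cofactor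
coming from the twisted action. -/
lemma natDegree_eq_zero_of_darboux {q : ℤ[X][X]} {l : ℤ[X]} (hq : q ≠ 0)
    (h : riccatiDeriv q + (q.natDegree : ℤ[X][X]) * (X * q) = C l * q) : q.natDegree = 0 := by
  by_contra hk
  set k := q.natDegree with hkdef
  have h0 := congrArg (fun p ↦ p.coeff 0) h
  have hs : ∀ i, _ := fun i ↦ congrArg (fun p ↦ p.coeff (i + 1)) h
  simp only [coeff_add, coeff_natCast_mul, coeff_X_mul_zero, coeff_riccatiDeriv_zero,
    coeff_C_mul] at h0
  simp only [coeff_add, coeff_natCast_mul, coeff_X_mul, coeff_riccatiDeriv_succ,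
    coeff_C_mul] at hs
  refine false_of_terminating_poly_recursion (k := k) (l := l)
    (P := fun j ↦ if j ≤ k + 1 then q.coeff (k + 1 - j) else 0) (by omega) ?_ ?_ ?_ ?_
  · simpa using coeff_eq_zero_of_natDegree_lt (by omega)
  · simpa [hkdef] using hq
  · simp
  · intro j hj
    simp only [show j + 1 ≤ k + 1 by omega, show j ≤ k + 1 by omega, if_true]
    rw [show k + 1 - (j + 1) = k - j by omega, show k + 1 - j = k - j + 1 by omega]
    obtain ⟨i, hi⟩ : ∃ i, i = k - j := ⟨_, rfl⟩
    have hji : (j : ℤ) = k - i := by omega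
    rw [← hi, hji]
    cases i with
    | zero =>
      simp only [show ¬ (j + 2 ≤ k + 1) by omega, if_false]
      simp only [Nat.cast_zero, sub_zero, sub_self, mul_zero, C_0, zero_mul, zero_add, mul_one,
        C_ofNat]
      linear_combination h0
    | succ i =>
      simp only [show j + 2 ≤ k + 1 by omega, if_true, show k + 1 - (j + 2) = i by omega]
      simp only [C_mul, C_add, C_sub, C_ofNat, C_1, map_natCast]
      have := hs i
      push_cast
      linear_combination this

/-- The logarithmic derivative of `besselSeries`. -/
def logDerivSeries : PowerSeries ℚ := besselSeries′ * besselSeries⁻¹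

lemma besselSeries_mul_inv : besselSeries * besselSeries⁻¹ = 1 :=
  PowerSeries.mul_inv_cancel _ (by simp [constantCoeff_besselSeries])

lemma besselSeries_ne_zero : besselSeries ≠ 0 := left_ne_zero_of_mul_eq_one besselSeries_mul_inv

lemma besselSeries_mul_logDerivSeries : besselSeries * logDerivSeries = besselSeries′ := by
  rw [logDerivSeries]
  linear_combination besselSeries′ * besselSeries_mul_inv

lemma euler_logDerivSeries : logDerivSeries′ =
    PowerSeries.X * (4 * logDerivSeries + 2) - logDerivSeries * logDerivSeries := by
  apply mul_left_cancel₀ besselSeries_ne_zero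
  have h := congrArg (fun f ↦ f′) besselSeries_mul_logDerivSeries
  simp only [Derivation.leibniz, smul_eq_mul] at h
  rw [euler_euler_besselSeries, ← besselSeries_mul_logDerivSeries] at h
  linear_combination h

lemma aeval_riccatiDeriv (q : ℤ[X][X]) :
    aeval logDerivSeries (riccatiDeriv q) = (aeval logDerivSeries q)′ := by
  rw [Differential.deriv_aeval_eq, riccatiDeriv, map_add, map_mul, euler_logDerivSeries]
  simp only [map_sub, map_add, map_mul, aeval_X, aeval_C, algebraMap_X_series, map_ofNat]
  ring

lemma natDegree_riccatiDeriv_add_le (q : ℤ[X][X]) {k : ℕ} (hk : q.natDegree = k) :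
    (riccatiDeriv q + (k : ℤ[X][X]) * (X * q)).natDegree ≤ k := by
  rw [natDegree_le_iff_coeff_eq_zero]
  intro n hn
  obtain ⟨n, rfl⟩ : ∃ t, n = t + 1 := ⟨n - 1, by omega⟩
  rw [coeff_add, coeff_natCast_mul, coeff_X_mul, coeff_riccatiDeriv_succ]
  rw [coeff_eq_zero_of_natDegree_lt (n := n + 1) (by omega),
    coeff_eq_zero_of_natDegree_lt (n := n + 2) (by omega)]
  rcases (show k ≤ n by omega).eq_or_lt with h | h
  · simp [h]
  · rw [coeff_eq_zero_of_natDegree_lt (n := n) (by omega)]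
    simp

lemma transcendental_logDerivSeries : Transcendental ℤ[X] logDerivSeries := by
  classical
  let _ : NormalizedGCDMonoid ℤ[X] := UniqueFactorizationMonoid.toNormalizedGCDMonoid _
  intro halg
  have hex : ∃ k, ∃ q : ℤ[X][X], q ≠ 0 ∧ aeval logDerivSeries q = 0 ∧ q.natDegree = k := by
    obtain ⟨q, h1, h2⟩ := halg
    exact ⟨_, q, h1, h2, rfl⟩
  obtain ⟨k, ⟨q, hq0, hqt, hqk⟩, hmin⟩ : ∃ k, (∃ q : ℤ[X][X], q ≠ 0 ∧
      aeval logDerivSeries q = 0 ∧ q.natDegree = k) ∧ ∀ n < k, ¬ ∃ q : ℤ[X][X], q ≠ 0 ∧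
      aeval logDerivSeries q = 0 ∧ q.natDegree = n :=
    ⟨Nat.find hex, Nat.find_spec hex, fun n hn ↦ Nat.find_min hex hn⟩
  obtain ⟨q, hq0, hqt, hqk, hprim⟩ : ∃ q : ℤ[X][X], q ≠ 0 ∧ aeval logDerivSeries q = 0 ∧
      q.natDegree = k ∧ q.IsPrimitive := by
    refine ⟨q.primPart, q.primPart_ne_zero, ?_, q.natDegree_primPart.trans hqk,
      q.isPrimitive_primPart⟩
    rw [q.eq_C_content_mul_primPart, map_mul, aeval_C, mul_eq_zero] at hqt
    refine hqt.resolve_left fun h ↦ hq0 ?_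
    rw [map_eq_zero_iff _ algebraMap_series_injective, content_eq_zero_iff] at h
    exact h
  set d := riccatiDeriv q + (k : ℤ[X][X]) * (X * q) with hd
  have hdt : aeval logDerivSeries d = 0 := by
    rw [hd, map_add, aeval_riccatiDeriv, map_mul, map_mul, hqt]
    simp
  have hdk : d.natDegree ≤ k := natDegree_riccatiDeriv_add_le q hqk
  have hrel : C (q.coeff k) * d = C (d.coeff k) * q := by
    rw [← sub_eq_zero]
    by_contra hne
    have hle : (C (q.coeff k) * d - C (d.coeff k) * q).natDegree ≤ k := by
      refine (natDegree_sub_le _ _).trans (max_le ?_ ?_)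
      · exact (natDegree_C_mul_le _ _).trans hdk
      · exact (natDegree_C_mul_le _ _).trans hqk.le
    rcases hle.eq_or_lt with h | h
    · apply hne
      rw [← leadingCoeff_eq_zero, leadingCoeff, h]
      simp [mul_comm]
    · exact hmin _ h ⟨_, hne, by simp [hqt, hdt], rfl⟩
  have hlc : q.coeff k ≠ 0 := by rw [← hqk]; simpa using hq0
  obtain ⟨l, hl⟩ : q.coeff k ∣ d.coeff k := by
    have h1 := associated_content_C_mul (q.coeff k) d
    have h2 := associated_content_C_mul (d.coeff k) q
    rw [hprim.content_eq_one, mul_one] at h2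
    rw [hrel] at h1
    exact (Dvd.intro _ rfl).trans (h1.symm.trans h2).dvd
  have hdarb : riccatiDeriv q + (q.natDegree : ℤ[X][X]) * (X * q) = C l * q := by
    rw [hqk, ← hd]
    apply mul_left_cancel₀ (C_ne_zero.2 hlc)
    rw [hrel, hl, C_mul, mul_assoc]
  have hk0 := natDegree_eq_zero_of_darboux hq0 hdarb
  rw [eq_C_of_natDegree_eq_zero hk0, aeval_C, map_eq_zero_iff _ algebraMap_series_injective] at hqt
  rw [← hqk, hk0] at hlc
  exact hlc hqt

lemma natDegree_eq_zero_of_dvd_riccatiDeriv {u : ℤ[X][X]} (hu : u ≠ 0) (h : u ∣ riccatiDeriv u) :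
    u.natDegree = 0 := by
  obtain ⟨c, hc⟩ := h
  obtain ⟨k, hk⟩ : ∃ k, k = u.natDegree := ⟨_, rfl⟩
  have h1 := natDegree_riccatiDeriv_add_le u hk.symm
  rw [hc, show u * c + (k : ℤ[X][X]) * (X * u) = (c + (k : ℤ[X][X]) * X) * u by ring] at h1
  have h2 : (c + (k : ℤ[X][X]) * X).natDegree = 0 := by
    by_cases h0 : c + (k : ℤ[X][X]) * X = 0
    · simp [h0]
    · rw [natDegree_mul h0 hu] at h1
      omega
  refine natDegree_eq_zero_of_darboux (l := (c + (k : ℤ[X][X]) * X).coeff 0) hu ?_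
  rw [← eq_C_of_natDegree_eq_zero h2, hc, ← hk]
  ring

lemma eq_zero_of_wronskian {a b : ℤ[X][X]} {c : ℤ} (ha : a ≠ 0) (hb : b ≠ 0)
    (h : a * riccatiDeriv b - b * riccatiDeriv a = (c : ℤ[X][X]) * X * a * b) : c = 0 := by
  obtain ⟨u, v, g, hrel, rfl, rfl⟩ := UniqueFactorizationMonoid.exists_reduced_factors' a b hb
  have hg : g ≠ 0 := left_ne_zero_of_mul ha
  have hu : u ≠ 0 := right_ne_zero_of_mul ha
  have hv : v ≠ 0 := right_ne_zero_of_mul hb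
  have h : u * riccatiDeriv v - v * riccatiDeriv u = (c : ℤ[X][X]) * X * u * v := by
    apply mul_left_cancel₀ (mul_ne_zero hg hg)
    rw [riccatiDeriv_mul, riccatiDeriv_mul] at h
    linear_combination h
  have hu0 := natDegree_eq_zero_of_dvd_riccatiDeriv hu
    (hrel.dvd_of_dvd_mul_left ⟨riccatiDeriv v - (c : ℤ[X][X]) * X * v, by linear_combination -h⟩)
  have hv0 := natDegree_eq_zero_of_dvd_riccatiDeriv hv
    (hrel.symm.dvd_of_dvd_mul_left
      ⟨riccatiDeriv u + (c : ℤ[X][X]) * X * u, by linear_combination h⟩)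
  obtain ⟨a, rfl⟩ : ∃ a, u = C a := ⟨_, eq_C_of_natDegree_eq_zero hu0⟩
  obtain ⟨b, rfl⟩ : ∃ b, v = C b := ⟨_, eq_C_of_natDegree_eq_zero hv0⟩
  rw [C_ne_zero] at hu hv
  have := congrArg (fun p ↦ p.coeff 1) h
  simp only [riccatiDeriv_C, ← C_mul, ← C_sub, mul_assoc, coeff_C_succ] at this
  rw [coeff_intCast_mul, coeff_X_mul, coeff_C_zero, eq_comm, mul_eq_zero] at this
  exact_mod_cast this.resolve_right (mul_ne_zero hu hv)

lemma eq_zero_of_sum_besselSeries_pow (s : Finset ℕ) (q : ℕ → ℤ[X][X])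
    (h : ∑ k ∈ s, besselSeries ^ k * aeval logDerivSeries (q k) = 0) : ∀ k ∈ s, q k = 0 := by
  classical
  induction hn : s.card using Nat.strong_induction_on generalizing s q with
  | _ n ih =>
  subst hn
  by_contra! hcon
  obtain ⟨k0, hk0, hq0⟩ := hcon
  have hlt : (s.erase k0).card < s.card := Finset.card_erase_lt_of_mem hk0
  by_cases hall : ∃ k1 ∈ s, k1 ≠ k0
  · obtain ⟨k1, hk1, hne⟩ := hall
    have hq1 : q k1 ≠ 0 := by
      intro h1
      refine hq0 (ih _ (Finset.card_erase_lt_of_mem hk1) (s.erase k1) q ?_ rfl k0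
        (Finset.mem_erase.2 ⟨hne.symm, hk0⟩))
      rw [← Finset.add_sum_erase _ _ hk1, h1, map_zero, mul_zero, zero_add] at h
      exact h
    have hder : ∑ k ∈ s, besselSeries ^ k *
        aeval logDerivSeries (riccatiDeriv (q k) + (k : ℤ[X][X]) * X * q k) = 0 := by
      have := congrArg (fun f ↦ f′) h
      simp only [map_sum, Derivation.leibniz, smul_eq_mul, map_zero, Derivation.leibniz_pow] at this
      rw [← this]
      refine Finset.sum_congr rfl fun k _ ↦ ?_
      rw [map_add, aeval_riccatiDeriv, map_mul, map_mul, aeval_X, map_natCast, nsmul_eq_mul,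
        ← besselSeries_mul_logDerivSeries]
      cases k with
      | zero => simp
      | succ k => rw [Nat.add_sub_cancel]; ring
    have hnew : ∑ k ∈ s.erase k0, besselSeries ^ k * aeval logDerivSeries
        (q k0 * (riccatiDeriv (q k) + (k : ℤ[X][X]) * X * q k)
          - q k * (riccatiDeriv (q k0) + (k0 : ℤ[X][X]) * X * q k0)) = 0 := by
      rw [Finset.sum_erase _ (by simp [mul_comm])]
      simp only [map_sub, map_mul (aeval logDerivSeries) (q k0),
        map_mul (aeval logDerivSeries) (q _) (riccatiDeriv (q k0) + (k0 : ℤ[X][X]) * X * q k0),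
        mul_sub,
        Finset.sum_sub_distrib]
      simp only [mul_left_comm _ (aeval logDerivSeries (q k0)), ← mul_assoc (besselSeries ^ _)]
      simp only [← Finset.mul_sum, ← Finset.sum_mul]
      rw [h, hder]
      simp
    have := ih _ hlt _ _ hnew rfl k1 (Finset.mem_erase.2 ⟨hne, hk1⟩)
    have := eq_zero_of_wronskian (c := (k0 : ℤ) - k1) hq0 hq1 (by
      push_cast
      linear_combination this)
    omega
  · push Not at hall
    have : s = {k0} := Finset.eq_singleton_iff_unique_mem.2 ⟨hk0, hall⟩
    rw [this, Finset.sum_singleton, mul_eq_zero] at h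
    have h := h.resolve_left (pow_ne_zero _ besselSeries_ne_zero)
    exact hq0 ((transcendental_iff.1 transcendental_logDerivSeries) _ h)

/-- Algebraic independence of `besselSeries` and its derivative over `ℤ[z]`. -/
lemma algIndep_besselSeries (s : Finset ℕ) (p : ℕ → ℕ → ℤ[X])
    (h : ∑ k ∈ s, ∑ j ∈ Finset.range (k + 1), algebraMap ℤ[X] (PowerSeries ℚ) (p k j) *
      (besselSeries ^ (k - j) * besselSeries′ ^ j) = 0) : ∀ k ∈ s, ∀ j ≤ k, p k j = 0 := by
  intro k hk j hj
  have := eq_zero_of_sum_besselSeries_pow s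
    (fun k ↦ ∑ j ∈ Finset.range (k + 1), C (p k j) * X ^ j) (by
      rw [← h]
      refine Finset.sum_congr rfl fun k _ ↦ ?_
      rw [map_sum, Finset.mul_sum]
      refine Finset.sum_congr rfl fun j hj ↦ ?_
      rw [map_mul, map_pow, aeval_C, aeval_X, ← besselSeries_mul_logDerivSeries, mul_pow]
      have : besselSeries ^ k = besselSeries ^ (k - j) * besselSeries ^ j := by
        rw [← pow_add, Nat.sub_add_cancel (by simpa [Nat.lt_succ_iff] using hj)]
      rw [this]
      ring) k hk
  have := congrArg (fun p ↦ p.coeff j) this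
  simpa [finsetSum_coeff, coeff_C_mul, coeff_X_pow, Finset.sum_ite_eq, Nat.lt_succ_iff, hj]
    using this

/-- The operator on polynomials of degree at most `k` dual to differentiation of the
homogeneous forms of degree `k` in a solution and its derivative. -/
def twist (k : ℕ) (q : ℤ[X][X]) : ℤ[X][X] := riccatiDeriv q + (k : ℤ[X][X]) * (X * q)

lemma natDegree_twist_le {k : ℕ} {q : ℤ[X][X]} (hq : q.natDegree ≤ k) :
    (twist k q).natDegree ≤ k := by
  rw [natDegree_le_iff_coeff_eq_zero]
  intro n hn
  obtain ⟨n, rfl⟩ : ∃ t, n = t + 1 := ⟨n - 1, by omega⟩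
  rw [twist, coeff_add, coeff_natCast_mul, coeff_X_mul, coeff_riccatiDeriv_succ,
    coeff_eq_zero_of_natDegree_lt (n := n + 1) (by omega),
    coeff_eq_zero_of_natDegree_lt (n := n + 2) (by omega)]
  rcases (show k ≤ n by omega).eq_or_lt with h | h
  · simp [h]
  · rw [coeff_eq_zero_of_natDegree_lt (n := n) (by omega)]
    simp

lemma natDegree_iterate_twist_le {k : ℕ} {q : ℤ[X][X]} (hq : q.natDegree ≤ k) (i : ℕ) :
    ((twist k)^[i] q).natDegree ≤ k := by
  induction i with
  | zero => exact hq
  | succ i ih => rw [Function.iterate_succ_apply']; exact natDegree_twist_le ih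

lemma riccatiDeriv_add (p q : ℤ[X][X]) :
    riccatiDeriv (p + q) = riccatiDeriv p + riccatiDeriv q := by
  simp only [riccatiDeriv, map_add]
  ring

lemma twist_add (k : ℕ) (p q : ℤ[X][X]) : twist k (p + q) = twist k p + twist k q := by
  rw [twist, riccatiDeriv_add, twist, twist]
  ring

lemma twist_zero (k : ℕ) : twist k 0 = 0 := by simp [twist, riccatiDeriv]

lemma iterate_twist_zero (k i : ℕ) : (twist k)^[i] 0 = 0 :=
  Function.iterate_fixed (twist_zero k) i

lemma twist_C_mul (k : ℕ) (c : ℤ[X]) (q : ℤ[X][X]) :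
    twist k (C c * q) = C c′ * q + C c * twist k q := by
  rw [twist, twist, riccatiDeriv_mul, riccatiDeriv_C]
  ring

lemma riccatiDeriv_X_pow (n : ℕ) : riccatiDeriv (X ^ n) =
    C (n : ℤ[X]) * X ^ (n - 1) * (C (4 * X) * X + C (2 * X) - X * X) := by
  have : Differential.mapCoeffs (X ^ n : ℤ[X][X]) = 0 := by
    rw [Derivation.leibniz_pow, Differential.mapCoeffs_X]
    simp
  rw [riccatiDeriv, this, derivative_X_pow]
  ring

section Homogenization

variable {E : Type*} [CommRing E] [Algebra ℤ[X] E]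

/-- The value at `(a, b)` of the degree `k` homogenization of `q`. -/
def homValue (k : ℕ) (a b : E) : ℤ[X][X] →ₗ[ℤ[X]] E where
  toFun q := ∑ j ∈ Finset.range (k + 1), algebraMap ℤ[X] E (q.coeff j) * (a ^ (k - j) * b ^ j)
  map_add' p q := by simp [add_mul, Finset.sum_add_distrib]
  map_smul' c q := by simp [Finset.mul_sum, Algebra.smul_def, mul_assoc]

lemma homValue_apply (k : ℕ) (a b : E) (q : ℤ[X][X]) : homValue k a b q =
    ∑ j ∈ Finset.range (k + 1), algebraMap ℤ[X] E (q.coeff j) * (a ^ (k - j) * b ^ j) := rfl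

lemma homValue_monomial {k n : ℕ} (hn : n ≤ k) (a b : E) (c : ℤ[X]) :
    homValue k a b (C c * X ^ n) = algebraMap ℤ[X] E c * (a ^ (k - n) * b ^ n) := by
  rw [homValue_apply, Finset.sum_eq_single n]
  · simp
  · intro j _ hj
    simp [coeff_X_pow, hj]
  · intro h
    simp at h
    omega

variable [Differential E] [DifferentialAlgebra ℤ[X] E]

lemma deriv_homValue {k : ℕ} {a b : E} (hab : a′ = b)
    (hb : b′ = algebraMap ℤ[X] E X * (4 * b + 2 * a)) {q : ℤ[X][X]} (hq : q.natDegree ≤ k) :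
    (homValue k a b q)′ = homValue k a b (twist k q) := by
  refine induction_with_natDegree_le
    (fun q ↦ (homValue k a b q)′ = homValue k a b (twist k q)) k ?_ ?_ ?_ q hq
  · simp [twist_zero]
  · intro n c _ hn
    rw [homValue_monomial hn]
    simp only [Derivation.leibniz, Derivation.leibniz_pow, smul_eq_mul, nsmul_eq_mul, hab, hb,
      deriv_algebraMap]
    have htw : twist k (C c * X ^ n) = C c′ * X ^ n + (C ((n : ℤ[X]) * c * (4 * X)) * X ^ n
        + (C (((k - n : ℕ) : ℤ[X]) * c) * X ^ (n + 1)
        + C ((n : ℤ[X]) * c * (2 * X)) * X ^ (n - 1))) := by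
      rw [twist_C_mul, twist, riccatiDeriv_X_pow]
      have hkn : ((k - n : ℕ) : ℤ[X]) = k - n := by push_cast [hn]; ring
      rw [hkn]
      cases n with
      | zero =>
        simp only [Nat.cast_zero, C_0, zero_mul, C_sub, C_mul, map_natCast, pow_zero, zero_add]
        ring
      | succ n =>
        rw [Nat.add_sub_cancel]
        simp only [C_sub, C_mul, map_natCast]
        push_cast
        ring
    rw [htw, map_add, map_add, map_add, homValue_monomial hn, homValue_monomial hn,
      homValue_monomial (n := n - 1) (by omega)]
    have hlast : homValue k a b (C (((k - n : ℕ) : ℤ[X]) * c) * X ^ (n + 1)) =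
        (k - n : ℕ) * algebraMap ℤ[X] E c * (a ^ (k - n - 1) * b ^ (n + 1)) := by
      rcases hn.eq_or_lt with h | h
      · simp [h]
      · rw [homValue_monomial (by omega), Nat.sub_add_eq]
        simp
    rw [hlast]
    simp only [map_mul, map_natCast, map_ofNat]
    cases n with
    | zero =>
      simp only [Nat.cast_zero, pow_zero]
      ring
    | succ n =>
      rw [Nat.add_sub_cancel, show k - n = k - (n + 1) + 1 by omega]
      ring
  · intro f g _ _ hf hg
    simp only [twist_add, map_add, hf, hg]

end Homogenization

section Cyclic

variable {R : Type*} [CommRing R] [IsDomain R] {V : Type*} [AddCommGroup V] [Module R V]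

/-- If the orbit of `u` under a connection is linearly dependent, some nonzero functional on
coordinates kills the whole orbit. -/
lemma exists_annihilator_of_dependent {ι : Type*} [Fintype ι] (L : V →ₗ[R] (ι → R))
    (θ : R → R) (Δ : V → V) (hadd : ∀ x y, Δ (x + y) = Δ x + Δ y)
    (hsmul : ∀ c x, Δ (c • x) = θ c • x + c • Δ x) (u : V) (c : Fin (Fintype.card ι) → R)
    (hc : c ≠ 0) (h : ∑ i, c i • Δ^[i] u = 0) :
    ∃ phi : ι → R, phi ≠ 0 ∧ ∀ m, ∑ a, phi a * L (Δ^[m] u) a = 0 := by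
  classical
  have hΔ0 : Δ 0 = 0 := by simpa using hadd 0 0
  have hex : ∃ r, ∃ c : Fin (Fintype.card ι) → R, c ≠ 0 ∧ ∑ i, c i • Δ^[i] u = 0 ∧
      ∀ i, r ≤ i.1 → c i = 0 := ⟨Fintype.card ι, c, hc, h, fun i hi ↦ absurd i.2 (by omega)⟩
  obtain ⟨r, ⟨c, hc, h, hcr⟩, hmin⟩ : ∃ r, (∃ c : Fin (Fintype.card ι) → R, c ≠ 0 ∧
      ∑ i, c i • Δ^[i] u = 0 ∧ ∀ i, r ≤ i.1 → c i = 0) ∧ ∀ n < r, ¬ ∃ c :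
      Fin (Fintype.card ι) → R, c ≠ 0 ∧ ∑ i, c i • Δ^[i] u = 0 ∧ ∀ i, n ≤ i.1 → c i = 0 :=
    ⟨Nat.find hex, Nat.find_spec hex, fun n hn ↦ Nat.find_min hex hn⟩
  obtain ⟨r, rfl⟩ : ∃ t, r = t + 1 := by
    refine ⟨r - 1, ?_⟩
    by_contra h0
    exact hc (funext fun i ↦ hcr i (by omega))
  have hrlt : r < Fintype.card ι := by
    by_contra! hlt
    exact hmin r (by omega) ⟨c, hc, h, fun i hi ↦ absurd i.2 (by omega)⟩
  have hr0 : c ⟨r, hrlt⟩ ≠ 0 := by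
    intro h0
    refine hmin r (by omega) ⟨c, hc, h, fun i hi ↦ ?_⟩
    rcases hi.eq_or_lt with h1 | h1
    · rw [← h0]; congr; exact Fin.ext h1.symm
    · exact hcr i h1
  set N := Submodule.span R (Set.range fun i : Fin r ↦ Δ^[i] u) with hN
  let sat : V → Prop := fun x ↦ ∃ b : R, b ≠ 0 ∧ b • x ∈ N
  have sat_add : ∀ x y, sat x → sat y → sat (x + y) := by
    rintro x y ⟨b, hb, hx⟩ ⟨d, hd, hy⟩
    refine ⟨b * d, mul_ne_zero hb hd, ?_⟩
    rw [smul_add]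
    refine N.add_mem ?_ ?_
    · rw [mul_comm, mul_smul]; exact N.smul_mem _ hx
    · rw [mul_smul]; exact N.smul_mem _ hy
  have sat_smul : ∀ (d : R) x, sat x → sat (d • x) := by
    rintro d x ⟨b, hb, hx⟩
    exact ⟨b, hb, by rw [smul_comm]; exact N.smul_mem _ hx⟩
  have sat_of_smul : ∀ (d : R) x, d ≠ 0 → sat (d • x) → sat x := by
    rintro d x hd ⟨b, hb, hx⟩
    exact ⟨b * d, mul_ne_zero hb hd, by rwa [mul_smul]⟩
  have sat_mem : ∀ x ∈ N, sat x := fun x hx ↦ ⟨1, one_ne_zero, by simpa using hx⟩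
  have sat_neg : ∀ x, sat x → sat (-x) := fun x hx ↦ by simpa using sat_smul (-1) x hx
  have sat_r : sat (Δ^[r] u) := by
    refine ⟨c ⟨r, hrlt⟩, hr0, ?_⟩
    rw [Fintype.sum_eq_add_sum_compl ⟨r, hrlt⟩, add_eq_zero_iff_eq_neg] at h
    rw [h]
    refine N.neg_mem (N.sum_mem fun i hi ↦ ?_)
    by_cases hir : i.1 < r
    · exact N.smul_mem _ (Submodule.subset_span ⟨⟨i, hir⟩, rfl⟩)
    · have : c i = 0 := hcr i (by
        have : i ≠ ⟨r, hrlt⟩ := by simpa using hi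
        have : i.1 ≠ r := fun h ↦ this (Fin.ext h)
        omega)
      rw [this, zero_smul]
      exact N.zero_mem
  have sat_Δ_mem : ∀ x ∈ N, sat (Δ x) := by
    intro x hx
    induction hx using Submodule.span_induction with
    | mem x hx =>
      obtain ⟨i, rfl⟩ := hx
      simp only [← Function.iterate_succ_apply']
      by_cases hi : i.1 + 1 < r
      · exact sat_mem _ (Submodule.subset_span ⟨⟨i + 1, hi⟩, rfl⟩)
      · rw [show i.1.succ = r by omega]
        exact sat_r
    | zero => rw [hΔ0]; exact sat_mem _ N.zero_mem
    | add x y _ _ hx hy => rw [hadd]; exact sat_add _ _ hx hy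
    | smul b x hx ih =>
      rw [hsmul]
      exact sat_add _ _ (sat_mem _ (N.smul_mem _ hx)) (sat_smul _ _ ih)
  have sat_Δ : ∀ x, sat x → sat (Δ x) := by
    rintro x ⟨b, hb, hx⟩
    have h1 := sat_Δ_mem _ hx
    rw [hsmul] at h1
    apply sat_of_smul b _ hb
    have h2 := sat_add _ _ h1 (sat_neg _ (sat_smul (θ b) x ⟨b, hb, hx⟩))
    simpa using h2
  have hall : ∀ m, sat (Δ^[m] u) := by
    intro m
    by_cases hm : m < r
    · exact sat_mem _ (Submodule.subset_span ⟨⟨m, hm⟩, rfl⟩)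
    · obtain ⟨t, rfl⟩ : ∃ t, m = r + t := ⟨m - r, by omega⟩
      clear hm
      induction t with
      | zero => exact sat_r
      | succ t ih => rw [← add_assoc, Function.iterate_succ_apply']; exact sat_Δ _ ih
  let e := Fintype.equivFin ι
  let A : Matrix ι ι R := fun a b ↦ if (e a).1 < r then L (Δ^[e a] u) b else 0
  have hA : A.det = 0 := by
    apply Matrix.det_eq_zero_of_row_eq_zero (e.symm ⟨r, hrlt⟩)
    intro j
    simp [A]
  obtain ⟨phi, hphi, hAphi⟩ := Matrix.exists_mulVec_eq_zero_iff.2 hA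
  refine ⟨phi, hphi, fun m ↦ ?_⟩
  have hkill : ∀ x ∈ N, ∑ a, phi a * L x a = 0 := by
    intro x hx
    induction hx using Submodule.span_induction with
    | mem x hx =>
      obtain ⟨i, rfl⟩ := hx
      have := congrFun hAphi (e.symm ⟨i, by omega⟩)
      simpa [A, Matrix.mulVec, dotProduct, mul_comm] using this
    | zero => simp
    | add x y _ _ hx hy => simp [mul_add, Finset.sum_add_distrib, hx, hy]
    | smul b x _ hx =>
      simp only [map_smul, Pi.smul_apply, smul_eq_mul, mul_left_comm _ b, ← Finset.mul_sum, hx,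
        mul_zero]
  obtain ⟨b, hb, hm⟩ := hall m
  have := hkill _ hm
  simp only [map_smul, Pi.smul_apply, smul_eq_mul, mul_left_comm _ b, ← Finset.mul_sum] at this
  exact (mul_eq_zero.1 this).resolve_left hb

end Cyclic

/-- A power series whose logarithmic-type quotient has constant Euler derivative is constant. -/
lemma eq_smul_of_euler_quotient {f g : PowerSeries ℚ} {c : ℚ} (hf : f ≠ 0)
    (h : f * g′ - f′ * g = PowerSeries.C c * (f * f)) :
    c = 0 ∧ ∃ d : ℚ, g = PowerSeries.C d * f := by
  obtain ⟨e, w, hfw, hw⟩ : ∃ (e : ℕ) (w : PowerSeries ℚ), f = PowerSeries.X ^ e * w ∧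
      PowerSeries.constantCoeff w ≠ 0 := by
    have h1 := PowerSeries.coeff_order hf
    have h2 : PowerSeries.X ^ f.order.toNat ∣ f := PowerSeries.X_pow_order_dvd
    generalize f.order.toNat = e at h1 h2
    obtain ⟨w, rfl⟩ := h2
    refine ⟨e, w, rfl, ?_⟩
    have h3 := PowerSeries.coeff_X_pow_mul w e 0
    rw [zero_add] at h3
    rwa [h3, PowerSeries.coeff_zero_eq_constantCoeff] at h1
  have hw1 := PowerSeries.mul_inv_cancel w hw
  set G := g * w⁻¹ with hG
  have hg : g = G * w := by rw [hG]; linear_combination -g * hw1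
  have hw0 : w ≠ 0 := fun h0 ↦ hw (by simp [h0])
  have hX : (PowerSeries.X : PowerSeries ℚ) ^ e ≠ 0 := pow_ne_zero _ PowerSeries.X_ne_zero
  have hXe : ((PowerSeries.X : PowerSeries ℚ) ^ e)′ =
      (e : PowerSeries ℚ) * (PowerSeries.X : PowerSeries ℚ) ^ e := by
    ext n
    rw [coeff_seriesEuler, ← map_natCast (PowerSeries.C (R := ℚ)), PowerSeries.coeff_C_mul,
      PowerSeries.coeff_X_pow]
    split_ifs with h
    · simp [h]
    · simp
  have key : G′ - (e : PowerSeries ℚ) * G = PowerSeries.C c * PowerSeries.X ^ e := by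
    apply mul_left_cancel₀ (mul_ne_zero hX (mul_ne_zero hw0 hw0))
    rw [hfw, hg] at h
    simp only [Derivation.leibniz, smul_eq_mul, hXe] at h
    linear_combination h
  have hcoeff : ∀ n : ℕ, ((n : ℚ) - e) * PowerSeries.coeff n G = if n = e then c else 0 := by
    intro n
    have := congrArg (PowerSeries.coeff n) key
    rw [map_sub, coeff_seriesEuler, ← map_natCast (PowerSeries.C (R := ℚ)), PowerSeries.coeff_C_mul,
      PowerSeries.coeff_C_mul, PowerSeries.coeff_X_pow] at this
    rw [sub_mul, this]
    simp
  refine ⟨by simpa using (hcoeff e).symm, PowerSeries.coeff e G, ?_⟩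
  have : G = PowerSeries.C (PowerSeries.coeff e G) * PowerSeries.X ^ e := by
    ext n
    rw [PowerSeries.coeff_C_mul, PowerSeries.coeff_X_pow]
    split_ifs with h
    · simp [h]
    · have := hcoeff n
      rw [if_neg h, mul_eq_zero] at this
      rw [this.resolve_left (sub_ne_zero.2 (by exact_mod_cast h)), mul_zero]
  rw [hfw, hg]
  linear_combination w * this

/-- The derivation of `ℚ⟦z⟧[ℓ]` extending the Euler derivation with `ℓ ↦ 1`; here `ℓ` plays
the role of `log z`. -/
instance logEuler : Differential (PowerSeries ℚ)[X] :=
  differentialOfLeibniz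
    { toFun := fun q ↦ Differential.mapCoeffs q + derivative q
      map_zero' := by simp
      map_add' := fun p q ↦ by simp only [map_add]; ring }
    fun p q ↦ by
      simp only [AddMonoidHom.coe_mk, ZeroHom.coe_mk, Derivation.leibniz, derivative_mul,
        smul_eq_mul]
      ring

lemma logEuler_def (q : (PowerSeries ℚ)[X]) : q′ = Differential.mapCoeffs q + derivative q := rfl

lemma coeff_logEuler (q : (PowerSeries ℚ)[X]) (i : ℕ) :
    (q′).coeff i = (q.coeff i)′ + ((i : PowerSeries ℚ) + 1) * q.coeff (i + 1) := by
  rw [logEuler_def, coeff_add, coeff_derivative, Differential.coeff_mapCoeffs]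
  ring

lemma logEuler_add (p q : (PowerSeries ℚ)[X]) : (p + q)′ = p′ + q′ := map_add _ _ _

lemma logEuler_mul (p q : (PowerSeries ℚ)[X]) : (p * q)′ = p * q′ + q * p′ := by
  simp only [Derivation.leibniz, smul_eq_mul]

lemma logEuler_C (f : PowerSeries ℚ) : (C f)′ = C (f′) := by
  rw [logEuler_def]
  simp

lemma logEuler_X : (X : (PowerSeries ℚ)[X])′ = 1 := by
  rw [logEuler_def]
  simp

instance : DifferentialAlgebra ℤ[X] (PowerSeries ℚ)[X] where
  deriv_algebraMap p := by
    rw [Polynomial.algebraMap_apply, Polynomial.algebraMap_apply, logEuler_C, deriv_algebraMap]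

/-- The logarithmic solution of the second-order equation satisfied by `besselSeries`. -/
def logSolution : (PowerSeries ℚ)[X] := C besselSeries * X + C secondSeries

lemma deriv_logSolution : logSolution′ =
    C (besselSeries′) * X + C (besselSeries + secondSeries′) := by
  rw [logSolution, logEuler_add, logEuler_mul, logEuler_C, logEuler_C, logEuler_X, C_add]
  ring

lemma deriv_deriv_logSolution : logSolution′′ =
    algebraMap ℤ[X] (PowerSeries ℚ)[X] X * (4 * logSolution′ + 2 * logSolution) := by
  have h1 := euler_euler_besselSeries
  have h2 : secondSeries′′ + 2 * besselSeries′ = _ := euler_euler_secondSeries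
  have h2 : secondSeries′′ = PowerSeries.X * (4 * besselSeries + 4 * secondSeries′
    + 2 * secondSeries) - 2 * besselSeries′ := by linear_combination h2
  have h3 : (C (besselSeries′) * X + C (besselSeries + secondSeries′) : (PowerSeries ℚ)[X])′ =
      C (besselSeries′′) * X + C (2 * besselSeries′ + secondSeries′′) := by
    rw [logEuler_add, logEuler_mul, logEuler_C, logEuler_C, logEuler_X, map_add, C_add, C_add]
    simp only [C_mul, C_ofNat]
    ring
  rw [deriv_logSolution, h3, h1, h2, logSolution, Polynomial.algebraMap_apply, algebraMap_X_series]
  simp only [C_add, C_mul, C_ofNat, C_sub]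
  ring

lemma natDegree_linear_pow_mul_le {R : Type*} [CommRing R] (a b c d : R) (m n : ℕ) :
    ((C a * X + C b) ^ m * (C c * X + C d) ^ n).natDegree ≤ m + n := by
  refine natDegree_mul_le.trans (add_le_add ?_ ?_)
  · exact (natDegree_pow_le_of_le m natDegree_linear_le).trans (by simp)
  · exact (natDegree_pow_le_of_le n natDegree_linear_le).trans (by simp)

lemma coeff_linear_pow_mul {R : Type*} [CommRing R] (a b c d : R) (m n : ℕ) :
    ((C a * X + C b) ^ m * (C c * X + C d) ^ n).coeff (m + n) = a ^ m * c ^ n := by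
  have h1 : ∀ (a b : R) (m : ℕ), ((C a * X + C b) ^ m).coeff m = a ^ m := by
    intro a b m
    have := coeff_pow_of_natDegree_le (m := m) (natDegree_linear_le (a := a) (b := b))
    rw [mul_one] at this
    rw [this]
    simp
  rw [coeff_mul_add_eq_of_natDegree_le, h1, h1]
  · exact (natDegree_pow_le_of_le m natDegree_linear_le).trans (by simp)
  · exact (natDegree_pow_le_of_le n natDegree_linear_le).trans (by simp)

lemma natDegree_homValue_logSolution_le (k : ℕ) (q : ℤ[X][X]) :
    (homValue k logSolution (logSolution′) q).natDegree ≤ k := by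
  rw [homValue_apply]
  refine natDegree_sum_le_of_forall_le _ _ fun j hj ↦ ?_
  rw [Polynomial.algebraMap_apply, deriv_logSolution, logSolution]
  refine (natDegree_C_mul_le _ _).trans ((natDegree_linear_pow_mul_le _ _ _ _ _ _).trans ?_)
  have := Finset.mem_range.1 hj
  omega

lemma coeff_homValue_logSolution (k : ℕ) (q : ℤ[X][X]) :
    (homValue k logSolution (logSolution′) q).coeff k =
      homValue k besselSeries (besselSeries′) q := by
  rw [homValue_apply, finsetSum_coeff, homValue_apply]
  refine Finset.sum_congr rfl fun j hj ↦ ?_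
  have hj := Finset.mem_range.1 hj
  rw [Polynomial.algebraMap_apply, deriv_logSolution, logSolution, coeff_C_mul]
  have := coeff_linear_pow_mul besselSeries secondSeries (besselSeries′)
    (besselSeries + secondSeries′) (k - j) j
  rw [show k - j + j = k by omega] at this
  rw [this]

/-- The index set of the monomials `a ^ (k - j) * b ^ j` with `j ≤ k` and `k ∈ S`. -/
def monoIdx (S : Finset ℕ) : Finset (Σ _ : ℕ, ℕ) := S.sigma fun k ↦ Finset.range (k + 1)

lemma mem_monoIdx {S : Finset ℕ} {x : Σ _ : ℕ, ℕ} : x ∈ monoIdx S ↔ x.1 ∈ S ∧ x.2 ≤ x.1 := by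
  simp [monoIdx]

lemma sum_monoIdx {M : Type*} [AddCommMonoid M] (S : Finset ℕ) (f : ℕ → ℕ → M) :
    ∑ a : monoIdx S, f a.1.1 a.1.2 = ∑ k ∈ S, ∑ i ∈ Finset.range (k + 1), f k i := by
  rw [Finset.sum_coe_sort (monoIdx S) (fun a ↦ f a.1 a.2), Finset.sum_sigma', monoIdx]

/-- The matrix of the iterates of the twisted operator on a tuple of polynomials. -/
def orbitMatrix (S : Finset ℕ) (P : ℕ → ℤ[X][X]) : Matrix (monoIdx S) (monoIdx S) ℤ[X] :=
  fun a b ↦ ((twist b.1.1)^[Fintype.equivFin (monoIdx S) a] (P b.1.1)).coeff b.1.2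

lemma exists_relation_of_det_eq_zero {S : Finset ℕ} {P : ℕ → ℤ[X][X]}
    (hP : ∀ k, (P k).natDegree ≤ k) (hS : ∀ k, k ∉ S → P k = 0) (h : (orbitMatrix S P).det = 0) :
    ∃ c : Fin (Fintype.card (monoIdx S)) → ℤ[X], c ≠ 0 ∧
      ∀ k, ∑ i, c i • (twist k)^[i] (P k) = 0 := by
  obtain ⟨c, hc, hcM⟩ := Matrix.exists_vecMul_eq_zero_iff.2 h
  let e := Fintype.equivFin (monoIdx S)
  refine ⟨c ∘ e.symm, ?_, fun k ↦ ?_⟩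
  · intro h0
    exact hc (funext fun a ↦ by simpa using congrFun h0 (e a))
  · by_cases hk : k ∈ S
    · ext1 j
      rw [finsetSum_coeff, coeff_zero]
      by_cases hj : j ≤ k
      · have := congrFun hcM ⟨⟨k, j⟩, mem_monoIdx.2 ⟨hk, hj⟩⟩
        rw [Matrix.vecMul, dotProduct] at this
        rw [← Equiv.sum_comp e]
        simpa [orbitMatrix, e] using this
      · refine Finset.sum_eq_zero fun i _ ↦ ?_
        rw [coeff_smul, coeff_eq_zero_of_natDegree_lt, smul_zero]
        exact (natDegree_iterate_twist_le (hP k) i).trans_lt (by omega)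
    · simp [hS k hk, iterate_twist_zero]

/-- A functional killing the orbit of the logarithmic values yields another one by the dual
connection. -/
lemma dual_connection_kills {S : Finset ℕ} {Q : ℕ → ℕ → (PowerSeries ℚ)[X]}
    (hQ : ∀ m k, (Q m k).natDegree ≤ k) (hQ' : ∀ m k, (Q m k)′ = Q (m + 1) k)
    {v : ℕ → ℕ → PowerSeries ℚ}
    (hv : ∀ m, ∑ k ∈ S, ∑ i ∈ Finset.range (k + 1), v k i * (Q m k).coeff i = 0) (m : ℕ) :
    ∑ k ∈ S, ∑ i ∈ Finset.range (k + 1),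
      ((v k i)′ - (i : PowerSeries ℚ) * v k (i - 1)) * (Q m k).coeff i = 0 := by
  have h1 := congrArg (fun f ↦ f′) (hv m)
  have h2 := hv (m + 1)
  simp only [← hQ', coeff_logEuler] at h2
  simp only [map_sum, Derivation.leibniz, smul_eq_mul, map_zero] at h1
  rw [← sub_zero (0 : PowerSeries ℚ)]
  nth_rw 1 [← h1]
  rw [← h2, ← Finset.sum_sub_distrib]
  refine Finset.sum_congr rfl fun k _ ↦ ?_
  have hshift : ∑ i ∈ Finset.range (k + 1), (i : PowerSeries ℚ) * v k (i - 1) * (Q m k).coeff i =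
      ∑ i ∈ Finset.range (k + 1), v k i * (((i : PowerSeries ℚ) + 1) * (Q m k).coeff (i + 1)) := by
    rw [Finset.sum_range_succ', Finset.sum_range_succ,
      coeff_eq_zero_of_natDegree_lt (n := k + 1) ((hQ m k).trans_lt (by omega))]
    simp only [Nat.cast_zero, zero_mul, mul_zero, add_zero, Nat.add_sub_cancel]
    refine Finset.sum_congr rfl fun i _ ↦ ?_
    push_cast
    ring
  simp only [sub_mul, mul_add, Finset.sum_sub_distrib, Finset.sum_add_distrib, hshift]
  simp only [mul_comm]
  ring

lemma exists_maximal_lead {α : Type*} (T : ℕ → α → Prop) {x : α} (h0 : T 0 x)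
    (hbound : ∃ n, ∀ y, ¬ T n y) : ∃ n, (∃ y, T n y) ∧ ∀ y, ¬ T (n + 1) y := by
  by_contra! hcon
  obtain ⟨n, hn⟩ := hbound
  have : ∀ n, ∃ y, T n y := by
    intro n
    induction n with
    | zero => exact ⟨x, h0⟩
    | succ n ih => exact hcon n ih
  obtain ⟨y, hy⟩ := this n
  exact hn y hy

/-- Functionals of maximal lead killing the orbit are diagonal with constant ratios. -/
lemma exists_diagonal_annihilator {S : Finset ℕ} {Q : ℕ → ℕ → (PowerSeries ℚ)[X]}
    (hQ : ∀ m k, (Q m k).natDegree ≤ k) (hQ' : ∀ m k, (Q m k)′ = Q (m + 1) k)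
    {w : ℕ → ℕ → PowerSeries ℚ}
    (hw : ∀ m, ∑ k ∈ S, ∑ i ∈ Finset.range (k + 1), w k i * (Q m k).coeff i = 0)
    (hw0 : ∃ k ∈ S, ∃ i ≤ k, w k i ≠ 0) :
    ∃ c : ℕ → ℚ, (∃ k ∈ S, c k ≠ 0) ∧ ∑ k ∈ S, PowerSeries.C (c k) * (Q 0 k).coeff k = 0 := by
  obtain ⟨N, hN⟩ : ∃ N, ∀ k ∈ S, k < N := ⟨S.sup id + 1, fun k hk ↦
    Nat.lt_succ_of_le (Finset.le_sup (f := id) hk)⟩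
  obtain ⟨n, ⟨v, hv, ⟨k0, hk0, i0, hi0, hne⟩, hlow⟩, hmax⟩ := exists_maximal_lead
    (fun n (v : ℕ → ℕ → PowerSeries ℚ) ↦
      (∀ m, ∑ k ∈ S, ∑ i ∈ Finset.range (k + 1), v k i * (Q m k).coeff i = 0) ∧
      (∃ k ∈ S, ∃ i ≤ k, v k i ≠ 0) ∧ ∀ k ∈ S, ∀ i ≤ k, i * N + k < n → v k i = 0)
    (x := w) ⟨hw, hw0, fun _ _ _ _ h ↦ absurd h (by omega)⟩ ⟨N * N + N, by
      rintro v ⟨_, ⟨k, hk, i, hi, hne⟩, hlow⟩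
      refine hne (hlow k hk i hi ?_)
      have := hN k hk
      have : i * N ≤ N * N := Nat.mul_le_mul_right _ (by omega)
      omega⟩
  obtain ⟨k1, hk1, i1, hi1, hf, hn1⟩ : ∃ k ∈ S, ∃ i ≤ k, v k i ≠ 0 ∧ i * N + k = n := by
    by_contra! hcon
    refine hmax v ⟨hv, ⟨k0, hk0, i0, hi0, hne⟩, fun k hk i hi hlt ↦ ?_⟩
    by_contra h0
    have h1 := hcon k hk i hi h0
    exact h0 (hlow k hk i hi (by omega))
  have hrel : ∀ k ∈ S, ∀ i ≤ k, v k1 i1 * (v k i)′ - (v k1 i1)′ * v k i =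
      (i : PowerSeries ℚ) * (v k1 i1 * v k (i - 1)) := by
    by_contra! hcon
    obtain ⟨k, hk, i, hi, hcon⟩ := hcon
    refine hmax (fun k i ↦ v k1 i1 * ((v k i)′ - (i : PowerSeries ℚ) * v k (i - 1))
      - (v k1 i1)′ * v k i) ⟨fun m ↦ ?_, ⟨k, hk, i, hi, ?_⟩, fun k hk i hi hlt ↦ ?_⟩
    · have h1 := dual_connection_kills hQ hQ' hv m
      have h2 := hv m
      simp only [sub_mul _ ((v k1 i1)′ * _), mul_assoc, Finset.sum_sub_distrib, ← Finset.mul_sum]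
      rw [h1, h2]
      simp
    · intro h0
      exact hcon (by linear_combination h0)
    · have hprev : (i : PowerSeries ℚ) * v k (i - 1) = 0 := by
        cases i with
        | zero => simp
        | succ i =>
          rw [Nat.add_sub_cancel, hlow k hk i (by omega), mul_zero]
          have := hN k hk
          rw [add_mul] at hlt
          omega
      simp only [hprev, sub_zero]
      rcases (Nat.lt_succ_iff.1 hlt).eq_or_lt with h | h
      · have hk' := hN k hk
        have hk1' := hN k1 hk1
        have hkk : k = k1 := by
          have := congrArg (· % N) (h.trans hn1.symm)
          simpa [Nat.add_mod, Nat.mod_eq_of_lt hk', Nat.mod_eq_of_lt hk1'] using this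
        subst hkk
        have : i * N = i1 * N := by omega
        have := Nat.eq_of_mul_eq_mul_right (by omega) this
        subst this
        ring
      · rw [hlow k hk i hi h]
        simp
  generalize v k1 i1 = f at hf hrel
  have hdiag : ∀ k ∈ S, ∀ i ≤ k, (∃ d : ℚ, v k i = PowerSeries.C d * f) ∧
      ∀ i' < i, v k i' = 0 := by
    intro k hk i
    induction i with
    | zero =>
      intro _
      refine ⟨(eq_smul_of_euler_quotient (c := 0) hf ?_).2, fun i' hi' ↦ absurd hi' (by omega)⟩
      simpa using hrel k hk 0 (by omega)
    | succ i ih =>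
      intro hi
      obtain ⟨⟨d, hd⟩, hz⟩ := ih (by omega)
      have h1 := hrel k hk (i + 1) hi
      rw [Nat.add_sub_cancel, hd] at h1
      obtain ⟨h2, h3⟩ := eq_smul_of_euler_quotient (c := ((i + 1 : ℕ) : ℚ) * d) hf (by
        rw [h1, map_mul, map_natCast]
        ring)
      refine ⟨h3, fun i' hi' ↦ ?_⟩
      have hd0 : d = 0 := (mul_eq_zero.1 h2).resolve_left (by positivity)
      rcases (Nat.lt_succ_iff.1 hi').eq_or_lt with h | h
      · rw [h, hd, hd0]
        simp
      · exact hz i' h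
  choose! c hc using fun k hk ↦ (hdiag k hk k le_rfl).1
  refine ⟨c, ?_, ?_⟩
  · refine ⟨k0, hk0, fun h0 ↦ hne ?_⟩
    rcases hi0.eq_or_lt with h | h
    · rw [h, hc k0 hk0, h0]
      simp
    · exact (hdiag k0 hk0 k0 le_rfl).2 i0 h
  · apply mul_left_cancel₀ hf
    rw [mul_zero, Finset.mul_sum]
    rw [← hv 0]
    refine Finset.sum_congr rfl fun k hk ↦ ?_
    rw [Finset.sum_range_succ, Finset.sum_eq_zero, hc k hk]
    · ring
    · intro i hi
      rw [(hdiag k hk k le_rfl).2 i (Finset.mem_range.1 hi), zero_mul]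

/-- The zero estimate: the orbit of a tuple of polynomials under the twisted operator spans
everything supported on the same degrees. -/
theorem det_orbitMatrix_ne_zero {S : Finset ℕ} {P : ℕ → ℤ[X][X]}
    (hP : ∀ k, (P k).natDegree ≤ k) (hS : ∀ k, k ∈ S ↔ P k ≠ 0) : (orbitMatrix S P).det ≠ 0 := by
  intro hdet
  obtain ⟨c, hc, hrel⟩ := exists_relation_of_det_eq_zero hP
    (fun k hk ↦ by simpa using (hS k).not.1 hk) hdet
  let Q : ℕ → ℕ → (PowerSeries ℚ)[X] := fun m k ↦
    homValue k logSolution (logSolution′) ((twist k)^[m] (P k))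
  have hQ : ∀ m k, (Q m k).natDegree ≤ k := fun m k ↦ natDegree_homValue_logSolution_le _ _
  have hQ' : ∀ m k, (Q m k)′ = Q (m + 1) k := fun m k ↦ by
    simp only [Q]
    rw [deriv_homValue rfl deriv_deriv_logSolution (natDegree_iterate_twist_le (hP k) m),
      Function.iterate_succ_apply']
  let Δ : (ℕ → (PowerSeries ℚ)[X]) → (ℕ → (PowerSeries ℚ)[X]) :=
    fun x k ↦ ((x k)′ : (PowerSeries ℚ)[X])
  have hΔ : ∀ m, Δ^[m] (Q 0) = Q m := by
    intro m
    induction m with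
    | zero => rfl
    | succ m ih =>
      rw [Function.iterate_succ_apply', ih]
      exact funext fun k ↦ hQ' m k
  let L : (ℕ → (PowerSeries ℚ)[X]) →ₗ[PowerSeries ℚ] (monoIdx S → PowerSeries ℚ) :=
    LinearMap.pi fun a ↦ (lcoeff (PowerSeries ℚ) a.1.2).comp (LinearMap.proj a.1.1)
  obtain ⟨w, hw0, hw⟩ := exists_annihilator_of_dependent L (fun f ↦ f′) Δ
    (fun x y ↦ funext fun k ↦ logEuler_add _ _)
    (fun c x ↦ funext fun k ↦ by
      simp only [Δ, Pi.add_apply, Pi.smul_apply, smul_eq_C_mul, logEuler_mul, logEuler_C]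
      ring)
    (Q 0) (fun i ↦ algebraMap ℤ[X] (PowerSeries ℚ) (c i))
    (fun h0 ↦ hc (funext fun i ↦ algebraMap_series_injective (by simpa using congrFun h0 i)))
    (by
      funext k
      have := congrArg (homValue k logSolution (logSolution′)) (hrel k)
      simp only [map_sum, map_smul, map_zero] at this
      simp only [hΔ, Finset.sum_apply, Pi.smul_apply, algebraMap_smul, Pi.zero_apply]
      exact this)
  obtain ⟨w', hw'⟩ : ∃ w' : ℕ → ℕ → PowerSeries ℚ, ∀ a : monoIdx S, w' a.1.1 a.1.2 = w a :=
    ⟨fun k i ↦ if h : (⟨k, i⟩ : Σ _ : ℕ, ℕ) ∈ monoIdx S then w ⟨_, h⟩ else 0, fun a ↦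
      dif_pos a.2⟩
  obtain ⟨d, ⟨k0, hk0, hd0⟩, hd⟩ := exists_diagonal_annihilator (w := w') hQ hQ'
    (fun m ↦ by
      rw [← sum_monoIdx S (fun k i ↦ w' k i * (Q m k).coeff i), ← hw m]
      refine Finset.sum_congr rfl fun a _ ↦ ?_
      rw [hw' a, hΔ]
      rfl)
    (by
      by_contra! hcon
      refine hw0 (funext fun a ↦ ?_)
      have ha := mem_monoIdx.1 a.2
      rw [← hw' a, hcon _ ha.1 _ ha.2]
      rfl)
  obtain ⟨b, hb⟩ := IsLocalization.exist_integer_multiples (nonZeroDivisors ℤ) S d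
  choose! n hn using hb
  have hb0 : (b : ℤ) ≠ 0 := nonZeroDivisors.coe_ne_zero b
  have hn' : ∀ k ∈ S, (n k : ℚ) = (b : ℤ) * d k := fun k hk ↦ by
    have := hn k hk
    simpa using this
  have hzero := algIndep_besselSeries S (fun k j ↦ C (n k) * (P k).coeff j) (by
    have := congrArg (fun f ↦ PowerSeries.C ((b : ℤ) : ℚ) * f) hd
    simp only [mul_zero, Finset.mul_sum] at this
    rw [← this]
    refine Finset.sum_congr rfl fun k hk ↦ ?_
    have hCn : algebraMap ℤ[X] (PowerSeries ℚ) (C (n k)) = PowerSeries.C (n k : ℚ) := by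
      rw [eq_intCast, map_intCast, map_intCast]
    simp only [Q, Function.iterate_zero, id, coeff_homValue_logSolution]
    simp only [homValue_apply, map_mul, hCn, hn' k hk, Finset.mul_sum]
    refine Finset.sum_congr rfl fun j _ ↦ by ring)
  refine (hS k0).1 hk0 ?_
  ext1 j
  by_cases hj : j ≤ k0
  · have := hzero k0 hk0 j hj
    refine (mul_eq_zero.1 this).resolve_left (C_ne_zero.2 fun h0 ↦ hd0 ?_)
    have h1 := hn' k0 hk0
    rw [h0, Int.cast_zero, eq_comm, mul_eq_zero] at h1
    exact h1.resolve_left (by exact_mod_cast hb0)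
  · rw [coeff_eq_zero_of_natDegree_lt ((hP k0).trans_lt (by omega)), coeff_zero]

/-- The twisted operator acting on a tuple of polynomials. -/
def seqTwist (W : ℕ → ℤ[X][X]) : ℕ → ℤ[X][X] := fun k ↦ twist k (W k)

lemma iterate_seqTwist (W : ℕ → ℤ[X][X]) (i k : ℕ) :
    seqTwist^[i] W k = (twist k)^[i] (W k) := by
  induction i with
  | zero => rfl
  | succ i ih => rw [Function.iterate_succ_apply', Function.iterate_succ_apply', ← ih, seqTwist]

lemma det_smul_single_eq_sum {S : Finset ℕ} {P : ℕ → ℤ[X][X]}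
    (hP : ∀ k, (P k).natDegree ≤ k) (hS : ∀ k, k ∉ S → P k = 0) (b : monoIdx S) :
    (orbitMatrix S P).det • (Pi.single b.1.1 (X ^ b.1.2) : ℕ → ℤ[X][X]) =
      ∑ a, (orbitMatrix S P).adjugate b a •
        seqTwist^[Fintype.equivFin (monoIdx S) a] P := by
  have hb := mem_monoIdx.1 b.2
  funext k
  simp only [Finset.sum_apply, Pi.smul_apply, iterate_seqTwist]
  ext1 j
  simp only [finsetSum_coeff, coeff_smul, smul_eq_mul]
  by_cases hkj : k ∈ S ∧ j ≤ k
  · have := congrFun (congrFun (Matrix.adjugate_mul (orbitMatrix S P)) b)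
      ⟨⟨k, j⟩, mem_monoIdx.2 hkj⟩
    rw [Matrix.mul_apply, Matrix.smul_apply, Matrix.one_apply, smul_eq_mul] at this
    rw [show ∑ a, (orbitMatrix S P).adjugate b a *
      ((twist k)^[Fintype.equivFin (monoIdx S) a] (P k)).coeff j = _ from this]
    congr 1
    obtain ⟨⟨k', j'⟩, hb'⟩ := b
    by_cases h : k = k'
    · subst h
      simp [coeff_X_pow, eq_comm]
    · rw [Pi.single_eq_of_ne h, coeff_zero, if_neg]
      rintro h'
      simp at h'
      exact h h'.1.symm
  · rw [Finset.sum_eq_zero]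
    · by_cases h : k = b.1.1
      · subst h
        rw [Pi.single_eq_same, coeff_X_pow, if_neg, mul_zero]
        rintro rfl
        exact hkj hb
      · rw [Pi.single_eq_of_ne h, coeff_zero, mul_zero]
    · intro a _
      by_cases hk : k ∈ S
      · rw [coeff_eq_zero_of_natDegree_lt, mul_zero]
        have := natDegree_iterate_twist_le (hP k) (Fintype.equivFin (monoIdx S) a)
        have : ¬ j ≤ k := fun h ↦ hkj ⟨hk, h⟩
        omega
      · rw [hS k hk, iterate_twist_zero, coeff_zero, mul_zero]

lemma X_pow_dvd_euler {T : ℕ} {f : PowerSeries ℚ} (h : PowerSeries.X ^ T ∣ f) :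
    PowerSeries.X ^ T ∣ f′ := by
  rw [PowerSeries.X_pow_dvd_iff] at h ⊢
  intro m hm
  rw [coeff_seriesEuler, h m hm, mul_zero]

/-- The linear form in the monomials in the Bessel series and its derivative. -/
def besselForm (S : Finset ℕ) (P : ℕ → ℤ[X][X]) : PowerSeries ℚ :=
  ∑ k ∈ S, homValue k besselSeries (besselSeries′) (P k)

lemma besselForm_seqTwist {S : Finset ℕ} {P : ℕ → ℤ[X][X]} (hP : ∀ k, (P k).natDegree ≤ k)
    (i : ℕ) : besselForm S (seqTwist^[i] P) = (fun f ↦ f′)^[i] (besselForm S P) := by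
  have hb : besselSeries′′ = algebraMap ℤ[X] (PowerSeries ℚ) X *
      (4 * besselSeries′ + 2 * besselSeries) := by
    rw [euler_euler_besselSeries, algebraMap_X_series]
  induction i with
  | zero => rfl
  | succ i ih =>
    rw [Function.iterate_succ_apply', Function.iterate_succ_apply', ← ih, besselForm, besselForm,
      map_sum]
    refine Finset.sum_congr rfl fun k _ ↦ ?_
    rw [iterate_seqTwist, seqTwist, iterate_seqTwist,
      deriv_homValue rfl hb (natDegree_iterate_twist_le (hP k) i)]

lemma X_pow_dvd_det_orbitMatrix {S : Finset ℕ} {P : ℕ → ℤ[X][X]} {T : ℕ}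
    (hP : ∀ k, (P k).natDegree ≤ k) (hS : ∀ k, k ∉ S → P k = 0) (hne : S.Nonempty)
    (hT : PowerSeries.X ^ T ∣ besselForm S P) : X ^ T ∣ (orbitMatrix S P).det := by
  obtain ⟨k, hk⟩ := hne
  have hdvd : ∀ i, PowerSeries.X ^ T ∣ besselForm S (seqTwist^[i] P) := by
    intro i
    rw [besselForm_seqTwist hP]
    induction i with
    | zero => exact hT
    | succ i ih => rw [Function.iterate_succ_apply']; exact X_pow_dvd_euler ih
  have hlin : ∀ (c : ℤ[X]) W, besselForm S (c • W) = algebraMap ℤ[X] _ c * besselForm S W := by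
    intro c W
    simp only [besselForm, Finset.mul_sum, Pi.smul_apply, map_smul]
    exact Finset.sum_congr rfl fun _ _ ↦ Algebra.smul_def _ _
  have hsum : ∀ (W : monoIdx S → ℕ → ℤ[X][X]), besselForm S (∑ a, W a) =
      ∑ a, besselForm S (W a) := by
    intro W
    simp only [besselForm, Finset.sum_apply, map_sum]
    exact Finset.sum_comm
  have h := congrArg (besselForm S) (det_smul_single_eq_sum hP hS
    ⟨⟨k, 0⟩, mem_monoIdx.2 ⟨hk, Nat.zero_le _⟩⟩)
  rw [hlin, hsum] at h
  simp only [hlin] at h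
  have hA : besselForm S (Pi.single k (X ^ 0)) = besselSeries ^ k := by
    rw [besselForm, Finset.sum_eq_single k]
    · rw [Pi.single_eq_same]
      have := homValue_monomial (Nat.zero_le k) besselSeries (besselSeries′) 1
      simpa using this
    · intro j _ hj
      rw [Pi.single_eq_of_ne hj, map_zero]
    · exact fun h ↦ absurd hk h
  simp only [hA] at h
  have hu : IsUnit (besselSeries ^ k) := by
    rw [PowerSeries.isUnit_iff_constantCoeff, map_pow, constantCoeff_besselSeries]
    simp
  have h2 : PowerSeries.X ^ T ∣ algebraMap ℤ[X] (PowerSeries ℚ) (orbitMatrix S P).det := by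
    rw [← hu.dvd_mul_right, h]
    exact Finset.dvd_sum fun a _ ↦ (hdvd _).mul_left _
  rw [Polynomial.X_pow_dvd_iff]
  intro d hd
  have := PowerSeries.X_pow_dvd_iff.1 h2 d hd
  rw [coeff_algebraMap_series] at this
  exact_mod_cast this

lemma coeff_twist_zero (k : ℕ) (q : ℤ[X][X]) :
    (twist k q).coeff 0 = (q.coeff 0)′ + 2 * X * q.coeff 1 := by
  rw [twist, coeff_add, coeff_natCast_mul, coeff_X_mul_zero, coeff_riccatiDeriv_zero]
  ring

lemma coeff_twist_succ (k : ℕ) (q : ℤ[X][X]) (i : ℕ) :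
    (twist k q).coeff (i + 1) = (q.coeff (i + 1))′ + 4 * X * ((i : ℤ[X]) + 1) * q.coeff (i + 1)
      + 2 * X * ((i : ℤ[X]) + 2) * q.coeff (i + 2) + ((k : ℤ[X]) - (i : ℤ[X])) * q.coeff i := by
  rw [twist, coeff_add, coeff_natCast_mul, coeff_X_mul, coeff_riccatiDeriv_succ]
  ring

lemma natDegree_polyEuler_le (p : ℤ[X]) : (p′).natDegree ≤ p.natDegree := by
  rw [natDegree_le_iff_coeff_eq_zero]
  intro n hn
  rw [coeff_polyEuler, coeff_eq_zero_of_natDegree_lt hn, mul_zero]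

lemma natDegree_coeff_twist_le {n k : ℕ} {q : ℤ[X][X]} (hq : ∀ j, (q.coeff j).natDegree ≤ n)
    (j : ℕ) : ((twist k q).coeff j).natDegree ≤ n + 1 := by
  have h1 : ∀ j, ((q.coeff j)′).natDegree ≤ n + 1 := fun j ↦
    (natDegree_polyEuler_le _).trans ((hq j).trans (by omega))
  have h2 : ∀ (c : ℤ[X]) j, c.natDegree ≤ 1 → (c * q.coeff j).natDegree ≤ n + 1 := fun c j hc ↦
    natDegree_mul_le.trans (by have := hq j; omega)
  cases j with
  | zero =>
    rw [coeff_twist_zero]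
    refine natDegree_add_le_of_degree_le (h1 _) (h2 _ _ (by compute_degree))
  | succ j =>
    rw [coeff_twist_succ]
    refine natDegree_add_le_of_degree_le (natDegree_add_le_of_degree_le
      (natDegree_add_le_of_degree_le (h1 _) (h2 _ _ ?_)) (h2 _ _ ?_)) (h2 _ _ ?_)
    · compute_degree
    · compute_degree
    · compute_degree
      exact Nat.zero_le 1

lemma natDegree_coeff_iterate_twist_le {n k : ℕ} {q : ℤ[X][X]}
    (hq : ∀ j, (q.coeff j).natDegree ≤ n) (i j : ℕ) :
    (((twist k)^[i] q).coeff j).natDegree ≤ n + i := by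
  induction i generalizing j with
  | zero => exact hq j
  | succ i ih => rw [Function.iterate_succ_apply']; exact natDegree_coeff_twist_le ih j

lemma natDegree_det_orbitMatrix_le {S : Finset ℕ} {P : ℕ → ℤ[X][X]} {n : ℕ}
    (hn : ∀ k j, ((P k).coeff j).natDegree ≤ n) :
    (orbitMatrix S P).det.natDegree ≤ (monoIdx S).card * (n + (monoIdx S).card) := by
  rw [Matrix.det_apply]
  refine natDegree_sum_le_of_forall_le _ _ fun σ _ ↦ ?_
  refine (natDegree_smul_le _ _).trans ((natDegree_prod_le _ _).trans ?_)
  refine (Finset.sum_le_card_nsmul _ _ (n + (monoIdx S).card) fun a _ ↦ ?_).trans ?_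
  · refine (natDegree_coeff_iterate_twist_le (hn _) _ _).trans ?_
    have := (Fintype.equivFin (monoIdx S) (σ a)).2.trans_eq (Fintype.card_coe _)
    omega
  · simp

/-- High-order vanishing forces all degrees to occur. -/
lemma support_eq_of_high_order {M n T N : ℕ} {P : ℕ → ℤ[X][X]}
    (hP : ∀ k, (P k).natDegree ≤ k) (hN : ∀ k, N < k → P k = 0) (hP0 : P ≠ 0)
    (hn : ∀ k j, ((P k).coeff j).natDegree ≤ n)
    (hM : M = (monoIdx (Finset.range (N + 1))).card)
    (hT : PowerSeries.X ^ T ∣ besselForm (Finset.range (N + 1)) P)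
    (hlarge : (M - 1) * (n + (M - 1)) < T) : ∀ k ≤ N, P k ≠ 0 := by
  classical
  set S := (Finset.range (N + 1)).filter fun k ↦ P k ≠ 0 with hSdef
  have hS : ∀ k, k ∈ S ↔ P k ≠ 0 := by
    intro k
    simp only [hSdef, Finset.mem_filter, Finset.mem_range, and_iff_right_iff_imp]
    intro h
    by_contra hk
    exact h (hN k (by omega))
  have hS' : ∀ k, k ∉ S → P k = 0 := fun k hk ↦ by simpa using (hS k).not.1 hk
  have hne : S.Nonempty := by
    obtain ⟨k, hk⟩ := Function.ne_iff.1 hP0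
    exact ⟨k, (hS k).2 hk⟩
  have hform : besselForm (Finset.range (N + 1)) P = besselForm S P := by
    symm
    refine Finset.sum_subset (Finset.filter_subset _ _) fun k _ hk ↦ ?_
    rw [hS' k hk, map_zero]
  rw [hform] at hT
  have h1 := X_pow_dvd_det_orbitMatrix hP hS' hne hT
  have hd := natDegree_le_of_dvd h1 (det_orbitMatrix_ne_zero hP hS)
  rw [natDegree_X_pow] at hd
  have h2 := hd.trans (natDegree_det_orbitMatrix_le hn)
  have hsub : monoIdx S ⊆ monoIdx (Finset.range (N + 1)) :=
    Finset.sigma_mono (Finset.filter_subset _ _) fun _ ↦ le_rfl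
  have hcard : ¬ (monoIdx S).card ≤ M - 1 := fun hle ↦ by
    have := Nat.mul_le_mul hle (Nat.add_le_add_left hle n)
    omega
  have heq := Finset.eq_of_subset_of_card_le hsub (by omega)
  intro k hk
  rw [← hS]
  have : (⟨k, 0⟩ : Σ _ : ℕ, ℕ) ∈ monoIdx S := by
    rw [heq, mem_monoIdx]
    simp
    omega
  exact (mem_monoIdx.1 this).1

lemma map_iterate_smul_of_vanishing {F V : Type*} [Field F] [AddCommGroup V] [Module ℤ[X] V]
    {ξ : F} (D : V →+ V)
    (hD : ∀ (f : ℤ[X]) v, D (f • v) = f′ • v + f • D v) (ε : V →+ F)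
    (hε : ∀ (f : ℤ[X]) v, ε (f • v) = aeval ξ f * ε v) (s : ℕ) (d : ℤ[X])
    (h : ∀ i < s, aeval ξ ((fun p : ℤ[X] ↦ p′)^[i] d) = 0) (v : V) :
    ε (D^[s] (d • v)) = aeval ξ ((fun p : ℤ[X] ↦ p′)^[s] d) * ε v := by
  induction s generalizing d v with
  | zero => exact hε d v
  | succ s ih =>
    rw [Function.iterate_succ_apply, hD, iterate_map_add, map_add,
      ih _ (fun i hi ↦ by
        have := h (i + 1) (by omega)
        rwa [Function.iterate_succ_apply] at this),
      ih _ (fun i hi ↦ h i (by omega)), h s (by omega), zero_mul, add_zero]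
    rfl

section Multiplicity

variable {F : Type*} [Field F] [CharZero F]

lemma X_sub_C_pow_dvd_of_euler {ξ : F} (hξ : ξ ≠ 0) (s : ℕ) (g : F[X])
    (h : ∀ i < s, ((fun p : F[X] ↦ X * derivative p)^[i] g).eval ξ = 0) :
    (X - C ξ) ^ s ∣ g := by
  induction s generalizing g with
  | zero => simp
  | succ s ih =>
    by_cases hg : g = 0
    · simp [hg]
    have hroot : g.IsRoot ξ := h 0 (by omega)
    have h1 : (X - C ξ) ^ s ∣ X * derivative g := ih _ fun i hi ↦ by
      have := h (i + 1) (by omega)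
      rwa [Function.iterate_succ_apply] at this
    have hcop : IsCoprime ((X - C ξ) ^ s) X := by
      apply IsCoprime.pow_left
      simpa using isCoprime_X_sub_C_of_isUnit_sub (a := ξ) (b := 0) (by simpa using hξ)
    have h2 := hcop.dvd_of_dvd_mul_left h1
    have hpos : 0 < rootMultiplicity ξ g := (rootMultiplicity_pos hg).2 hroot
    have hdne : derivative g ≠ 0 := by
      intro h0
      have := derivative_eq_zero.1 h0
      rw [eq_C_of_natDegree_eq_zero this] at hroot hg
      simp at hroot
      simp [hroot] at hg
    rw [← le_rootMultiplicity_iff hdne, derivative_rootMultiplicity_of_root hroot] at h2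
    rw [← le_rootMultiplicity_iff hg]
    omega

lemma exists_euler_ne_zero {ξ : F} (hξ : ξ ≠ 0) {d : ℤ[X]} (hd : d ≠ 0) {T τ : ℕ}
    (hT : X ^ T ∣ d) (hdeg : d.natDegree ≤ T + τ) :
    ∃ s ≤ τ, aeval ξ ((fun p : ℤ[X] ↦ p′)^[s] d) ≠ 0 := by
  by_contra! hcon
  have hinj : Function.Injective (Int.castRingHom F) := Int.cast_injective
  have hd' : d.map (Int.castRingHom F) ≠ 0 := by
    rwa [Ne, Polynomial.map_eq_zero_iff hinj]
  have hmap : ∀ s, ((fun p : ℤ[X] ↦ p′)^[s] d).map (Int.castRingHom F) =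
      (fun p : F[X] ↦ X * derivative p)^[s] (d.map (Int.castRingHom F)) := by
    intro s
    induction s with
    | zero => rfl
    | succ s ih =>
      rw [Function.iterate_succ_apply', Function.iterate_succ_apply', ← ih, polyEuler_def]
      simp [derivative_map]
  have h1 : (X - C ξ) ^ (τ + 1) ∣ d.map (Int.castRingHom F) :=
    X_sub_C_pow_dvd_of_euler hξ _ _ fun i hi ↦ by
      rw [← hmap, eval_map]
      exact hcon i (by omega)
  have h2 : X ^ T ∣ d.map (Int.castRingHom F) := by
    have := Polynomial.map_dvd (Int.castRingHom F) hT
    simpa using this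
  have hcop : IsCoprime ((X - C ξ) ^ (τ + 1)) (X ^ T) := by
    apply IsCoprime.pow
    simpa using isCoprime_X_sub_C_of_isUnit_sub (a := ξ) (b := 0) (by simpa using hξ)
  have h3 := natDegree_le_of_dvd (hcop.mul_dvd h1 h2) hd'
  rw [natDegree_mul (pow_ne_zero _ (X_sub_C_ne_zero ξ)) (pow_ne_zero _ X_ne_zero), natDegree_pow,
    natDegree_X_sub_C, natDegree_X_pow, natDegree_map_eq_of_injective hinj] at h3
  omega

variable {V : Type*} [AddCommGroup V] [Module ℤ[X] V]

lemma functional_vanishes_of_orbit {ξ : F} (hξ : ξ ≠ 0) (D : V →+ V)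
    (hD : ∀ (f : ℤ[X]) v, D (f • v) = f′ • v + f • D v) (ε : V →+ F)
    (hε : ∀ (f : ℤ[X]) v, ε (f • v) = aeval ξ f * ε v) {d : ℤ[X]} (hd : d ≠ 0) {T τ : ℕ}
    (hT : X ^ T ∣ d) (hdeg : d.natDegree ≤ T + τ) {p v : V} {M : ℕ}
    (hv : d • v ∈ Submodule.span ℤ[X] ((fun i ↦ D^[i] p) '' Set.Iio M))
    (hp : ∀ i < M + τ, ε (D^[i] p) = 0) : ε v = 0 := by
  classical
  have hstep : ∀ n w, w ∈ Submodule.span ℤ[X] ((fun i ↦ D^[i] p) '' Set.Iio n) →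
      D w ∈ Submodule.span ℤ[X] ((fun i ↦ D^[i] p) '' Set.Iio (n + 1)) := by
    intro n w hw
    induction hw using Submodule.span_induction with
    | mem x hx =>
      obtain ⟨i, hi, rfl⟩ := hx
      refine Submodule.subset_span ⟨i + 1, ?_, Function.iterate_succ_apply' _ _ _⟩
      simpa using hi
    | zero => simp
    | add x y _ _ hx hy => rw [map_add]; exact add_mem hx hy
    | smul a x hx hDx =>
      rw [hD]
      refine add_mem (Submodule.smul_mem _ _ ?_) (Submodule.smul_mem _ _ hDx)
      exact Submodule.span_mono (Set.image_mono (Set.Iio_subset_Iio (by omega))) hx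
  have hmem : ∀ s, D^[s] (d • v) ∈
      Submodule.span ℤ[X] ((fun i ↦ D^[i] p) '' Set.Iio (M + s)) := by
    intro s
    induction s with
    | zero => exact hv
    | succ s ih => rw [Function.iterate_succ_apply']; exact hstep _ _ ih
  have hzero : ∀ s ≤ τ, ε (D^[s] (d • v)) = 0 := by
    intro s hs
    have := hmem s
    generalize D^[s] (d • v) = w at this
    induction this using Submodule.span_induction with
    | mem x hx =>
      obtain ⟨i, hi, rfl⟩ := hx
      exact hp i (lt_of_lt_of_le hi (by omega))
    | zero => simp
    | add x y _ _ hx hy => rw [map_add, hx, hy, add_zero]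
    | smul a x _ hx => rw [hε, hx, mul_zero]
  have hex := exists_euler_ne_zero hξ hd hT hdeg
  have hex' : ∃ s, aeval ξ ((fun p : ℤ[X] ↦ p′)^[s] d) ≠ 0 := hex.imp fun _ h ↦ h.2
  have hle : Nat.find hex' ≤ τ := by
    obtain ⟨s, hs, h⟩ := hex
    exact (Nat.find_min' hex' h).trans hs
  have h1 := map_iterate_smul_of_vanishing D hD ε hε (Nat.find hex') d
    (fun i hi ↦ not_not.1 (Nat.find_min hex' hi)) v
  rw [hzero _ hle, eq_comm, mul_eq_zero] at h1
  exact h1.resolve_left (Nat.find_spec hex')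

/-- Dehomogenization at `β` of the values at `ξ` of the coefficients of a tuple. -/
def evalTuple (N : ℕ) (ξ β : F) (W : ℕ → ℤ[X][X]) (j : ℕ) : F :=
  ∑ k ∈ Finset.range (N + 1), aeval ξ ((W k).coeff j) * β ^ (k - j)

/-- The values at `ξ` of the orbit of a tuple vanishing to high order span the whole space. -/
lemma eq_zero_of_forall_evalTuple {ξ : F} (hξ : ξ ≠ 0) (β : F) {N M T n τ : ℕ}
    {P : ℕ → ℤ[X][X]} (hP : ∀ k, (P k).natDegree ≤ k) (hN : ∀ k, N < k → P k = 0)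
    (hP0 : P ≠ 0) (hn : ∀ k j, ((P k).coeff j).natDegree ≤ n)
    (hM : M = (monoIdx (Finset.range (N + 1))).card)
    (hT : PowerSeries.X ^ T ∣ besselForm (Finset.range (N + 1)) P)
    (hlarge : (M - 1) * (n + (M - 1)) < T) (hτ : M * (n + M) ≤ T + τ) {ψ : ℕ → F}
    (hψ : ∀ i < M + τ, ∑ j ∈ Finset.range (N + 1), ψ j * evalTuple N ξ β (seqTwist^[i] P) j = 0) :
    ∀ j ≤ N, ψ j = 0 := by
  have hsupp := support_eq_of_high_order hP hN hP0 hn hM hT hlarge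
  have hS : ∀ k, k ∈ Finset.range (N + 1) ↔ P k ≠ 0 := by
    intro k
    rw [Finset.mem_range]
    exact ⟨fun h ↦ hsupp k (by omega), fun h ↦ by by_contra hk; exact h (hN k (by omega))⟩
  have hS' : ∀ k, k ∉ Finset.range (N + 1) → P k = 0 := fun k hk ↦ by simpa using (hS k).not.1 hk
  have hdet := det_orbitMatrix_ne_zero hP hS
  intro j hj
  let D : (ℕ → ℤ[X][X]) →+ (ℕ → ℤ[X][X]) :=
    { toFun := seqTwist
      map_zero' := funext fun k ↦ twist_zero k
      map_add' := fun x y ↦ funext fun k ↦ twist_add k _ _ }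
  let ε : (ℕ → ℤ[X][X]) →+ F :=
    { toFun := fun W ↦ ∑ j ∈ Finset.range (N + 1), ψ j * evalTuple N ξ β W j
      map_zero' := by simp [evalTuple]
      map_add' := fun x y ↦ by
        simp [evalTuple, add_mul, mul_add, Finset.sum_add_distrib] }
  have h := functional_vanishes_of_orbit (V := ℕ → ℤ[X][X]) hξ D
    (fun f v ↦ funext fun k ↦ by
      simp only [D, AddMonoidHom.coe_mk, ZeroHom.coe_mk, seqTwist, Pi.smul_apply, Pi.add_apply,
        smul_eq_C_mul, twist_C_mul]) ε
    (fun f v ↦ by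
      simp only [ε, AddMonoidHom.coe_mk, ZeroHom.coe_mk, evalTuple, Pi.smul_apply, coeff_smul,
        smul_eq_mul, map_mul, Finset.mul_sum]
      exact Finset.sum_congr rfl fun _ _ ↦ Finset.sum_congr rfl fun _ _ ↦ by ring)
    hdet (X_pow_dvd_det_orbitMatrix hP hS' ⟨0, by simp⟩ hT)
    ((natDegree_det_orbitMatrix_le hn).trans (hM ▸ hτ)) (p := P)
    (v := Pi.single j (X ^ j)) (M := M) (by
      rw [det_smul_single_eq_sum hP hS' ⟨⟨j, j⟩, mem_monoIdx.2 ⟨by simp; omega, le_rfl⟩⟩]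
      refine Submodule.sum_mem _ fun a _ ↦ Submodule.smul_mem _ _ (Submodule.subset_span ?_)
      refine ⟨_, ?_, rfl⟩
      rw [hM]
      exact (Fintype.equivFin (monoIdx (Finset.range (N + 1))) a).2.trans_eq (Fintype.card_coe _))
    hψ
  have hj' : j ∈ Finset.range (N + 1) := by simp; omega
  simp only [ε, AddMonoidHom.coe_mk, ZeroHom.coe_mk, evalTuple] at h
  rw [Finset.sum_eq_single j] at h
  · rw [Finset.sum_eq_single j] at h
    · simpa using h
    · intro k _ hk
      rw [Pi.single_eq_of_ne hk]
      simp
    · exact fun h ↦ absurd hj' h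
  · intro l _ hl
    rw [Finset.sum_eq_zero, mul_zero]
    intro k _
    by_cases hk : k = j
    · subst hk
      simp [coeff_X_pow, hl]
    · rw [Pi.single_eq_of_ne hk]
      simp
  · exact fun h ↦ absurd hj' h

end Multiplicity

/-- Power series whose coefficients are `cₘ / m!` with integers `cₘ` of size at most `C ^ m`. -/
def IsESeries (C : ℕ) (f : PowerSeries ℚ) : Prop :=
  ∀ m, ∃ z : ℤ, (m ! : ℚ) * PowerSeries.coeff m f = z ∧ |z| ≤ (C : ℤ) ^ m

namespace IsESeries

lemma one : IsESeries 0 1 := by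
  intro m
  cases m with
  | zero => exact ⟨1, by simp, by simp⟩
  | succ m => exact ⟨0, by simp [PowerSeries.coeff_one], by simp⟩

lemma mono {C D : ℕ} {f : PowerSeries ℚ} (hf : IsESeries C f) (h : C ≤ D) : IsESeries D f := by
  intro m
  obtain ⟨z, hz, hzC⟩ := hf m
  exact ⟨z, hz, hzC.trans (by gcongr)⟩

lemma mul {C D : ℕ} {f g : PowerSeries ℚ} (hf : IsESeries C f) (hg : IsESeries D g) :
    IsESeries (C + D) (f * g) := by
  choose u hu huC using hf
  choose v hv hvD using hg
  intro m
  refine ⟨∑ x ∈ Finset.HasAntidiagonal.antidiagonal m, m.choose x.1 * (u x.1 * v x.2), ?_, ?_⟩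
  · rw [PowerSeries.coeff_mul, Finset.mul_sum]
    push_cast
    refine Finset.sum_congr rfl fun x hx ↦ ?_
    have hx := Finset.HasAntidiagonal.mem_antidiagonal.1 hx
    have h1 := Nat.add_choose_mul_factorial_mul_factorial x.1 x.2
    rw [hx, ← Nat.choose_symm_of_eq_add hx.symm] at h1
    rw [← hu, ← hv, ← h1]
    push_cast
    ring
  · refine (Finset.abs_sum_le_sum_abs _ _).trans ?_
    push_cast
    rw [(Commute.all (C : ℤ) D).add_pow']
    refine Finset.sum_le_sum fun x _ ↦ ?_
    rw [abs_mul, abs_mul, Nat.abs_cast, nsmul_eq_mul]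
    have := huC x.1
    have := hvD x.2
    gcongr

lemma pow {C : ℕ} {f : PowerSeries ℚ} (hf : IsESeries C f) (n : ℕ) :
    IsESeries (n * C) (f ^ n) := by
  induction n with
  | zero => simpa using one
  | succ n ih =>
    rw [pow_succ, add_mul, one_mul]
    exact ih.mul hf

end IsESeries

lemma isESeries_besselSeries : IsESeries 4 besselSeries := by
  intro m
  refine ⟨m.centralBinom, ?_, ?_⟩
  · rw [besselSeries, PowerSeries.coeff_mk]
    have : (m ! : ℚ) ≠ 0 := by positivity
    field_simp
    simp
  · rw [Nat.abs_cast]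
    exact_mod_cast Nat.centralBinom_le_four_pow m

lemma isESeries_euler_besselSeries : IsESeries 8 (besselSeries′) := by
  intro m
  refine ⟨m * m.centralBinom, ?_, ?_⟩
  · rw [coeff_seriesEuler, besselSeries, PowerSeries.coeff_mk]
    have : (m ! : ℚ) ≠ 0 := by positivity
    field_simp
    simp
  · rw [abs_mul, Nat.abs_cast, Nat.abs_cast]
    have h1 := Nat.centralBinom_le_four_pow m
    have h2 := (Nat.lt_two_pow_self (n := m)).le
    calc (m : ℤ) * (m.centralBinom : ℤ) ≤ 2 ^ m * 4 ^ m := by exact_mod_cast Nat.mul_le_mul h2 h1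
      _ = _ := by rw [← mul_pow]; norm_num

lemma isESeries_monomial {k j N : ℕ} (hk : k ≤ N) (hj : j ≤ k) :
    IsESeries (8 * N) (besselSeries ^ (k - j) * besselSeries′ ^ j) :=
  ((isESeries_besselSeries.pow _).mul (isESeries_euler_besselSeries.pow _)).mono (by omega)

/-- Siegel's lemma with integral bounds. -/
lemma exists_int_solution {α β : Type*} [Fintype α] [Fintype β] (A : Matrix α β ℤ) {e t B : ℕ}
    (hα : Fintype.card α = e * t) (hβ : Fintype.card β = (e + 1) * t) (he : 0 < e) (ht : 0 < t)
    (hB : 1 ≤ B) (hA : ∀ i j, |A i j| ≤ B) :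
    ∃ q : β → ℤ, q ≠ 0 ∧ A.mulVec q = 0 ∧ ∀ j, |q j| ≤ ((((e + 1) * t * B) ^ e : ℕ) : ℤ) := by
  obtain ⟨q, hq0, hq, hqB⟩ := Int.Matrix.exists_ne_zero_int_vec_norm_le A
    (by rw [hα, hβ]; nlinarith) (by rw [hα]; positivity)
  refine ⟨q, hq0, hq, fun j ↦ ?_⟩
  have hexp : ((Fintype.card α : ℕ) : ℝ) / ((Fintype.card β : ℕ) - (Fintype.card α : ℕ)) = e := by
    rw [hα, hβ]
    have : (t : ℝ) ≠ 0 := by positivity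
    push_cast
    rw [show ((e : ℝ) + 1) * t - e * t = t by ring]
    field_simp
  rw [hexp, Real.rpow_natCast, hβ] at hqB
  have h1 := (norm_le_pi_norm q j).trans hqB
  rw [Int.norm_eq_abs] at h1
  have h2 : (|q j| : ℝ) ≤ ((e + 1) * t * B) ^ e := by
    refine h1.trans ?_
    push_cast
    gcongr
    refine max_le (by exact_mod_cast hB) ?_
    rw [Matrix.norm_le_iff (by positivity)]
    intro a b
    rw [Int.norm_eq_abs]
    exact_mod_cast hA a b
  exact_mod_cast h2

/-- The tuple of polynomials with prescribed coefficients. -/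
def tupleOf (S : Finset ℕ) (p : monoIdx S → ℤ[X]) (k : ℕ) : ℤ[X][X] :=
  ∑ j ∈ Finset.range (k + 1), monomial j (if h : ⟨k, j⟩ ∈ monoIdx S then p ⟨⟨k, j⟩, h⟩ else 0)

lemma coeff_tupleOf (S : Finset ℕ) (p : monoIdx S → ℤ[X]) (k j : ℕ) :
    (tupleOf S p k).coeff j = if h : ⟨k, j⟩ ∈ monoIdx S then p ⟨⟨k, j⟩, h⟩ else 0 := by
  rw [tupleOf, finsetSum_coeff]
  simp only [coeff_monomial]
  rw [Finset.sum_ite_eq', ite_eq_left_iff]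
  intro h
  rw [dif_neg]
  intro h'
  have := (mem_monoIdx.1 h').2
  simp at h this
  omega

lemma natDegree_tupleOf_le (S : Finset ℕ) (p : monoIdx S → ℤ[X]) (k : ℕ) :
    (tupleOf S p k).natDegree ≤ k := by
  rw [natDegree_le_iff_coeff_eq_zero]
  intro j hj
  rw [coeff_tupleOf, dif_neg]
  intro h
  have := (mem_monoIdx.1 h).2
  simp at this
  omega

lemma besselForm_tupleOf (S : Finset ℕ) (p : monoIdx S → ℤ[X]) :
    besselForm S (tupleOf S p) = ∑ a, algebraMap ℤ[X] (PowerSeries ℚ) (p a) *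
      (besselSeries ^ (a.1.1 - a.1.2) * besselSeries′ ^ a.1.2) := by
  simp only [besselForm, homValue_apply]
  rw [← sum_monoIdx S fun k j ↦ algebraMap ℤ[X] (PowerSeries ℚ) ((tupleOf S p k).coeff j) *
    (besselSeries ^ (k - j) * besselSeries′ ^ j)]
  refine Finset.sum_congr rfl fun a _ ↦ ?_
  rw [coeff_tupleOf, dif_pos a.2]

/-- The polynomial `∑ ((2t)! / l!) qₗ X ^ l`. -/
def scaledPoly (t : ℕ) (q : Fin (2 * t) → ℤ) : ℤ[X] :=
  ∑ l : Fin (2 * t), monomial l (((2 * t).descFactorial (2 * t - l) : ℤ) * q l)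

lemma coeff_scaledPoly (t : ℕ) (q : Fin (2 * t) → ℤ) (l : ℕ) : (scaledPoly t q).coeff l =
    if h : l < 2 * t then ((2 * t).descFactorial (2 * t - l) : ℤ) * q ⟨l, h⟩ else 0 := by
  rw [scaledPoly, finsetSum_coeff]
  simp only [coeff_monomial]
  split_ifs with h
  · rw [Finset.sum_eq_single ⟨l, h⟩]
    · simp
    · intro x _ hx
      rw [if_neg fun h' ↦ hx (Fin.ext h')]
    · simp
  · exact Finset.sum_eq_zero fun x _ ↦ if_neg fun h' : (x : ℕ) = l ↦ h (h' ▸ x.2)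

lemma factorial_mul_coeff_scaledPoly (t : ℕ) (q : Fin (2 * t) → ℤ) (l : ℕ) :
    (l ! : ℤ) * (scaledPoly t q).coeff l =
      if h : l < 2 * t then ((2 * t)! : ℤ) * q ⟨l, h⟩ else 0 := by
  rw [coeff_scaledPoly]
  split_ifs with h
  · have := Nat.factorial_mul_descFactorial (n := 2 * t) (k := 2 * t - l) (by omega)
    rw [show 2 * t - (2 * t - l) = l by omega] at this
    rw [← mul_assoc]
    congr 1
    exact_mod_cast this
  · simp

lemma coeff_scaledPoly_mul (t : ℕ) (q : Fin (2 * t) → ℤ) {f : PowerSeries ℚ} {c : ℕ → ℤ}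
    (hc : ∀ m, (m ! : ℚ) * PowerSeries.coeff m f = c m) (m : ℕ) :
    (m ! : ℚ) * PowerSeries.coeff m (algebraMap ℤ[X] (PowerSeries ℚ) (scaledPoly t q) * f) =
      (((2 * t)! * ∑ l : Fin (2 * t), (m.choose l * c (m - l)) * q l : ℤ) : ℚ) := by
  rw [PowerSeries.coeff_mul, Finset.Nat.sum_antidiagonal_eq_sum_range_succ_mk]
  have h1 : ∀ l ∈ Finset.range m.succ,
      (m ! : ℚ) * (PowerSeries.coeff l (algebraMap ℤ[X] (PowerSeries ℚ) (scaledPoly t q)) *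
        PowerSeries.coeff (m - l) f) =
      ((m.choose l * c (m - l) *
        if h : l < 2 * t then ((2 * t)! : ℤ) * q ⟨l, h⟩ else 0 : ℤ) : ℚ) := by
    intro l hl
    have hl := Finset.mem_range.1 hl
    rw [← factorial_mul_coeff_scaledPoly, coeff_algebraMap_series,
      ← Nat.choose_mul_factorial_mul_factorial (Nat.lt_succ_iff.1 hl)]
    push_cast
    rw [← hc]
    ring
  rw [Finset.mul_sum, Finset.sum_congr rfl h1, ← Int.cast_sum]
  congr 1
  set g : ℕ → ℤ := fun l ↦ m.choose l * c (m - l) *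
    if h : l < 2 * t then ((2 * t)! : ℤ) * q ⟨l, h⟩ else 0 with hg
  have h2 : ∑ l ∈ Finset.range m.succ, g l = ∑ l ∈ Finset.range (m + 1 + 2 * t), g l := by
    refine Finset.sum_subset (Finset.range_mono (by omega)) fun l _ hl ↦ ?_
    simp only [hg]
    rw [Nat.choose_eq_zero_of_lt (by simpa using hl)]
    simp
  have h3 : ∑ l ∈ Finset.range (2 * t), g l = ∑ l ∈ Finset.range (m + 1 + 2 * t), g l := by
    refine Finset.sum_subset (Finset.range_mono (by omega)) fun l _ hl ↦ ?_
    simp only [hg]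
    rw [dif_neg (by simpa using hl), mul_zero]
  rw [h2, ← h3, ← Fin.sum_univ_eq_sum_range, Finset.mul_sum]
  refine Finset.sum_congr rfl fun l _ ↦ ?_
  simp only [hg]
  rw [dif_pos l.2]
  ring

/-- Auxiliary polynomials for which the form in the Bessel series vanishes to high order. -/
lemma exists_auxiliary_tuple (N M : ℕ) (hM : M = (monoIdx (Finset.range (N + 1))).card) :
    ∃ C : ℕ, 0 < C ∧ ∀ t, 0 < t → ∃ P : ℕ → ℤ[X][X], (∀ k, (P k).natDegree ≤ k) ∧
      (∀ k, N < k → P k = 0) ∧ P ≠ 0 ∧ (∀ k j, ((P k).coeff j).natDegree ≤ 2 * t - 1) ∧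
      (∀ k j l, |((P k).coeff j).coeff l| ≤ (2 * t)! * (C : ℤ) ^ t) ∧
      PowerSeries.X ^ ((2 * M - 1) * t) ∣ besselForm (Finset.range (N + 1)) P ∧
      ∀ m, (m ! : ℚ) * |PowerSeries.coeff m (besselForm (Finset.range (N + 1)) P)| ≤
        (2 * t)! * (C : ℚ) ^ t * (C : ℚ) ^ m := by
  classical
  set S := Finset.range (N + 1) with hS
  have hMpos : 0 < M := by
    rw [hM, Finset.card_pos]
    exact ⟨⟨0, 0⟩, mem_monoIdx.2 ⟨by simp [hS], le_rfl⟩⟩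
  choose c hc hcB using fun a : monoIdx S ↦ isESeries_monomial (N := N) (k := a.1.1) (j := a.1.2)
    (by have := (mem_monoIdx.1 a.2).1; simp [hS] at this; omega) (mem_monoIdx.1 a.2).2
  set e := 2 * M - 1 with he
  set D := 8 * N + 1 with hD
  let C1 : ℕ := (2 * (2 * M) * D ^ e) ^ e
  have hbound : ∀ a m l, |((m.choose l : ℤ) * c a (m - l))| ≤ (D : ℤ) ^ m := by
    intro a m l
    rcases lt_or_ge m l with h | h
    · rw [Nat.choose_eq_zero_of_lt h]
      simp only [Nat.cast_zero, zero_mul, abs_zero]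
      positivity
    · rw [abs_mul, Nat.abs_cast, hD]
      push_cast
      rw [add_pow]
      refine (mul_le_mul_of_nonneg_left (hcB a (m - l)) (by positivity)).trans ?_
      refine le_trans (le_of_eq ?_) (Finset.single_le_sum (f := fun i ↦ (8 * (N : ℤ)) ^ i
        * 1 ^ (m - i) * (m.choose i : ℤ)) (fun i _ ↦ by positivity)
        (Finset.mem_range.2 (show m - l < m + 1 by omega)))
      simp only [Nat.choose_symm h]
      push_cast
      ring
  refine ⟨C1 * (4 * M) * D, by positivity, fun t ht ↦ ?_⟩
  have hDpos : 1 ≤ D := by omega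
  obtain ⟨q, hq0, hq, hqB⟩ := exists_int_solution
    (fun (m : Fin (e * t)) (b : monoIdx S × Fin (2 * t)) ↦
      ((m : ℕ).choose b.2 : ℤ) * c b.1 (m - b.2)) (e := e) (t := t) (B := D ^ (e * t))
    (by simp) (by
      simp only [Fintype.card_prod, Fintype.card_coe, Fintype.card_fin, ← hM]
      rw [show e + 1 = 2 * M by omega]
      ring) (by omega) ht (Nat.one_le_pow _ _ hDpos) (fun m b ↦ (hbound _ _ _).trans (by
        push_cast
        exact pow_le_pow_right₀ (by exact_mod_cast hDpos) m.2.le))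
  have hqC : ∀ b, |q b| ≤ (C1 : ℤ) ^ t := by
    intro b
    refine (hqB b).trans ?_
    norm_cast
    rw [show C1 ^ t = ((2 * (2 * M) * D ^ e) ^ t) ^ e by
      rw [← pow_mul, ← pow_mul, mul_comm e t]]
    refine Nat.pow_le_pow_left ?_ e
    rw [show e + 1 = 2 * M by omega, mul_pow, mul_pow, ← pow_mul, mul_comm (2 * M) t]
    refine Nat.mul_le_mul (Nat.mul_le_mul Nat.lt_two_pow_self.le ?_) le_rfl
    exact Nat.le_self_pow ht.ne' _
  let p : monoIdx S → ℤ[X] := fun a ↦ scaledPoly t fun l ↦ q (a, l)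
  have hcoeff : ∀ m, (m ! : ℚ) * PowerSeries.coeff m (besselForm S (tupleOf S p)) =
      (((2 * t)! * ∑ b : monoIdx S × Fin (2 * t),
        (m.choose b.2 * c b.1 (m - b.2)) * q b : ℤ) : ℚ) := by
    intro m
    rw [besselForm_tupleOf, map_sum, Finset.mul_sum,
      Finset.sum_congr rfl fun a _ ↦ coeff_scaledPoly_mul t _ (hc a) m, ← Int.cast_sum,
      ← Finset.mul_sum, Fintype.sum_prod_type]
  refine ⟨tupleOf S p, natDegree_tupleOf_le S p, fun k hk ↦ ?_, ?_, fun k j ↦ ?_, fun k j l ↦ ?_,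
    ?_, fun m ↦ ?_⟩
  · ext1 j
    rw [coeff_tupleOf, dif_neg, coeff_zero]
    intro h
    have := (mem_monoIdx.1 h).1
    simp [hS] at this
    omega
  · intro h0
    apply hq0
    funext ⟨a, l⟩
    have h1 := congrArg (fun f : ℕ → ℤ[X][X] ↦ ((f a.1.1).coeff a.1.2).coeff l) h0
    simp only [coeff_tupleOf, dif_pos a.2, p, coeff_scaledPoly, dif_pos l.2, Pi.zero_apply,
      coeff_zero] at h1
    refine (mul_eq_zero.1 h1).resolve_left ?_
    have := Nat.pos_of_ne_zero (fun h ↦ absurd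
      ((Nat.descFactorial_eq_zero_iff_lt (n := 2 * t) (k := 2 * t - l)).1 h) (by omega))
    exact_mod_cast this.ne'
  · rw [natDegree_le_iff_coeff_eq_zero]
    intro l hl
    rw [coeff_tupleOf]
    split_ifs with h
    · rw [coeff_scaledPoly, dif_neg (by omega)]
    · simp
  · rw [coeff_tupleOf]
    split_ifs with h
    · rw [coeff_scaledPoly]
      split_ifs with hl
      · rw [abs_mul, Nat.abs_cast]
        refine mul_le_mul ?_ ((hqC _).trans ?_) (abs_nonneg _) (by positivity)
        · rw [← Nat.factorial_mul_descFactorial (n := 2 * t) (k := 2 * t - l) (by omega)]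
          exact_mod_cast Nat.le_mul_of_pos_left _ (Nat.factorial_pos _)
        · push_cast
          refine pow_le_pow_left₀ (by positivity) ?_ _
          norm_cast
          rw [mul_assoc]
          exact Nat.le_mul_of_pos_right _ (by positivity)
      · simp only [abs_zero]; positivity
    · simp only [coeff_zero, abs_zero]; positivity
  · rw [PowerSeries.X_pow_dvd_iff]
    intro m hm
    have h1 := congrFun hq ⟨m, hm⟩
    have h2 := hcoeff m
    simp only [Matrix.mulVec, dotProduct, Pi.zero_apply] at h1
    rw [h1, mul_zero, Int.cast_zero] at h2
    exact (mul_eq_zero.1 h2).resolve_left (by positivity)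
  · have h1 : (m ! : ℚ) * |PowerSeries.coeff m (besselForm S (tupleOf S p))| =
        |(m ! : ℚ) * PowerSeries.coeff m (besselForm S (tupleOf S p))| := by
      rw [abs_mul, Nat.abs_cast]
    rw [h1, hcoeff, ← Int.cast_abs, abs_mul, Nat.abs_cast]
    have h2 : |∑ b : monoIdx S × Fin (2 * t), (m.choose b.2 * c b.1 (m - b.2)) * q b| ≤
        (M * (2 * t)) * ((D : ℤ) ^ m * (C1 : ℤ) ^ t) := by
      refine (Finset.abs_sum_le_sum_abs _ _).trans ((Finset.sum_le_card_nsmul _ _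
        ((D : ℤ) ^ m * (C1 : ℤ) ^ t) fun b _ ↦ ?_).trans ?_)
      · rw [abs_mul]
        exact mul_le_mul (hbound _ _ _) (hqC _) (abs_nonneg _) (by positivity)
      · rw [Finset.card_univ, Fintype.card_prod, Fintype.card_coe, Fintype.card_fin, ← hM,
          nsmul_eq_mul]
        push_cast
        rfl
    have h3 : (M : ℤ) * (2 * t) ≤ (4 * M) ^ t := by
      have h4 : M * (2 * t) ≤ (4 * M) ^ t := by
        calc M * (2 * t) = 2 * M * t := by ring
          _ ≤ (2 * M) ^ t * 2 ^ t :=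
            Nat.mul_le_mul (Nat.le_self_pow ht.ne' _) Nat.lt_two_pow_self.le
          _ = _ := by rw [← mul_pow]; ring
      exact_mod_cast h4
    have h4 : (D : ℤ) ^ m ≤ (C1 * (4 * M) * D : ℕ) ^ m := by
      refine pow_le_pow_left₀ (by positivity) ?_ _
      norm_cast
      exact Nat.le_mul_of_pos_left _ (by positivity)
    have h5 : (1 : ℤ) ≤ (D : ℤ) ^ t := one_le_pow₀ (by exact_mod_cast hDpos)
    have h6 : ((2 * t)! : ℤ) * |∑ b : monoIdx S × Fin (2 * t),
        (m.choose b.2 * c b.1 (m - b.2)) * q b| ≤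
        (2 * t)! * ((C1 * (4 * M) * D : ℕ) : ℤ) ^ t * ((C1 * (4 * M) * D : ℕ) : ℤ) ^ m := by
      rw [mul_assoc]
      refine mul_le_mul_of_nonneg_left (h2.trans ?_) (by positivity)
      calc (M : ℤ) * (2 * t) * ((D : ℤ) ^ m * (C1 : ℤ) ^ t)
          ≤ (4 * M) ^ t * (((C1 * (4 * M) * D : ℕ) : ℤ) ^ m * (C1 : ℤ) ^ t) := by gcongr
        _ = (C1 : ℤ) ^ t * (4 * M) ^ t * 1 * ((C1 * (4 * M) * D : ℕ) : ℤ) ^ m := by ring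
        _ ≤ (C1 : ℤ) ^ t * (4 * M) ^ t * (D : ℤ) ^ t * ((C1 * (4 * M) * D : ℕ) : ℤ) ^ m := by
          gcongr
        _ = _ := by push_cast; rw [← mul_pow, ← mul_pow]
    exact_mod_cast h6

/-- The power series converging absolutely at `z`. -/
def convSubring (z : ℂ) : Subring (PowerSeries ℚ) where
  carrier := {f | Summable fun n ↦ ‖((PowerSeries.coeff n f : ℚ) : ℂ) * z ^ n‖}
  mul_mem' {f g} hf hg := by
    have h := summable_norm_sum_mul_antidiagonal_of_summable_norm hf hg
    refine h.congr fun n ↦ ?_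
    rw [PowerSeries.coeff_mul, Rat.cast_sum, Finset.sum_mul]
    congr 1
    refine Finset.sum_congr rfl fun x hx ↦ ?_
    rw [← Finset.HasAntidiagonal.mem_antidiagonal.1 hx, pow_add]
    push_cast
    ring
  one_mem' := by
    refine summable_of_ne_finset_zero (s := {0}) fun n hn ↦ ?_
    rw [PowerSeries.coeff_one, if_neg (by simpa using hn)]
    simp
  add_mem' {f g} hf hg := by
    refine (hf.add hg).of_nonneg_of_le (fun _ ↦ norm_nonneg _) fun n ↦ ?_
    rw [map_add, Rat.cast_add, add_mul]
    exact norm_add_le _ _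
  zero_mem' := by simp
  neg_mem' {f} hf := by simpa using hf

lemma mem_convSubring {z : ℂ} {f : PowerSeries ℚ} : f ∈ convSubring z ↔
    Summable fun n ↦ ‖((PowerSeries.coeff n f : ℚ) : ℂ) * z ^ n‖ := Iff.rfl

/-- The sum of a power series with rational coefficients at a complex number. -/
def seriesValue (z : ℂ) (f : PowerSeries ℚ) : ℂ :=
  ∑' n, ((PowerSeries.coeff n f : ℚ) : ℂ) * z ^ n

/-- Evaluation at `z` as a ring homomorphism. -/
def seriesValueHom (z : ℂ) : convSubring z →+* ℂ where
  toFun f := seriesValue z f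
  map_one' := by
    rw [seriesValue, tsum_eq_single 0]
    · simp
    · intro n hn
      simp [PowerSeries.coeff_one, hn]
  map_zero' := by simp [seriesValue]
  map_add' f g := by
    rw [seriesValue, seriesValue, seriesValue, ← (Summable.of_norm f.2).tsum_add (.of_norm g.2)]
    refine tsum_congr fun n ↦ ?_
    simp [add_mul]
  map_mul' f g := by
    rw [seriesValue, seriesValue, seriesValue,
      tsum_mul_tsum_eq_tsum_sum_antidiagonal_of_summable_norm f.2 g.2]
    refine tsum_congr fun n ↦ ?_
    rw [Subring.coe_mul, PowerSeries.coeff_mul, Rat.cast_sum, Finset.sum_mul]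
    refine Finset.sum_congr rfl fun x hx ↦ ?_
    rw [← Finset.HasAntidiagonal.mem_antidiagonal.1 hx, pow_add]
    push_cast
    ring

lemma seriesValueHom_apply (z : ℂ) (f : convSubring z) :
    seriesValueHom z f = seriesValue z f := rfl

lemma algebraMap_mem_convSubring (z : ℂ) (p : ℤ[X]) :
    algebraMap ℤ[X] (PowerSeries ℚ) p ∈ convSubring z := by
  refine summable_of_ne_finset_zero (s := p.support) fun n hn ↦ ?_
  rw [coeff_algebraMap_series, notMem_support_iff.1 hn]
  simp

lemma seriesValue_algebraMap (z : ℂ) (p : ℤ[X]) :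
    seriesValue z (algebraMap ℤ[X] (PowerSeries ℚ) p) = aeval z p := by
  rw [seriesValue, tsum_eq_sum (s := p.support), aeval_def, eval₂_eq_sum, Polynomial.sum]
  · refine Finset.sum_congr rfl fun n _ ↦ ?_
    rw [coeff_algebraMap_series]
    simp
  · intro n hn
    rw [coeff_algebraMap_series, notMem_support_iff.1 hn]
    simp

lemma IsESeries.mem_convSubring {C : ℕ} {f : PowerSeries ℚ} (hf : IsESeries C f) (z : ℂ) :
    f ∈ convSubring z := by
  refine (Real.summable_pow_div_factorial (C * ‖z‖)).of_nonneg_of_le (fun _ ↦ norm_nonneg _)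
    fun n ↦ ?_
  obtain ⟨c, hc, hcC⟩ := hf n
  have h0 : (0 : ℝ) < n ! := by positivity
  have h1 : ((n ! : ℝ)) * |((PowerSeries.coeff n f : ℚ) : ℝ)| ≤ C ^ n := by
    have : ((n ! : ℚ)) * |PowerSeries.coeff n f| ≤ C ^ n := by
      rw [← Nat.abs_cast, ← abs_mul, hc]
      exact_mod_cast hcC
    exact_mod_cast this
  rw [norm_mul, norm_pow, le_div_iff₀ h0, Complex.norm_ratCast, mul_pow]
  calc _ = ((n ! : ℝ)) * |((PowerSeries.coeff n f : ℚ) : ℝ)| * ‖z‖ ^ n := by ring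
    _ ≤ _ := by gcongr

lemma seriesValue_besselForm (z : ℂ) (N : ℕ) {W : ℕ → ℤ[X][X]} (hW : ∀ k, (W k).natDegree ≤ k) :
    seriesValue z (besselForm (Finset.range (N + 1)) W) = ∑ j ∈ Finset.range (N + 1),
      evalTuple N z (seriesValue z besselSeries) W j * seriesValue z (besselSeries′) ^ j := by
  let ι : ℤ[X] → convSubring z := fun p ↦ ⟨_, algebraMap_mem_convSubring z p⟩
  let A : convSubring z := ⟨_, isESeries_besselSeries.mem_convSubring z⟩
  let Y : convSubring z := ⟨_, isESeries_euler_besselSeries.mem_convSubring z⟩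
  have h : besselForm (Finset.range (N + 1)) W = ((∑ k ∈ Finset.range (N + 1),
      ∑ j ∈ Finset.range (N + 1), ι ((W k).coeff j) * (A ^ (k - j) * Y ^ j) : convSubring z) :
        PowerSeries ℚ) := by
    rw [besselForm]
    push_cast
    refine Finset.sum_congr rfl fun k hk ↦ ?_
    rw [homValue_apply]
    refine Finset.sum_subset (Finset.range_mono (by simpa using hk)) fun j _ hj ↦ ?_
    rw [coeff_eq_zero_of_natDegree_lt ((hW k).trans_lt (by simp at hj; omega))]
    simp
  rw [h, ← seriesValueHom_apply, map_sum, Finset.sum_congr rfl fun k _ ↦ map_sum _ _ _,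
    Finset.sum_comm]
  refine Finset.sum_congr rfl fun j _ ↦ ?_
  rw [evalTuple, Finset.sum_mul]
  refine Finset.sum_congr rfl fun k _ ↦ ?_
  rw [map_mul, map_mul, map_pow, map_pow]
  simp only [seriesValueHom_apply, ι, A, Y, seriesValue_algebraMap]
  ring

lemma coeff_iterate_euler (f : PowerSeries ℚ) (i n : ℕ) :
    PowerSeries.coeff n ((fun f : PowerSeries ℚ ↦ f′)^[i] f) = n ^ i * PowerSeries.coeff n f := by
  induction i with
  | zero => simp
  | succ i ih =>
    rw [Function.iterate_succ_apply', coeff_seriesEuler, ih]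
    ring

lemma pow_le_factorial_mul_three_pow (m i : ℕ) : (m : ℝ) ^ i ≤ i ! * 3 ^ m := by
  have h := Real.pow_div_factorial_le_exp (m : ℝ) (by positivity) i
  rw [div_le_iff₀ (by positivity)] at h
  refine h.trans ?_
  rw [mul_comm, ← Real.exp_one_pow]
  gcongr
  exact (Real.exp_one_lt_d9.trans (by norm_num)).le

lemma norm_seriesValue_iterate_le {z : ℂ} {f : PowerSeries ℚ} {T : ℕ} {C H : ℝ} (hC : 0 ≤ C)
    (hH : 0 ≤ H) (hT : PowerSeries.X ^ T ∣ f)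
    (hf : ∀ m, (m ! : ℝ) * |((PowerSeries.coeff m f : ℚ) : ℝ)| ≤ H * C ^ m) (i : ℕ) :
    ‖seriesValue z ((fun f : PowerSeries ℚ ↦ f′)^[i] f)‖ ≤
      H * i ! * ((3 * C * ‖z‖) ^ T / T !) * ∑' r : ℕ, (3 * C * ‖z‖) ^ r / r ! := by
  set u := 3 * C * ‖z‖ with hu
  have hu0 : 0 ≤ u := by positivity
  have hterm : ∀ m, ‖((PowerSeries.coeff m ((fun f : PowerSeries ℚ ↦ f′)^[i] f) : ℚ) : ℂ) * z ^ m‖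
      ≤ H * i ! * (u ^ m / m !) := by
    intro m
    rw [coeff_iterate_euler, norm_mul, norm_pow, Complex.norm_ratCast, Rat.cast_mul, abs_mul,
      Rat.cast_pow, Rat.cast_natCast, abs_pow, Nat.abs_cast]
    have h1 : |((PowerSeries.coeff m f : ℚ) : ℝ)| ≤ H * C ^ m / m ! := by
      rw [le_div_iff₀ (by positivity), mul_comm]
      exact hf m
    calc (m : ℝ) ^ i * |((PowerSeries.coeff m f : ℚ) : ℝ)| * ‖z‖ ^ m
        ≤ (i ! * 3 ^ m) * (H * C ^ m / m !) * ‖z‖ ^ m := by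
          gcongr
          exact pow_le_factorial_mul_three_pow m i
      _ = H * i ! * (u ^ m / m !) := by rw [hu]; ring
  have hsum : Summable fun m ↦
      ((PowerSeries.coeff m ((fun f : PowerSeries ℚ ↦ f′)^[i] f) : ℚ) : ℂ) * z ^ m :=
    Summable.of_norm_bounded ((Real.summable_pow_div_factorial u).mul_left _) hterm
  rw [seriesValue, ← hsum.sum_add_tsum_nat_add T, Finset.sum_eq_zero, zero_add, ← tsum_mul_left]
  · refine tsum_of_norm_bounded ((Real.summable_pow_div_factorial u).mul_left _).hasSum fun r ↦ ?_
    refine (hterm _).trans ?_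
    rw [mul_assoc (H * (i ! : ℝ))]
    refine mul_le_mul_of_nonneg_left ?_ (by positivity)
    rw [div_mul_div_comm, ← pow_add, add_comm r T]
    gcongr
    exact_mod_cast Nat.le_of_dvd (Nat.factorial_pos _)
      (Nat.factorial_mul_factorial_dvd_factorial_add T r)
  · intro m hm
    rw [coeff_iterate_euler, PowerSeries.X_pow_dvd_iff.1 hT m (Finset.mem_range.1 hm)]
    simp

lemma abs_coeff_polyEuler_le {n : ℕ} {p : ℤ[X]} {H : ℤ} (hn : p.natDegree ≤ n) (hH : 0 ≤ H)
    (hp : ∀ l, |p.coeff l| ≤ H) (l : ℕ) : |(p′).coeff l| ≤ n * H := by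
  rw [coeff_polyEuler]
  by_cases hl : l ≤ n
  · rw [abs_mul, Nat.abs_cast]
    have := hp l
    gcongr
  · rw [coeff_eq_zero_of_natDegree_lt (by omega), mul_zero, abs_zero]
    positivity

lemma abs_coeff_C_mul_X_mul_le {p : ℤ[X]} {H : ℤ} (hp : ∀ l, |p.coeff l| ≤ H) (c : ℤ) (l : ℕ) :
    |(C c * (X * p)).coeff l| ≤ |c| * H := by
  rw [coeff_C_mul, abs_mul]
  refine mul_le_mul_of_nonneg_left ?_ (abs_nonneg c)
  cases l with
  | zero => simpa using (abs_nonneg _).trans (hp 0)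
  | succ l => simpa using hp l

lemma abs_coeff_twist_le {n k : ℕ} {q : ℤ[X][X]} {H : ℤ} (hk : q.natDegree ≤ k)
    (hn : ∀ j, (q.coeff j).natDegree ≤ n) (hq : ∀ j l, |(q.coeff j).coeff l| ≤ H) (j l : ℕ) :
    |((twist k q).coeff j).coeff l| ≤ (n + 7 * k + 8 : ℕ) * H := by
  have hH : 0 ≤ H := (abs_nonneg _).trans (hq 0 0)
  have h1 := fun j ↦ abs_coeff_polyEuler_le (hn j) hH (hq j) l
  have h2 := fun c j ↦ abs_coeff_C_mul_X_mul_le (hq j) c l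
  push_cast
  cases j with
  | zero =>
    rw [coeff_twist_zero, show (2 : ℤ[X]) * X * q.coeff 1 = C 2 * (X * q.coeff 1) by
      simp [mul_assoc], coeff_add]
    have h3 := h2 2 1
    rw [abs_of_nonneg (by norm_num : (0 : ℤ) ≤ 2)] at h3
    refine (abs_add_le _ _).trans ((add_le_add (h1 0) h3).trans ?_)
    nlinarith [mul_nonneg (Nat.cast_nonneg (α := ℤ) k) hH]
  | succ i =>
    by_cases hik : i ≤ k
    · rw [coeff_twist_succ, show (4 : ℤ[X]) * X * ((i : ℤ[X]) + 1) * q.coeff (i + 1) =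
          C (4 * ((i : ℤ) + 1)) * (X * q.coeff (i + 1)) by simp; ring,
        show (2 : ℤ[X]) * X * ((i : ℤ[X]) + 2) * q.coeff (i + 2) =
          C (2 * ((i : ℤ) + 2)) * (X * q.coeff (i + 2)) by simp; ring,
        show ((k : ℤ[X]) - (i : ℤ[X])) * q.coeff i = C ((k : ℤ) - i) * q.coeff i by simp,
        coeff_add, coeff_add, coeff_add]
      have h3 := h2 (4 * ((i : ℤ) + 1)) (i + 1)
      have h4 := h2 (2 * ((i : ℤ) + 2)) (i + 2)
      rw [abs_of_nonneg (by positivity : (0 : ℤ) ≤ 4 * ((i : ℤ) + 1))] at h3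
      rw [abs_of_nonneg (by positivity : (0 : ℤ) ≤ 2 * ((i : ℤ) + 2))] at h4
      have h5 : |(C ((k : ℤ) - i) * q.coeff i).coeff l| ≤ ((k : ℤ) - i) * H := by
        have hki : (0 : ℤ) ≤ (k : ℤ) - i := by omega
        rw [coeff_C_mul, abs_mul, abs_of_nonneg hki]
        exact mul_le_mul_of_nonneg_left (hq i l) hki
      refine (abs_add_le _ _).trans ((add_le_add ((abs_add_le _ _).trans (add_le_add
        ((abs_add_le _ _).trans (add_le_add (h1 _) h3)) h4)) h5).trans ?_)
      have : (i : ℤ) * H ≤ k * H := mul_le_mul_of_nonneg_right (by exact_mod_cast hik) hH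
      nlinarith
    · rw [coeff_eq_zero_of_natDegree_lt ((natDegree_twist_le hk).trans_lt (by omega))]
      simp only [coeff_zero, abs_zero]
      positivity

lemma abs_coeff_iterate_twist_le {n k m : ℕ} {q : ℤ[X][X]} {H : ℤ} (hk : q.natDegree ≤ k)
    (hn : ∀ j, (q.coeff j).natDegree ≤ n) (hq : ∀ j l, |(q.coeff j).coeff l| ≤ H) (i : ℕ)
    (hm : n + i + 7 * k + 8 ≤ m) (j l : ℕ) :
    |(((twist k)^[i] q).coeff j).coeff l| ≤ (m : ℤ) ^ i * H := by
  induction i generalizing j l with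
  | zero => simpa using hq j l
  | succ i ih =>
    have hH : 0 ≤ H := (abs_nonneg _).trans (hq 0 0)
    rw [Function.iterate_succ_apply']
    refine (abs_coeff_twist_le (natDegree_iterate_twist_le hk i)
      (natDegree_coeff_iterate_twist_le hn i) (ih (by omega)) j l).trans ?_
    rw [pow_succ', mul_assoc]
    gcongr
    omega

lemma norm_aeval_le {p : ℤ[X]} {H : ℤ} {D : ℕ} (hp : ∀ l, |p.coeff l| ≤ H)
    (hD : p.natDegree ≤ D) (z : ℂ) : ‖aeval z p‖ ≤ H * (1 + ‖z‖) ^ D := by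
  have hH : 0 ≤ H := (abs_nonneg _).trans (hp 0)
  rw [aeval_eq_sum_range' (Nat.lt_succ_of_le hD), add_comm, add_pow, Finset.mul_sum]
  refine (norm_sum_le _ _).trans (Finset.sum_le_sum fun l hl ↦ ?_)
  rw [zsmul_eq_mul, norm_mul, norm_pow, Complex.norm_intCast, one_pow, mul_one]
  have h1 : |((p.coeff l : ℤ) : ℝ)| ≤ H := by exact_mod_cast hp l
  have h2 : (1 : ℝ) ≤ D.choose l := by
    exact_mod_cast Nat.choose_pos (by simpa [Nat.lt_succ_iff] using hl)
  have h3 : (0 : ℝ) ≤ H := by exact_mod_cast hH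
  calc _ ≤ (H : ℝ) * ‖z‖ ^ l := by gcongr
    _ ≤ _ := by
      gcongr
      exact le_mul_of_one_le_right (by positivity) h2

lemma norm_evalTuple_le {N n m : ℕ} {P : ℕ → ℤ[X][X]} {H : ℤ} (hP : ∀ k, (P k).natDegree ≤ k)
    (hn : ∀ k j, ((P k).coeff j).natDegree ≤ n) (hH : ∀ k j l, |((P k).coeff j).coeff l| ≤ H)
    {i : ℕ} (hm : n + i + 7 * N + 8 ≤ m) (z w : ℂ) (j : ℕ) :
    ‖evalTuple N z w (seqTwist^[i] P) j‖ ≤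
      (N + 1) * (1 + ‖w‖) ^ N * ((m : ℝ) ^ i * H * (1 + ‖z‖) ^ m) := by
  have hH0 : 0 ≤ H := (abs_nonneg _).trans (hH 0 0 0)
  have hH0' : (0 : ℝ) ≤ H := by exact_mod_cast hH0
  refine (norm_sum_le_of_le (Finset.range (N + 1)) (n := fun _ ↦
    (1 + ‖w‖) ^ N * ((m : ℝ) ^ i * H * (1 + ‖z‖) ^ m)) fun k hk ↦ ?_).trans_eq ?_
  · have hk' : k ≤ N := by simpa [Nat.lt_succ_iff] using hk
    rw [norm_mul, norm_pow, mul_comm, iterate_seqTwist]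
    have h1 := norm_aeval_le (fun l ↦ abs_coeff_iterate_twist_le (hP k) (hn k) (hH k) i
      (m := m) (by omega) j l) (D := m)
      ((natDegree_coeff_iterate_twist_le (hn k) i j).trans (by omega)) z
    push_cast at h1
    have h2 : ‖w‖ ^ (k - j) ≤ (1 + ‖w‖) ^ N :=
      (pow_le_pow_left₀ (norm_nonneg _) (by linarith) _).trans
        (pow_le_pow_right₀ (by linarith [norm_nonneg w]) (by omega))
    gcongr
  · simp [mul_assoc]

lemma exists_det_ne_zero {F : Type*} [Field F] {n m : ℕ} (x : ℕ → Fin n → F)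
    (h : ∀ f : Fin n → F, (∀ i < m, ∑ j, f j * x i j = 0) → f = 0) :
    ∃ r : Fin n → ℕ, (∀ b, r b < m) ∧ (Matrix.of fun b j ↦ x (r b) j).det ≠ 0 := by
  have hspan : Submodule.span F (x '' Set.Iio m) = ⊤ := by
    by_contra hne
    obtain ⟨f, hf, hle⟩ := Submodule.exists_le_ker_of_lt_top _ (lt_top_iff_ne_top.2 hne)
    refine hf (LinearMap.pi_ext' fun j ↦ LinearMap.ext_ring ?_)
    have := h (fun j ↦ f (Pi.single j 1)) fun i hi ↦ by
      have h0 : f (x i) = 0 := hle (Submodule.subset_span ⟨i, hi, rfl⟩)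
      rw [LinearMap.pi_apply_eq_sum_univ] at h0
      rw [← h0]
      exact Finset.sum_congr rfl fun j _ ↦ by
        rw [smul_eq_mul, mul_comm]
        congr 2
        funext l
        simp [Pi.single_apply, eq_comm]
    simpa using congrFun this j
  have hfr : Module.finrank F (Submodule.span F (x '' Set.Iio m)) = n := by
    rw [hspan, finrank_top, Module.finrank_fin_fun]
  obtain ⟨f, hf, -, hli⟩ := Submodule.exists_fun_fin_finrank_span_eq F (x '' Set.Iio m)
  choose r hr hrf using hf
  refine ⟨fun b ↦ r (Fin.cast hfr.symm b), fun b ↦ hr _, ?_⟩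
  rw [← isUnit_iff_ne_zero, ← Matrix.isUnit_iff_isUnit_det,
    ← Matrix.linearIndependent_rows_iff_isUnit]
  have := hli.comp (Fin.cast hfr.symm) (Fin.cast_injective _)
  rwa [show f ∘ Fin.cast hfr.symm = fun b ↦ x (r (Fin.cast hfr.symm b)) from
    funext fun b ↦ (hrf _).symm] at this

/-- Liouville's inequality. -/
lemma one_le_mul_pow_of_isIntegral {K : Type*} [Field K] [NumberField K] {x : K}
    (hx : IsIntegral ℤ x) (hx0 : x ≠ 0) {B ε : ℝ} (hB : ∀ σ : K →ₐ[ℚ] ℂ, ‖σ x‖ ≤ B)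
    (σ₀ : K →ₐ[ℚ] ℂ) (hε : ‖σ₀ x‖ ≤ ε) : 1 ≤ ε * B ^ (Module.finrank ℚ K - 1) := by
  classical
  have h1 := Algebra.norm_eq_prod_embeddings ℚ ℂ x
  obtain ⟨a, ha⟩ := IsIntegrallyClosed.isIntegral_iff.1 (Algebra.isIntegral_norm ℚ hx)
  have ha0 : a ≠ 0 := by
    rintro rfl
    rw [map_zero, eq_comm, Algebra.norm_eq_zero_iff] at ha
    exact hx0 ha
  rw [← ha] at h1
  have h2 : (1 : ℝ) ≤ ∏ σ : K →ₐ[ℚ] ℂ, ‖σ x‖ := by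
    rw [← norm_prod, ← h1]
    simp only [eq_intCast, map_intCast, Complex.norm_intCast]
    exact_mod_cast Int.one_le_abs ha0
  rw [← Finset.mul_prod_erase _ _ (Finset.mem_univ σ₀)] at h2
  refine h2.trans (mul_le_mul hε ?_ (Finset.prod_nonneg fun _ _ ↦ norm_nonneg _)
    ((norm_nonneg _).trans hε))
  refine (Finset.prod_le_prod (fun _ _ ↦ norm_nonneg _) fun σ _ ↦ hB σ).trans_eq ?_
  rw [Finset.prod_const, Finset.card_erase_of_mem (Finset.mem_univ _), Finset.card_univ,
    AlgHom.card]

/-- Growth at most `K ^ t * t ^ (e * t)` for some constant `K`. -/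
def HasGrowth (e : ℤ) (g : ℕ → ℝ) : Prop :=
  ∃ K : ℝ, 1 ≤ K ∧ ∀ᶠ t : ℕ in Filter.atTop, 0 ≤ g t ∧ g t ≤ K ^ t * ((t : ℝ) ^ t) ^ e

lemma HasGrowth.mono {e : ℤ} {f g : ℕ → ℝ} (hg : HasGrowth e g)
    (h : ∀ᶠ t in Filter.atTop, 0 ≤ f t ∧ f t ≤ g t) : HasGrowth e f := by
  obtain ⟨K, hK, hg⟩ := hg
  refine ⟨K, hK, ?_⟩
  filter_upwards [hg, h] with t h1 h2
  exact ⟨h2.1, h2.2.trans h1.2⟩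

lemma HasGrowth.mul {e e' : ℤ} {f g : ℕ → ℝ} (hf : HasGrowth e f) (hg : HasGrowth e' g) :
    HasGrowth (e + e') fun t ↦ f t * g t := by
  obtain ⟨K, hK, hf⟩ := hf
  obtain ⟨K', hK', hg⟩ := hg
  refine ⟨K * K', one_le_mul_of_one_le_of_one_le hK hK', ?_⟩
  filter_upwards [hf, hg, Filter.eventually_gt_atTop 0] with t h1 h2 ht
  refine ⟨mul_nonneg h1.1 h2.1, (mul_le_mul h1.2 h2.2 h2.1 (h1.1.trans h1.2)).trans_eq ?_⟩
  rw [zpow_add₀ (by positivity), mul_pow]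
  ring

lemma hasGrowth_const_pow {c : ℝ} (hc : 0 ≤ c) (a b : ℕ) :
    HasGrowth 0 fun t ↦ c ^ (a * t + b) := by
  refine ⟨max 1 c ^ (a + b), one_le_pow₀ (le_max_left _ _), ?_⟩
  filter_upwards [Filter.eventually_ge_atTop 1] with t ht
  refine ⟨by positivity, ?_⟩
  rw [zpow_zero, mul_one, ← pow_mul]
  refine (pow_le_pow_left₀ hc (le_max_right 1 c) _).trans
    (pow_le_pow_right₀ (le_max_left _ _) ?_)
  nlinarith [Nat.mul_le_mul_left b ht]

lemma hasGrowth_const {c : ℝ} (hc : 0 ≤ c) : HasGrowth 0 fun _ ↦ c := by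
  simpa using hasGrowth_const_pow hc 0 1

lemma HasGrowth.pow {e : ℤ} {f : ℕ → ℝ} (hf : HasGrowth e f) (n : ℕ) :
    HasGrowth (n * e) fun t ↦ f t ^ n := by
  induction n with
  | zero => simpa using hasGrowth_const zero_le_one
  | succ n ih =>
    simp only [pow_succ]
    convert ih.mul hf using 1
    push_cast
    ring

lemma hasGrowth_pow_self : HasGrowth 1 fun t ↦ (t : ℝ) ^ t :=
  ⟨1, le_rfl, .of_forall fun t ↦ ⟨by positivity, by simp⟩⟩

lemma hasGrowth_linear_pow (L : ℕ) : HasGrowth 1 fun t ↦ (4 * t : ℝ) ^ (t + L) := by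
  have h := (hasGrowth_const_pow (c := 4) (by norm_num) 1 L).mul
    (hasGrowth_pow_self.mul (hasGrowth_const_pow (c := 2 ^ L) (by positivity) 1 0))
  refine h.mono (.of_forall fun t ↦ ⟨by positivity, ?_⟩)
  have : (t : ℝ) ≤ 2 ^ t := by exact_mod_cast Nat.lt_two_pow_self.le
  rw [mul_pow, pow_add (t : ℝ), one_mul, add_zero, ← pow_mul, mul_comm L, pow_mul]
  gcongr

lemma hasGrowth_factorial_add (L : ℕ) : HasGrowth 1 fun t ↦ ((t + L)! : ℝ) := by
  refine (hasGrowth_linear_pow L).mono ?_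
  filter_upwards [Filter.eventually_ge_atTop L] with t ht
  refine ⟨by positivity, ?_⟩
  calc ((t + L)! : ℝ) ≤ ((t + L : ℕ) : ℝ) ^ (t + L) := by exact_mod_cast Nat.factorial_le_pow _
    _ ≤ (4 * t : ℝ) ^ (t + L) := by
      gcongr
      exact_mod_cast (by omega : t + L ≤ 4 * t)

lemma hasGrowth_factorial_two_mul : HasGrowth 2 fun t ↦ ((2 * t)! : ℝ) := by
  have h := (hasGrowth_const_pow (c := 2) (by norm_num) 2 0).mul (hasGrowth_pow_self.pow 2)
  refine h.mono (.of_forall fun t ↦ ⟨by positivity, ?_⟩)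
  calc ((2 * t)! : ℝ) ≤ ((2 * t : ℕ) : ℝ) ^ (2 * t) := by
        exact_mod_cast Nat.factorial_le_pow _
    _ = _ := by
      push_cast
      rw [mul_pow, add_zero, ← pow_mul, mul_comm t]

lemma hasGrowth_inv_factorial {c : ℝ} (hc : 0 ≤ c) (m : ℕ) :
    HasGrowth (-m) fun t ↦ c ^ (m * t) / (m * t)! := by
  refine ⟨max 1 (c * 3) ^ m, one_le_pow₀ (le_max_left _ _), ?_⟩
  filter_upwards [Filter.eventually_gt_atTop 0] with t ht
  refine ⟨by positivity, ?_⟩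
  rw [zpow_neg, zpow_natCast, ← pow_mul, ← pow_mul, mul_comm t m, ← div_eq_mul_inv,
    div_le_div_iff₀ (by positivity) (by positivity)]
  rcases Nat.eq_zero_or_pos m with rfl | hm
  · simp
  calc c ^ (m * t) * (t : ℝ) ^ (m * t)
      ≤ c ^ (m * t) * ((m * t : ℕ) : ℝ) ^ (m * t) := by
        gcongr
        exact Nat.le_mul_of_pos_left t hm
    _ ≤ c ^ (m * t) * ((m * t)! * 3 ^ (m * t)) := by
        gcongr
        exact pow_le_factorial_mul_three_pow _ _
    _ = (c * 3) ^ (m * t) * (m * t)! := by rw [mul_pow]; ring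
    _ ≤ _ := by gcongr; exact le_max_right _ _

lemma HasGrowth.eventually_lt_one {e : ℤ} {g : ℕ → ℝ} (hg : HasGrowth e g) (he : e < 0) :
    ∀ᶠ t in Filter.atTop, g t < 1 := by
  obtain ⟨K, hK, hg⟩ := hg
  filter_upwards [hg, Filter.eventually_gt_atTop ⌈K⌉₊] with t h ht
  have htK : K < t := (Nat.le_ceil K).trans_lt (by exact_mod_cast ht)
  have ht0 : t ≠ 0 := by omega
  have ht1 : (1 : ℝ) ≤ (t : ℝ) ^ t := one_le_pow₀ (hK.trans htK.le)
  calc g t ≤ K ^ t * ((t : ℝ) ^ t) ^ e := h.2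
    _ ≤ K ^ t * ((t : ℝ) ^ t) ^ (-1 : ℤ) := by
      gcongr
      omega
    _ < 1 := by
      rw [zpow_neg_one, ← div_eq_mul_inv, div_lt_one (by positivity)]
      gcongr

lemma isIntegral_pow_mul_aeval {K : Type*} [Field K] {x : K} {D n : ℕ}
    (hD : IsIntegral ℤ ((D : K) * x)) {p : ℤ[X]} (hp : p.natDegree ≤ n) :
    IsIntegral ℤ ((D : K) ^ n * aeval x p) := by
  rw [aeval_eq_sum_range' (Nat.lt_succ_of_le hp), Finset.mul_sum]
  refine IsIntegral.sum _ fun l hl ↦ ?_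
  have hl' : l ≤ n := by simpa [Nat.lt_succ_iff] using hl
  have : (D : K) ^ n * (p.coeff l • x ^ l) =
      (p.coeff l : K) * ((D : K) ^ (n - l) * ((D : K) * x) ^ l) := by
    rw [← Nat.sub_add_cancel hl', pow_add, mul_pow, zsmul_eq_mul, Nat.add_sub_cancel]
    ring
  rw [this]
  exact (isIntegral_intCast _).mul (((isIntegral_natCast _).pow _).mul (hD.pow l))

lemma isIntegral_evalTuple {K : Type*} [Field K] {x y : K} {D N m : ℕ}
    (hx : IsIntegral ℤ ((D : K) * x)) (hy : IsIntegral ℤ ((D : K) * y)) {W : ℕ → ℤ[X][X]}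
    (hW : ∀ k j, ((W k).coeff j).natDegree ≤ m) (j : ℕ) :
    IsIntegral ℤ ((D : K) ^ (m + N) * evalTuple N x y W j) := by
  rw [evalTuple, Finset.mul_sum]
  refine IsIntegral.sum _ fun k hk ↦ ?_
  have hk' : k - j ≤ N := by have := Finset.mem_range.1 hk; omega
  rw [pow_add, mul_mul_mul_comm]
  refine (isIntegral_pow_mul_aeval hx (hW k j)).mul ?_
  simpa using isIntegral_pow_mul_aeval hy (natDegree_X_pow_le (R := ℤ) (k - j) |>.trans hk')

lemma map_evalTuple {K L : Type*} [Field K] [Field L] [Algebra ℚ K] [Algebra ℚ L] (σ : K →ₐ[ℚ] L)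
    (N : ℕ) (x y : K) (W : ℕ → ℤ[X][X]) (j : ℕ) :
    σ (evalTuple N x y W j) = evalTuple N (σ x) (σ y) W j := by
  simp only [evalTuple, map_sum, map_mul, map_pow]
  refine Finset.sum_congr rfl fun k _ ↦ ?_
  congr 1
  exact (aeval_algHom_apply (σ.restrictScalars ℤ) x _).symm

lemma norm_det_le {n : ℕ} {A : Matrix (Fin n) (Fin n) ℂ} {G : ℝ} (h : ∀ i j, ‖A i j‖ ≤ G) :
    ‖A.det‖ ≤ n ! * G ^ n := by
  have := Matrix.det_le (abv := NormedField.toAbsoluteValue ℂ) h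
  rw [Fintype.card_fin, nsmul_eq_mul] at this
  exact this

lemma norm_det_le_of_norm_mulVec_le {n : ℕ} {A : Matrix (Fin n) (Fin n) ℂ} {G δ : ℝ}
    (hG1 : 1 ≤ G) (h : ∀ i j, ‖A i j‖ ≤ G) {v : Fin n → ℂ} {a : Fin n} (hv : v a = 1)
    (hδ : ∀ b, ‖A.mulVec v b‖ ≤ δ) : ‖A.det‖ ≤ n * (n ! * G ^ n * δ) := by
  have h1 : A.adjugate.mulVec (A.mulVec v) a = A.det := by
    rw [Matrix.mulVec_mulVec, Matrix.adjugate_mul, Matrix.smul_mulVec, Matrix.one_mulVec,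
      Pi.smul_apply, hv, smul_eq_mul, mul_one]
  rw [← h1, Matrix.mulVec, dotProduct]
  refine (norm_sum_le_of_le _ (n := fun _ ↦ n ! * G ^ n * δ) fun b _ ↦ ?_).trans_eq (by simp)
  rw [norm_mul]
  refine mul_le_mul ?_ (hδ b) (norm_nonneg _) (by positivity)
  rw [Matrix.adjugate_apply]
  refine norm_det_le fun i j ↦ ?_
  rw [Matrix.updateRow_apply]
  split_ifs
  · rw [Pi.single_apply]
    split_ifs
    · simpa using hG1
    · simpa using zero_le_one.trans hG1
  · exact h i j

/-- Liouville's inequality for a determinant whose rows nearly annihilate a vector. -/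
lemma one_le_of_det_ne_zero {K : Type*} [Field K] [NumberField K] {n : ℕ}
    {A : Matrix (Fin n) (Fin n) K} (hdet : A.det ≠ 0) {D : ℕ} (hD0 : D ≠ 0)
    (hD : ∀ i j, IsIntegral ℤ ((D : K) * A i j)) {G δ : ℝ} (hG1 : 1 ≤ G)
    (hG : ∀ (σ : K →ₐ[ℚ] ℂ) i j, ‖σ (A i j)‖ ≤ G) (σ₀ : K →ₐ[ℚ] ℂ) {v : Fin n → ℂ} {a : Fin n}
    (hv : v a = 1) (hδ : ∀ b, ‖∑ j, σ₀ (A b j) * v j‖ ≤ δ) :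
    1 ≤ (D : ℝ) ^ n * (n * (n ! * G ^ n * δ)) *
      ((D : ℝ) ^ n * (n ! * G ^ n)) ^ (Module.finrank ℚ K - 1) := by
  have hmap : ∀ σ : K →ₐ[ℚ] ℂ, ‖σ ((D : K) ^ n * A.det)‖ =
      (D : ℝ) ^ n * ‖(A.map σ).det‖ := by
    intro σ
    have : σ A.det = (A.map σ).det := AlgHom.map_det σ A
    rw [map_mul, map_pow, map_natCast, norm_mul, norm_pow, Complex.norm_natCast, this]
  refine one_le_mul_pow_of_isIntegral (x := (D : K) ^ n * A.det) ?_ ?_ (fun σ ↦ ?_) σ₀ ?_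
  · have : (D : K) ^ n * A.det = ((D : K) • A).det := by simp
    rw [this]
    exact IsIntegral.det hD
  · exact mul_ne_zero (pow_ne_zero _ (Nat.cast_ne_zero.2 hD0)) hdet
  · rw [hmap]
    gcongr
    exact norm_det_le fun i j ↦ hG σ i j
  · rw [hmap]
    gcongr
    exact norm_det_le_of_norm_mulVec_le hG1 (fun i j ↦ hG σ₀ i j) hv hδ

lemma card_monoIdx_range (N : ℕ) :
    2 * (monoIdx (Finset.range (N + 1))).card = (N + 1) * (N + 2) := by
  rw [monoIdx, Finset.card_sigma]
  simp only [Finset.card_range]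
  induction N with
  | zero => simp
  | succ N ih =>
    rw [Finset.sum_range_succ, mul_add, ih]
    ring

/-- A bound for the coefficients of the linear forms. -/
def rowBound (N L C : ℕ) (R : ℝ) (t : ℕ) : ℝ :=
  (N + 1) * (1 + R) ^ N * ((4 * t : ℝ) ^ (t + L) * ((2 * t)! * (C : ℝ) ^ t) * (1 + R) ^ (4 * t))

/-- A bound for the values of the linear forms. -/
def formBound (m L C : ℕ) (u : ℝ) (t : ℕ) : ℝ :=
  (2 * t)! * (C : ℝ) ^ t * (t + L)! * (u ^ (m * t) / (m * t)!) * ∑' r : ℕ, u ^ r / r !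

lemma one_le_rowBound {N L C : ℕ} {R : ℝ} (hC : 0 < C) (hR : 0 ≤ R) {t : ℕ} (ht : 0 < t) :
    1 ≤ rowBound N L C R t := by
  have hC' : (1 : ℝ) ≤ C := by exact_mod_cast hC
  have ht' : (1 : ℝ) ≤ t := by exact_mod_cast ht
  have h1 : ∀ n : ℕ, (1 : ℝ) ≤ (1 + R) ^ n := fun n ↦ one_le_pow₀ (by linarith)
  have h2 : (1 : ℝ) ≤ (2 * t)! := by exact_mod_cast Nat.factorial_pos _
  have h3 : (1 : ℝ) ≤ (4 * t : ℝ) ^ (t + L) := one_le_pow₀ (by linarith)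
  have h4 : (1 : ℝ) ≤ (C : ℝ) ^ t := one_le_pow₀ hC'
  have h5 : (1 : ℝ) ≤ (N : ℝ) + 1 := by linarith [Nat.cast_nonneg (α := ℝ) N]
  exact one_le_mul_of_one_le_of_one_le (one_le_mul_of_one_le_of_one_le h5 (h1 _))
    (one_le_mul_of_one_le_of_one_le (one_le_mul_of_one_le_of_one_le h3
      (one_le_mul_of_one_le_of_one_le h2 h4)) (h1 _))

lemma hasGrowth_rowBound (N L C : ℕ) {R : ℝ} (hR : 0 ≤ R) : HasGrowth 3 (rowBound N L C R) := by
  have h := (hasGrowth_const (c := (N + 1) * (1 + R) ^ N) (by positivity)).mul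
    (((hasGrowth_linear_pow L).mul (hasGrowth_factorial_two_mul.mul
      (hasGrowth_const_pow (Nat.cast_nonneg (α := ℝ) C) 1 0))).mul
      (hasGrowth_const_pow (c := 1 + R) (by positivity) 4 0))
  simp only [one_mul, add_zero] at h
  exact h

lemma hasGrowth_formBound (m L C : ℕ) {u : ℝ} (hu : 0 ≤ u) :
    HasGrowth (3 - m) (formBound m L C u) := by
  have h := (((hasGrowth_factorial_two_mul.mul
    (hasGrowth_const_pow (Nat.cast_nonneg (α := ℝ) C) 1 0)).mul (hasGrowth_factorial_add L)).mul
      (hasGrowth_inv_factorial hu m)).mul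
      (hasGrowth_const (c := ∑' r : ℕ, u ^ r / r !) (tsum_nonneg fun r ↦ by positivity))
  simp only [one_mul, add_zero] at h
  convert h using 1
  · ring
  · rfl

lemma exists_integral_denominator {K : Type*} [Field K] [NumberField K] (x y : K) :
    ∃ D : ℕ, D ≠ 0 ∧ IsIntegral ℤ ((D : K) * x) ∧ IsIntegral ℤ ((D : K) * y) := by
  have h : ∀ x : K, ∃ D : ℕ, D ≠ 0 ∧ IsIntegral ℤ ((D : K) * x) := by
    intro x
    have hx : IsAlgebraic ℤ x :=
      (IsFractionRing.isAlgebraic_iff ℤ ℚ K).2 (Algebra.IsAlgebraic.isAlgebraic x)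
    obtain ⟨a, ha, hax⟩ := hx.exists_integral_multiple
    rw [zsmul_eq_mul] at hax
    obtain ⟨n, rfl | rfl⟩ := a.eq_nat_or_neg
    · exact ⟨n, by simpa using ha, by simpa using hax⟩
    · exact ⟨n, by simpa using ha, by simpa using hax.neg⟩
  obtain ⟨D, hD, hx⟩ := h x
  obtain ⟨E, hE, hy⟩ := h y
  refine ⟨D * E, mul_ne_zero hD hE, ?_, ?_⟩
  · rw [Nat.cast_mul, mul_comm (D : K), mul_assoc]
    exact (isIntegral_natCast _).mul hx
  · rw [Nat.cast_mul, mul_assoc]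
    exact (isIntegral_natCast _).mul hy

lemma exists_conjugate_bound {K : Type*} [Field K] [NumberField K] (x y : K) :
    ∃ R : ℝ, 0 ≤ R ∧ ∀ σ : K →ₐ[ℚ] ℂ, ‖σ x‖ ≤ R ∧ ‖σ y‖ ≤ R := by
  refine ⟨∑ σ : K →ₐ[ℚ] ℂ, (‖σ x‖ + ‖σ y‖), by positivity, fun σ ↦ ?_⟩
  have := Finset.single_le_sum (f := fun σ : K →ₐ[ℚ] ℂ ↦ ‖σ x‖ + ‖σ y‖)
    (fun _ _ ↦ by positivity) (Finset.mem_univ σ)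
  constructor <;> linarith [norm_nonneg (σ x), norm_nonneg (σ y)]

lemma liouville_bound_of_algebraic_value {K : Type*} [Field K] [NumberField K] {ξ β : K}
    (hξ : ξ ≠ 0) (σ₀ : K →ₐ[ℚ] ℂ) (hβ : seriesValue (σ₀ ξ) besselSeries = σ₀ β) {D : ℕ}
    (hD0 : D ≠ 0) (hDξ : IsIntegral ℤ ((D : K) * ξ)) (hDβ : IsIntegral ℤ ((D : K) * β)) {R : ℝ}
    (hR0 : 0 ≤ R) (hR : ∀ σ : K →ₐ[ℚ] ℂ, ‖σ ξ‖ ≤ R ∧ ‖σ β‖ ≤ R) {N M C t : ℕ}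
    (hM : M = (monoIdx (Finset.range (N + 1))).card) (hM0 : 0 < M) (hC : 0 < C)
    (ht : M + M ^ 2 + 7 * N + 7 < t) {P : ℕ → ℤ[X][X]} (hP : ∀ k, (P k).natDegree ≤ k)
    (hN : ∀ k, N < k → P k = 0) (hP0 : P ≠ 0)
    (hn : ∀ k j, ((P k).coeff j).natDegree ≤ 2 * t - 1)
    (hH : ∀ k j l, |((P k).coeff j).coeff l| ≤ (2 * t)! * (C : ℤ) ^ t)
    (hT : PowerSeries.X ^ ((2 * M - 1) * t) ∣ besselForm (Finset.range (N + 1)) P)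
    (hsmall : ∀ m, (m ! : ℚ) * |PowerSeries.coeff m (besselForm (Finset.range (N + 1)) P)| ≤
      (2 * t)! * (C : ℚ) ^ t * (C : ℚ) ^ m) :
    1 ≤ ((D : ℝ) ^ (4 * t + N)) ^ (N + 1) * (((N + 1 : ℕ) : ℝ) * ((N + 1)! *
        rowBound N (M + M ^ 2) C R t ^ (N + 1) *
          formBound (2 * M - 1) (M + M ^ 2) C (3 * C * ‖σ₀ ξ‖) t)) *
      (((D : ℝ) ^ (4 * t + N)) ^ (N + 1) * ((N + 1)! *
        rowBound N (M + M ^ 2) C R t ^ (N + 1))) ^ (Module.finrank ℚ K - 1) := by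
  obtain ⟨M', rfl⟩ : ∃ M', M = M' + 1 := ⟨M - 1, by omega⟩
  set M := M' + 1 with hMdef
  obtain ⟨r, hr, hdet⟩ := exists_det_ne_zero (n := N + 1) (m := M + (t + M ^ 2))
    (fun i (j : Fin (N + 1)) ↦ evalTuple N ξ β (seqTwist^[i] P) j) fun f hf ↦ by
      have := eq_zero_of_forall_evalTuple (τ := t + M ^ 2) hξ β hP hN hP0 hn hM hT
        (by
          have h1 : 2 * M - 1 = 2 * M' + 1 := by omega
          have h2 : M - 1 = M' := by omega
          have h3 : 2 * t - 1 + M' ≤ 2 * t + M' := by omega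
          rw [h1, h2]
          calc M' * (2 * t - 1 + M') ≤ M' * (2 * t + M') := Nat.mul_le_mul_left _ h3
            _ < (2 * M' + 1) * t := by nlinarith)
        (by
          have h1 : 2 * M - 1 = 2 * M' + 1 := by omega
          have h3 : 2 * t - 1 + M ≤ 2 * t + M := by omega
          rw [h1]
          calc M * (2 * t - 1 + M) ≤ M * (2 * t + M) := Nat.mul_le_mul_left _ h3
            _ = _ := by rw [hMdef]; ring)
        (ψ := fun j ↦ if h : j < N + 1 then f ⟨j, h⟩ else 0) fun i hi ↦ by
          rw [Finset.sum_range]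
          simpa only [Fin.is_lt, dite_true, Fin.eta] using hf i hi
      funext j
      simpa only [Fin.is_lt, dite_true, Fin.eta, Pi.zero_apply] using this j (Nat.le_of_lt_succ j.2)
  have hr' : ∀ b, r b ≤ t + (M + M ^ 2) := fun b ↦ by have := hr b; omega
  have hC' : (1 : ℝ) ≤ C := by exact_mod_cast hC
  have ht' : (1 : ℝ) ≤ 4 * t := by exact_mod_cast (by omega : 1 ≤ 4 * t)
  have hiter : ∀ i k, (seqTwist^[i] P k).natDegree ≤ k := fun i k ↦ by
    rw [iterate_seqTwist]
    exact natDegree_iterate_twist_le (hP k) i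
  refine le_of_le_of_eq (one_le_of_det_ne_zero hdet (D := D ^ (4 * t + N)) (pow_ne_zero _ hD0)
    (fun b j ↦ ?_) (one_le_rowBound (N := N) (L := M + M ^ 2) hC hR0 (t := t) (by omega))
    (fun σ b j ↦ ?_) σ₀ (v := fun j ↦ seriesValue (σ₀ ξ) (besselSeries′) ^ (j : ℕ)) (a := 0)
    (by simp) (δ := formBound (2 * M - 1) (M + M ^ 2) C (3 * C * ‖σ₀ ξ‖) t) fun b ↦ ?_) ?_
  · rw [Nat.cast_pow]
    refine isIntegral_evalTuple hDξ hDβ (fun k j ↦ ?_) _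
    rw [iterate_seqTwist]
    refine (natDegree_coeff_iterate_twist_le (hn k) _ _).trans ?_
    have := hr' b
    omega
  · rw [Matrix.of_apply, map_evalTuple]
    refine (norm_evalTuple_le hP hn hH (m := 4 * t) (by have := hr' b; omega) _ _ _).trans ?_
    rw [rowBound]
    push_cast
    have h1 := (hR σ).1
    have h2 := (hR σ).2
    gcongr
    exact hr' b
  · simp only [Matrix.of_apply, map_evalTuple]
    rw [← hβ, ← Finset.sum_range (fun j ↦ evalTuple N (σ₀ ξ) (seriesValue (σ₀ ξ) besselSeries)
      (seqTwist^[r b] P) j * seriesValue (σ₀ ξ) (besselSeries′) ^ j),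
      ← seriesValue_besselForm _ _ (hiter _), besselForm_seqTwist hP]
    refine (norm_seriesValue_iterate_le (C := C) (H := (2 * t)! * (C : ℝ) ^ t) (by positivity)
      (by positivity) hT (fun m ↦ by exact_mod_cast hsmall m) _).trans ?_
    rw [formBound]
    have h3 : 0 ≤ ∑' r : ℕ, (3 * C * ‖σ₀ ξ‖) ^ r / r ! := tsum_nonneg fun r ↦ by positivity
    have h4 : ((r b)! : ℝ) ≤ (t + (M + M ^ 2))! := by
      exact_mod_cast Nat.factorial_le (hr' b)
    gcongr
  · push_cast
    rfl

lemma seriesValue_besselSeries_ne {K : Type*} [Field K] [NumberField K] {ξ : K} (hξ : ξ ≠ 0)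
    (β : K) (σ₀ : K →ₐ[ℚ] ℂ) : seriesValue (σ₀ ξ) besselSeries ≠ σ₀ β := by
  intro hβ
  obtain ⟨d, hd⟩ : ∃ d, Module.finrank ℚ K = d + 1 :=
    ⟨Module.finrank ℚ K - 1, by have := Module.finrank_pos (R := ℚ) (M := K); omega⟩
  set N := 3 * (d + 1) with hN
  obtain ⟨M, hM⟩ : ∃ M, M = (monoIdx (Finset.range (N + 1))).card := ⟨_, rfl⟩
  have hM2 : 2 * M = (N + 1) * (N + 2) := hM ▸ card_monoIdx_range N
  have hM0 : 0 < M := by nlinarith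
  obtain ⟨C, hC0, hC⟩ := exists_auxiliary_tuple N M hM
  obtain ⟨D, hD0, hDξ, hDβ⟩ := exists_integral_denominator ξ β
  obtain ⟨R, hR0, hR⟩ := exists_conjugate_bound ξ β
  have hrow := (hasGrowth_rowBound N (M + M ^ 2) C hR0).pow (N + 1)
  have hform := hasGrowth_formBound (2 * M - 1) (M + M ^ 2) C
    (u := 3 * C * ‖σ₀ ξ‖) (by positivity)
  have hden := (hasGrowth_const_pow (Nat.cast_nonneg (α := ℝ) D) 4 N).pow (N + 1)
  have hfac := hasGrowth_const (Nat.cast_nonneg (α := ℝ) (N + 1)!)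
  have hgrowth := (hden.mul ((hasGrowth_const (Nat.cast_nonneg (α := ℝ) (N + 1))).mul
    ((hfac.mul hrow).mul hform))).mul ((hden.mul (hfac.mul hrow)).pow d)
  have hlt := hgrowth.eventually_lt_one (by
    have h1 : ((2 * M - 1 : ℕ) : ℤ) = (N + 1) * (N + 2) - 1 := by
      rw [Nat.cast_sub (by omega), hM2]
      push_cast
      ring
    rw [h1, hN]
    push_cast
    nlinarith [Nat.cast_nonneg (α := ℤ) d])
  obtain ⟨t, ht1, ht2⟩ :=
    (hlt.and (Filter.eventually_gt_atTop (M + M ^ 2 + 7 * N + 7))).exists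
  obtain ⟨P, hP, hPN, hP0, hn, hH, hT, hsmall⟩ := hC t (by omega)
  have := liouville_bound_of_algebraic_value hξ σ₀ hβ hD0 hDξ hDβ hR0 hR hM hM0 hC0 ht2 hP hPN hP0
    hn hH hT hsmall
  rw [hd, Nat.add_sub_cancel] at this
  exact ht1.not_ge this

/-- Siegel's theorem for this Bessel series. -/
theorem transcendental_seriesValue_besselSeries {ξ : ℂ} (hξ : IsAlgebraic ℚ ξ) (hξ0 : ξ ≠ 0) :
    Transcendental ℚ (seriesValue ξ besselSeries) := by
  intro hβ
  set β := seriesValue ξ besselSeries with hβdef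
  let K := IntermediateField.adjoin ℚ {ξ, β}
  have : FiniteDimensional ℚ K := IntermediateField.finiteDimensional_adjoin fun x hx ↦ by
    rcases hx with rfl | rfl
    · exact hξ.isIntegral
    · exact hβ.isIntegral
  have : NumberField K := { to_charZero := inferInstance, to_finiteDimensional := this }
  have hξK : ξ ∈ K := IntermediateField.subset_adjoin _ _ (by simp)
  have hβK : β ∈ K := IntermediateField.subset_adjoin _ _ (by simp)
  exact seriesValue_besselSeries_ne (K := K) (ξ := ⟨ξ, hξK⟩) (fun h ↦ hξ0 (congrArg Subtype.val h))
    ⟨β, hβK⟩ K.val hβdef.symm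

lemma hasSum_closedForm (z : ℂ) :
    HasSum (fun n : ℕ ↦ ((n : ℂ) ^ 2 * ((2 * n).choose n : ℂ) / ((n : ℂ) + 1) ^ 2)
      * (z / 2) ^ (n + 1) / (n ! : ℂ))
      (1 / 2 + (z - 1) / 2 * seriesValue (z / 2) besselSeries) := by
  set b : ℕ → ℂ := fun n ↦ ((PowerSeries.coeff n besselSeries : ℚ) : ℂ) * (z / 2) ^ n with hb
  have hA : HasSum b (seriesValue (z / 2) besselSeries) :=
    (Summable.of_norm (isESeries_besselSeries.mem_convSubring (z / 2))).hasSum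
  have hA1 := (hasSum_nat_add_iff' 1).2 hA
  rw [Finset.sum_range_one, show b 0 = 1 by simp [hb, constantCoeff_besselSeries]] at hA1
  have h := (hA.mul_left (z / 2)).sub (hA1.mul_left (1 / 2))
  rw [show (1 : ℂ) / 2 + (z - 1) / 2 * seriesValue (z / 2) besselSeries =
    z / 2 * seriesValue (z / 2) besselSeries - 1 / 2 * (seriesValue (z / 2) besselSeries - 1) by
      ring]
  refine h.congr_fun fun n ↦ ?_
  have hs := congrArg (Rat.cast (K := ℂ)) (coeff_besselSeries_succ n)
  have hc : ((PowerSeries.coeff n besselSeries : ℚ) : ℂ) = ((2 * n).choose n : ℂ) / n ! := by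
    simp [besselSeries, Nat.centralBinom]
  push_cast at hs
  have h1 : (n : ℂ) + 1 ≠ 0 := Nat.cast_add_one_ne_zero n
  rw [mul_comm, ← eq_div_iff (pow_ne_zero 2 h1)] at hs
  simp only [hb]
  rw [hs, hc]
  have h2 : (n ! : ℂ) ≠ 0 := by exact_mod_cast Nat.factorial_ne_zero n
  rw [pow_succ]
  field_simp
  ring

end

/-- For the E-function `f(z) = ∑ₙ (n² C(2n,n)/(n+1)²) (z/2)^{n+1}/n!` and an algebraic
number `α`, the value `f(α)` is algebraic if and only if `α ∈ {0, 1}`; moreover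
`f(0) = 0` and `f(1) = ∑ₙ n² C(2n,n)/((n+1)² n! 2^{n+1}) = 1/2`. -/
theorem example_two_exceptional_values
    (f : ℂ → ℂ)
    (hf : ∀ z : ℂ, f z = ∑' n : ℕ,
      ((n : ℂ) ^ 2 * ((2 * n).choose n : ℂ) / ((n : ℂ) + 1) ^ 2)
        * (z / 2) ^ (n + 1) / (n ! : ℂ)) :
    (∀ α : ℂ, IsAlgebraic ℚ α → (IsAlgebraic ℚ (f α) ↔ α = 0 ∨ α = 1)) ∧
    f 0 = 0 ∧ f 1 = 1 / 2 ∧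
    (∑' n : ℕ, (n : ℂ) ^ 2 * ((2 * n).choose n : ℂ)
      / (((n : ℂ) + 1) ^ 2 * (n ! : ℂ) * 2 ^ (n + 1)) = 1 / 2) := by
  have hclosed : ∀ z, f z = 1 / 2 + (z - 1) / 2 * seriesValue (z / 2) besselSeries := fun z ↦ by
    rw [hf, (hasSum_closedForm z).tsum_eq]
  have h0 : f 0 = 0 := by simp [hf]
  have h1 : f 1 = 1 / 2 := by simp [hclosed]
  refine ⟨fun α hα ↦ ⟨fun hfα ↦ ?_, ?_⟩, h0, h1, ?_⟩
  · by_contra! hne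
    have halg : ∀ q : ℚ, IsAlgebraic ℚ (q : ℂ) := fun q ↦ isAlgebraic_algebraMap q
    have hhalf : IsAlgebraic ℚ (1 / 2 : ℂ) := by simpa using halg (1 / 2)
    have htwo : IsAlgebraic ℚ (2 : ℂ) := by simpa using halg 2
    refine transcendental_seriesValue_besselSeries (ξ := α / 2) ?_
      (div_ne_zero hne.1 two_ne_zero) ?_
    · simpa [div_eq_mul_inv] using hα.mul htwo.inv
    · have hα1 : α - 1 ≠ 0 := sub_ne_zero.2 hne.2
      have : seriesValue (α / 2) besselSeries = (f α - 1 / 2) * 2 * (α - 1)⁻¹ := by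
        rw [hclosed]
        field_simp
        ring
      rw [this]
      exact ((hfα.sub hhalf).mul htwo).mul (hα.sub isAlgebraic_one).inv
  · rintro (rfl | rfl)
    · rw [h0]
      exact isAlgebraic_zero
    · rw [h1]
      simpa using isAlgebraic_algebraMap (R := ℚ) (A := ℂ) (1 / 2 : ℚ)
  · rw [← h1, hf]
    refine tsum_congr fun n ↦ ?_
    rw [one_div, inv_pow]
    field_simp
end
end

section
/- Let a and b be distinct positive integers. Then the complex number (−1)^a e^{−a} + (−1)^b e^{−b} is transcendental. -/
noncomputable section

open Polynomial in
/-- Hermite's theorem: `e` is transcendental. -/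
theorem transcendental_int_exp_one : Transcendental ℤ (Complex.exp 1) := by
  intro h
  obtain ⟨q, hq0, hq⟩ := h.exists_nonzero_coeff_and_aeval_eq_zero
    (mem_nonZeroDivisors_of_ne_zero (Complex.exp_ne_zero 1))
  set d := q.natDegree with hd
  let f : ℤ[X] := ∏ i ∈ Finset.range d, (X - C ((i : ℤ) + 1))
  have hf_monic : f.Monic := monic_prod_X_sub_C _ _
  have hf0 : f.eval 0 ≠ 0 := by
    simp only [f, eval_prod, eval_sub, eval_X, eval_C, Finset.prod_ne_zero_iff]
    intro i _
    lia
  have hroot : ∀ i ∈ Finset.range d, ((i + 1 : ℕ) : ℂ) ∈ f.aroots ℂ := by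
    intro i hi
    rw [mem_aroots]
    refine ⟨hf_monic.ne_zero, ?_⟩
    simp only [f, map_prod]
    exact Finset.prod_eq_zero hi (by simp)
  obtain ⟨c, hc⟩ := LindemannWeierstrass.exp_polynomial_approx f hf0
  let B : ℝ := ∑ i ∈ Finset.range d, |(q.coeff (i + 1) : ℝ)|
  have hlim : Filter.Tendsto (fun m : ℕ ↦ B * c * (c ^ m / (m.factorial : ℝ)))
      Filter.atTop (nhds 0) := by
    simpa using (FloorSemiring.tendsto_pow_div_factorial_atTop c).const_mul (B * c)
  obtain ⟨M, hM⟩ := Filter.eventually_atTop.1 (hlim.eventually (gt_mem_nhds one_pos))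
  obtain ⟨p, hp_ge, hp⟩ := Nat.exists_infinite_primes
    (M + (f.eval 0).natAbs + (q.coeff 0).natAbs + 1)
  obtain ⟨n, hn, g, -, hg⟩ := hc p (by lia) hp
  let N : ℤ := n * q.coeff 0 + p * ∑ i ∈ Finset.range d, q.coeff (i + 1) * g.eval ((i : ℤ) + 1)
  have hN : N ≠ 0 := by
    intro h0
    have hdvd : (p : ℤ) ∣ n * q.coeff 0 :=
      (dvd_add_left (dvd_mul_right (p : ℤ) _)).1 (h0 ▸ dvd_zero (p : ℤ))
    rcases (Nat.prime_iff_prime_int.1 hp).dvd_or_dvd hdvd with h1 | h1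
    · exact hn h1
    · have := Nat.le_of_dvd (Int.natAbs_pos.2 hq0) (Int.natCast_dvd.1 h1)
      lia
  have hNsum : (N : ℂ) = -∑ i ∈ Finset.range d, (q.coeff (i + 1) : ℂ) *
      (n • Complex.exp ((i + 1 : ℕ) : ℂ) - p • aeval ((i + 1 : ℕ) : ℂ) g) := by
    have hsum : ∑ i ∈ Finset.range d, (q.coeff (i + 1) : ℂ) * Complex.exp ((i + 1 : ℕ) : ℂ) =
        -(q.coeff 0 : ℂ) := by
      rw [aeval_eq_sum_range, Finset.sum_range_succ'] at hq
      rw [eq_neg_iff_add_eq_zero, ← hq]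
      simp [← Complex.exp_nat_mul, hd]
    have haeval : ∀ i : ℕ, aeval ((i + 1 : ℕ) : ℂ) g = ((g.eval ((i : ℤ) + 1) : ℤ) : ℂ) := by
      intro i
      have := aeval_algebraMap_apply_eq_algebraMap_eval (A := ℂ) ((i : ℤ) + 1) g
      simpa using this
    simp only [haeval, zsmul_eq_mul, nsmul_eq_mul, mul_sub, Finset.sum_sub_distrib,
      mul_left_comm _ (n : ℂ), mul_left_comm _ (p : ℂ), ← Finset.mul_sum, hsum, N]
    push_cast
    ring
  have hle : ‖(N : ℂ)‖ ≤ B * c * (c ^ (p - 1) / ((p - 1).factorial : ℝ)) := by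
    have hpow : c * c ^ (p - 1) = c ^ p := mul_pow_sub_one hp.ne_zero c
    rw [hNsum, norm_neg, mul_assoc, ← mul_div_assoc, hpow, Finset.sum_mul]
    refine norm_sum_le_of_le _ fun i hi ↦ ?_
    rw [norm_mul, Complex.norm_intCast]
    exact mul_le_mul_of_nonneg_left (hg (hroot i hi)) (abs_nonneg _)
  have h1 : (1 : ℝ) ≤ ‖(N : ℂ)‖ := by
    rw [Complex.norm_intCast]
    exact_mod_cast Int.one_le_abs hN
  exact absurd (h1.trans hle) (hM (p - 1) (by lia)).not_ge

theorem transcendental_exp_neg_one : Transcendental ℚ (Complex.exp (-1)) := by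
  rw [Complex.exp_neg]
  intro h
  exact transcendental_int_exp_one
    ((IsFractionRing.isAlgebraic_iff ℤ ℚ ℂ).2 (IsAlgebraic.inv_iff.1 h))

/-- For distinct positive integers `a, b`, the number `(-1)^a e^{-a} + (-1)^b e^{-b}`
is transcendental. -/
theorem example_three_value_transcendental (a b : ℕ)
    (ha : 0 < a) (hb : 0 < b) (hab : a ≠ b) :
    Transcendental ℚ
      ((-1 : ℂ) ^ a * Complex.exp (-(a : ℂ)) + (-1 : ℂ) ^ b * Complex.exp (-(b : ℂ))) := by
  let f : Polynomial ℚ := Polynomial.monomial a ((-1) ^ a) + Polynomial.monomial b ((-1) ^ b)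
  have hf : Polynomial.aeval (Complex.exp (-1)) f =
      (-1 : ℂ) ^ a * Complex.exp (-(a : ℂ)) + (-1 : ℂ) ^ b * Complex.exp (-(b : ℂ)) := by
    simp [f, Polynomial.aeval_monomial, ← Complex.exp_nat_mul]
  have hcoeff : f.coeff a ≠ 0 := by
    simp [f, Polynomial.coeff_monomial, hab.symm]
  rw [← hf]
  have hdeg : f.natDegree ≠ 0 := (ha.trans_le (Polynomial.le_natDegree_of_ne_zero hcoeff)).ne'
  refine transcendental_exp_neg_one.aeval f hdeg (mem_nonZeroDivisors_of_ne_zero ?_)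
  exact Polynomial.leadingCoeff_ne_zero.2 fun h ↦ hcoeff (by rw [h, Polynomial.coeff_zero])
end
end

section
/- Let a and b be distinct positive integers and let f : ℂ → ℂ be the entire function f(z) = z^a e^{az} + z^b e^{bz}. Then f(α) is transcendental for every nonzero algebraic number α; moreover f'(z) = (1 + z)(a z^{a−1} e^{az} + b z^{b−1} e^{bz}) for all z ∈ ℂ, so that f'(−1) = 0. -/
noncomputable section

open Polynomial in
/-- A finite set of nonzero algebraic numbers consists of roots of a single integer polynomial
with nonzero constant coefficient. -/
theorem exists_eval_zero_ne_zero_forall_aeval_eq_zero {A : Type*} [Field A] (s : Finset A)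
    (hs : ∀ x ∈ s, IsAlgebraic ℤ x ∧ x ≠ 0) :
    ∃ f : ℤ[X], f.eval 0 ≠ 0 ∧ ∀ x ∈ s, aeval x f = 0 := by
  have h : ∀ x ∈ s, ∃ q : ℤ[X], q.coeff 0 ≠ 0 ∧ aeval x q = 0 := fun x hx ↦
    (hs x hx).1.exists_nonzero_coeff_and_aeval_eq_zero (mem_nonZeroDivisors_of_ne_zero (hs x hx).2)
  choose! q hq0 hq using h
  refine ⟨∏ x ∈ s, q x, ?_, fun x hx ↦ ?_⟩
  · rw [eval_prod, Finset.prod_ne_zero_iff]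
    intro x hx
    rw [← coeff_zero_eq_eval_zero]
    exact hq0 x hx
  · rw [map_prod]
    exact Finset.prod_eq_zero hx (hq x hx)

open Polynomial in
theorem isIntegral_pow_mul_aeval_s18 {A : Type*} [CommRing A] {d : ℤ} {x : A}
    (hx : IsIntegral ℤ (d • x)) {g : ℤ[X]} {N : ℕ} (hg : g.natDegree ≤ N) :
    IsIntegral ℤ ((d : A) ^ N * aeval x g) := by
  rw [aeval_eq_sum_range' (Nat.lt_succ_of_le hg), Finset.mul_sum]
  refine IsIntegral.sum _ fun i hi ↦ ?_
  have hi : i ≤ N := Nat.lt_succ_iff.mp (Finset.mem_range.mp hi)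
  have h : (d : A) ^ N * (g.coeff i • x ^ i) = ((g.coeff i * d ^ (N - i) : ℤ) : A) * (d • x) ^ i := by
    obtain ⟨k, rfl⟩ := Nat.exists_eq_add_of_le hi
    simp only [zsmul_eq_mul, Nat.add_sub_cancel_left]
    push_cast
    ring
  rw [h]
  exact (isIntegral_algebraMap (R := ℤ) (x := g.coeff i * d ^ (N - i))).mul (hx.pow i)

/-- A Galois-invariant algebraic integer is a rational integer. -/
theorem exists_intCast_eq_of_isIntegral_of_fixed {K : Type*} [Field K] [NumberField K]
    [IsGalois ℚ K] {x : K} (hx : IsIntegral ℤ x) (hfix : ∀ τ : Gal(K/ℚ), τ x = x) :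
    ∃ m : ℤ, (m : K) = x := by
  obtain ⟨q, rfl⟩ := (IsGalois.mem_range_algebraMap_iff_fixed x).mpr hfix
  rw [isIntegral_algebraMap_iff (algebraMap ℚ K).injective,
    IsIntegrallyClosed.isIntegral_iff] at hx
  obtain ⟨m, rfl⟩ := hx
  exact ⟨m, by simp⟩

theorem tendsto_pow_div_factorial_pred (c : ℝ) :
    Filter.Tendsto (fun n : ℕ ↦ c ^ n / (n - 1).factorial) Filter.atTop (nhds 0) := by
  rw [← Filter.tendsto_add_atTop_iff_nat 1]
  simpa [pow_succ', mul_div_assoc] using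
    (FloorSemiring.tendsto_pow_div_factorial_atTop c).const_mul c

open Polynomial in
/-- A Galois-invariant integral linear combination of exponentials of elements of a number field
does not vanish if the coefficient of `exp 0` is nonzero. -/
theorem sum_mul_exp_ne_zero_of_galois_invariant {K : Type*} [Field K] [NumberField K]
    [IsGalois ℚ K] (φ : K →+* ℂ) (H : K →₀ ℤ) (hinv : ∀ (τ : Gal(K/ℚ)) (x : K), H (τ x) = H x)
    (h0 : H 0 ≠ 0) : H.sum (fun x m ↦ (m : ℂ) * Complex.exp (φ x)) ≠ 0 := by
  classical
  intro hsum
  set s := H.support.erase 0 with hs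
  have hs_alg (x : K) : IsAlgebraic ℤ x :=
    (IsFractionRing.isAlgebraic_iff ℤ ℚ K).mpr (Algebra.IsAlgebraic.isAlgebraic x)
  obtain ⟨f, hf0, hf⟩ := exists_eval_zero_ne_zero_forall_aeval_eq_zero s
    fun x hx ↦ ⟨hs_alg x, Finset.ne_of_mem_erase hx⟩
  have : Algebra.IsAlgebraic ℤ K := ⟨hs_alg⟩
  obtain ⟨d, hd0, hd⟩ := Algebra.IsAlgebraic.exists_integral_multiples ℤ s
  obtain ⟨c, hc⟩ := LindemannWeierstrass.exp_polynomial_approx f hf0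
  have hroot : ∀ x ∈ s, φ x ∈ f.aroots ℂ := by
    intro x hx
    rw [mem_aroots]
    refine ⟨by rintro rfl; simp at hf0, ?_⟩
    rw [show φ x = φ.toIntAlgHom x from rfl, aeval_algHom_apply, hf x hx, map_zero]
  set M : ℝ := ∑ x ∈ s, |(H x : ℝ)| with hM
  set D := f.natDegree with hD
  have hlim : Filter.Tendsto
      (fun n : ℕ ↦ M * ((|(d : ℝ)| ^ D * c) ^ n / (n - 1).factorial)) Filter.atTop (nhds 0) := by
    simpa using (tendsto_pow_div_factorial_pred (|(d : ℝ)| ^ D * c)).const_mul M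
  obtain ⟨N, hN⟩ := Filter.eventually_atTop.mp (hlim.eventually_lt_const zero_lt_one)
  obtain ⟨p, hp, hpp⟩ := Nat.exists_infinite_primes
    (N + (eval 0 f).natAbs + d.natAbs + (H 0).natAbs + 1)
  obtain ⟨n, hn, g, hg, hgx⟩ := hc p (by omega) hpp
  have hgD : g.natDegree ≤ D * p := hg.trans (by rw [mul_comm]; omega)
  obtain ⟨m, hm⟩ : ∃ m : ℤ, (m : K) = ∑ x ∈ s, H x * ((d : K) ^ (D * p) * aeval x g) := by
    refine exists_intCast_eq_of_isIntegral_of_fixed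
      (IsIntegral.sum _ fun x hx ↦ (isIntegral_algebraMap (R := ℤ) (x := H x)).mul
        (isIntegral_pow_mul_aeval_s18 (hd x hx) hgD)) fun τ ↦ ?_
    rw [map_sum]
    refine Finset.sum_equiv τ.toEquiv (fun x ↦ ?_) fun x _ ↦ ?_
    · simp [hs, hinv]
    · have : τ (aeval x g) = aeval (τ x) g :=
        (aeval_algHom_apply ((τ : K →+* K).toIntAlgHom) x g).symm
      simp [hinv, this]
  have hmC : (m : ℂ) = ∑ x ∈ s, H x * ((d : ℂ) ^ (D * p) * aeval (φ x) g) := by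
    rw [← map_intCast φ, hm, map_sum]
    refine Finset.sum_congr rfl fun x _ ↦ ?_
    have : φ (aeval x g) = aeval (φ x) g := (aeval_algHom_apply φ.toIntAlgHom x g).symm
    simp [this]
  have hH0 : (H 0 : ℂ) = - ∑ x ∈ s, (H x : ℂ) * Complex.exp (φ x) := by
    rw [Finsupp.sum, ← Finset.add_sum_erase _ _ (Finsupp.mem_support_iff.mpr h0)] at hsum
    simpa using eq_neg_of_add_eq_zero_left hsum
  set I : ℤ := d ^ (D * p) * n * H 0 + p * m with hI
  have hIC : (I : ℂ) = - ∑ x ∈ s, (d : ℂ) ^ (D * p) * H x *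
      (n • Complex.exp (φ x) - p • aeval (φ x) g) := by
    rw [hI]
    push_cast
    rw [hmC, hH0, mul_neg, Finset.mul_sum, Finset.mul_sum, neg_add_eq_sub, ← Finset.sum_sub_distrib,
      ← Finset.sum_neg_distrib]
    refine Finset.sum_congr rfl fun x _ ↦ ?_
    simp only [zsmul_eq_mul, nsmul_eq_mul]
    ring
  have hlt : |(I : ℝ)| < 1 := by
    refine lt_of_le_of_lt ?_ (hN p (by omega))
    rw [← Complex.ofReal_intCast] at hIC
    rw [← Real.norm_eq_abs, ← Complex.norm_real, hIC, norm_neg, hM, Finset.sum_mul]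
    refine (norm_sum_le _ _).trans (Finset.sum_le_sum fun x hx ↦ ?_)
    rw [norm_mul, norm_mul, norm_pow, Complex.norm_intCast, Complex.norm_intCast]
    grw [hgx (hroot x hx)]
    apply le_of_eq
    ring
  have hI0 : I = 0 := by
    rw [← Int.abs_lt_one_iff]
    exact_mod_cast hlt
  have hdvd : (p : ℤ) ∣ d ^ (D * p) * n * H 0 :=
    (Int.dvd_add_left (dvd_mul_right (p : ℤ) m)).mp (by rw [← hI, hI0]; exact dvd_zero _)
  have hpZ : Prime (p : ℤ) := Nat.prime_iff_prime_int.mp hpp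
  have hsmall {z : ℤ} (hz : z ≠ 0) (hzp : z.natAbs < p) : ¬ (p : ℤ) ∣ z := fun h ↦
    hzp.not_ge (Nat.le_of_dvd (Int.natAbs_pos.mpr hz) (Int.natCast_dvd.mp h))
  rcases hpZ.dvd_or_dvd hdvd with h | h
  · rcases hpZ.dvd_or_dvd h with h | h
    · exact hsmall hd0 (by omega) (hpZ.dvd_of_dvd_pow h)
    · exact hn h
  · exact hsmall h0 (by omega) h

open Polynomial in
theorem aeval_single_one_ne_zero {R M : Type*} [CommRing R] [AddCommGroup M]
    [IsAddTorsionFree M] {x : M} (hx : x ≠ 0) {q : R[X]} (hq : q ≠ 0) :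
    aeval (AddMonoidAlgebra.single x (1 : R)) q ≠ 0 := by
  classical
  obtain ⟨k, hk⟩ : ∃ k, q.coeff k ≠ 0 := by
    by_contra! h
    exact hq (Polynomial.ext h)
  intro h
  apply hk
  have hinj : Function.Injective fun n : ℕ ↦ n • x := fun m n h ↦ by
    simpa [← natCast_zsmul] using smul_left_injective ℤ hx (a₁ := m) (a₂ := n) (by simpa using h)
  have := DFunLike.congr_fun (congrArg AddMonoidAlgebra.coeff h) (k • x)
  simpa [imp_iff_right (le_natDegree_of_ne_zero hk), aeval_eq_sum_range,
    AddMonoidAlgebra.single_pow, Finsupp.single_apply, hinj.eq_iff] using this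

open Polynomial in
/-- The Hermite–Lindemann theorem, for an element of a Galois number field. -/
theorem aeval_exp_ne_zero_of_isGalois {K : Type*} [Field K] [NumberField K]
    [IsGalois ℚ K] (φ : K →+* ℂ) {x : K} (hx : x ≠ 0) {q : ℤ[X]} (hq : q ≠ 0) :
    aeval (Complex.exp (φ x)) q ≠ 0 := by
  classical
  intro hzero
  let ev : AddMonoidAlgebra ℤ K →ₐ[ℤ] ℂ := AddMonoidAlgebra.lift ℤ ℂ K
    (Complex.expMonoidHom.comp (AddMonoidHom.toMultiplicative (φ : K →+ ℂ)))
  have ev_single (y : K) : ev (.single y 1) = Complex.exp (φ y) := by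
    simp [ev]
  let act (τ : Gal(K/ℚ)) : AddMonoidAlgebra ℤ K →ₐ[ℤ] AddMonoidAlgebra ℤ K :=
    AddMonoidAlgebra.mapDomainAlgHom ℤ ℤ (τ : K →+ K)
  have act_single (τ : Gal(K/ℚ)) (y : K) : act τ (.single y 1) = .single (τ y) 1 := by
    simp [act]
  have act_coeff (τ : Gal(K/ℚ)) (u : AddMonoidAlgebra ℤ K) (y : K) :
      (act τ u).coeff (τ y) = u.coeff y :=
    Finsupp.mapDomain_apply τ.injective u.coeff y
  let F : AddMonoidAlgebra ℤ K := ∏ σ : Gal(K/ℚ), aeval (.single (σ x) 1) q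
  have hF : F ≠ 0 := Finset.prod_ne_zero_iff.mpr fun σ _ ↦
    aeval_single_one_ne_zero (by simpa using hx) hq
  have hFev : ev F = 0 := by
    rw [map_prod]
    refine Finset.prod_eq_zero (Finset.mem_univ 1) ?_
    rw [← aeval_algHom_apply, ev_single]
    exact hzero
  have hFact (τ : Gal(K/ℚ)) : act τ F = F := by
    rw [map_prod]
    refine Fintype.prod_equiv (Equiv.mulLeft τ) _ _ fun σ ↦ ?_
    rw [← aeval_algHom_apply, act_single]
    rfl
  obtain ⟨y, hy⟩ : ∃ y, F.coeff y ≠ 0 := by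
    by_contra! h
    exact hF (AddMonoidAlgebra.ext (Finsupp.ext h))
  let S : AddMonoidAlgebra ℤ K := ∑ σ : Gal(K/ℚ), .single (-σ y) 1
  have hSact (τ : Gal(K/ℚ)) : act τ S = S := by
    rw [map_sum]
    refine Fintype.sum_equiv (Equiv.mulLeft τ) _ _ fun σ ↦ ?_
    rw [act_single, map_neg]
    rfl
  have hFc (τ : Gal(K/ℚ)) (z : K) : F.coeff (τ z) = F.coeff z := by
    conv_lhs => rw [← hFact τ]
    exact act_coeff τ F z
  refine sum_mul_exp_ne_zero_of_galois_invariant φ (S * F).coeff (fun τ z ↦ ?_) ?_ ?_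
  · conv_lhs => rw [← hSact τ, ← hFact τ, ← map_mul]
    exact act_coeff τ _ z
  · have : (S * F).coeff 0 = Fintype.card Gal(K/ℚ) * F.coeff y := by
      simp [S, Finset.sum_mul, AddMonoidAlgebra.coeff_single_mul_apply, hFc]
    rw [this]
    exact mul_ne_zero (by simp) hy
  · have : ev (S * F) = 0 := by rw [map_mul, hFev, mul_zero]
    simpa [ev, AddMonoidAlgebra.lift_apply] using this

open Polynomial in
/-- The **Hermite–Lindemann theorem**. -/
theorem transcendental_exp_of_isAlgebraic {α : ℂ} (hα : IsAlgebraic ℚ α) (h0 : α ≠ 0) :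
    Transcendental ℚ (Complex.exp α) := by
  let K := (minpoly ℚ α).SplittingField
  have : NumberField K := ⟨⟩
  have : (minpoly ℚ α).IsSplittingField ℚ K := IsSplittingField.splittingField _
  have : IsGalois ℚ K := IsGalois.of_separable_splitting_field
    (minpoly.irreducible hα.isIntegral).separable
  let φ : K →ₐ[ℚ] ℂ := IsAlgClosed.lift
  obtain ⟨x, hx⟩ : ∃ x : K, φ x = α := by
    have h := (SplittingField.splits (minpoly ℚ α)).image_rootSet φ
    have hmem : α ∈ (minpoly ℚ α).rootSet ℂ := by
      rw [mem_rootSet]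
      exact ⟨minpoly.ne_zero hα.isIntegral, minpoly.aeval ℚ α⟩
    rw [← h] at hmem
    obtain ⟨x, -, hx⟩ := hmem
    exact ⟨x, hx⟩
  intro halg
  obtain ⟨q, hq, hq0⟩ := (IsFractionRing.isAlgebraic_iff ℤ ℚ ℂ).mpr halg
  refine aeval_exp_ne_zero_of_isGalois (φ : K →+* ℂ) (x := x) ?_ hq ?_
  · rintro rfl
    exact h0 (by rw [← hx, map_zero])
  · simpa [hx] using hq0

open Polynomial in
/-- A sum of two monomials of distinct degrees with algebraic coefficients, one of them nonconstant,
takes a transcendental value at a transcendental element. -/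
theorem Transcendental.mul_pow_add_mul_pow {k E : Type*} [Field k] [Field E] [Algebra k E]
    {t u v : E} (ht : Transcendental k t) (hu : IsAlgebraic k u) (hv : IsAlgebraic k v)
    (hu0 : u ≠ 0) {a b : ℕ} (ha : 0 < a) (hab : a ≠ b) :
    Transcendental k (u * t ^ a + v * t ^ b) := by
  intro hw
  let A := algebraicClosure k E
  let u' : A := ⟨u, mem_algebraicClosure_iff.mpr hu⟩
  let v' : A := ⟨v, mem_algebraicClosure_iff.mpr hv⟩
  let w' : A := ⟨_, mem_algebraicClosure_iff.mpr hw⟩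
  refine ht (IsAlgebraic.restrictScalars k (S := A)
    ⟨C u' * X ^ a + C v' * X ^ b - C w', fun h ↦ ?_, ?_⟩)
  · have := congrArg (coeff · a) h
    simp only [coeff_sub, coeff_add, coeff_C_mul, coeff_X_pow, coeff_C, hab, ha.ne', if_true,
      if_false, coeff_zero, mul_one, mul_zero, add_zero, sub_zero] at this
    exact hu0 (congrArg Subtype.val this)
  · simp only [map_sub, map_add, map_mul, map_pow, aeval_C, aeval_X]
    exact sub_self _

theorem hasDerivAt_pow_mul_exp (n : ℕ) (hn : 0 < n) (z : ℂ) :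
    HasDerivAt (fun z : ℂ ↦ z ^ n * Complex.exp (n * z))
      ((1 + z) * (n * z ^ (n - 1) * Complex.exp (n * z))) z := by
  have h := (hasDerivAt_pow n z).mul ((hasDerivAt_id z).const_mul (n : ℂ)).cexp
  refine h.congr_deriv ?_
  obtain ⟨k, rfl⟩ := Nat.exists_eq_add_of_lt hn
  simp [pow_succ]
  ring

/-- For distinct positive integers `a, b`, the E-function
`f(z) = z^a e^{az} + z^b e^{bz}` takes transcendental values at all nonzero algebraic
points; moreover `f'(z) = (1+z)(a z^{a-1} e^{az} + b z^{b-1} e^{bz})`, so that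
`f'(-1) = 0`. -/
theorem example_three_no_exceptional_points (a b : ℕ)
    (ha : 0 < a) (hb : 0 < b) (hab : a ≠ b)
    (f : ℂ → ℂ)
    (hf : ∀ z : ℂ, f z = z ^ a * Complex.exp (a * z) + z ^ b * Complex.exp (b * z)) :
    (∀ α : ℂ, IsAlgebraic ℚ α → α ≠ 0 → Transcendental ℚ (f α)) ∧
    (∀ z : ℂ, deriv f z = (1 + z) * ((a : ℂ) * z ^ (a - 1) * Complex.exp (a * z)
      + (b : ℂ) * z ^ (b - 1) * Complex.exp (b * z))) ∧
    deriv f (-1) = 0 := by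
  obtain rfl : f = fun z ↦ z ^ a * Complex.exp (a * z) + z ^ b * Complex.exp (b * z) := funext hf
  have hd (z : ℂ) : deriv (fun z : ℂ ↦ z ^ a * Complex.exp (a * z) + z ^ b * Complex.exp (b * z)) z
      = (1 + z) * ((a : ℂ) * z ^ (a - 1) * Complex.exp (a * z)
      + (b : ℂ) * z ^ (b - 1) * Complex.exp (b * z)) := by
    rw [mul_add]
    exact ((hasDerivAt_pow_mul_exp a ha z).add (hasDerivAt_pow_mul_exp b hb z)).deriv
  refine ⟨fun α hα h0 ↦ ?_, hd, by simp [hd]⟩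
  simpa only [Complex.exp_nat_mul] using
    (transcendental_exp_of_isAlgebraic hα h0).mul_pow_add_mul_pow (hα.pow a) (hα.pow b)
      (pow_ne_zero a h0) ha hab
end
end

section
/- Let f(z) = Σ_{n≥0} (a_n/n!) z^n be an E-function. Then the entire function f is transcendental over the field of rational functions ℂ(z) if and only if a_n ≠ 0 for infinitely many n; equivalently, an E-function that is algebraic over ℂ(z) is a polynomial. -/
noncomputable section

/-- `ℚ̄`: the field of algebraic numbers, i.e. the algebraic closure of `ℚ` inside `ℂ`. -/
def Qbar : IntermediateField ℚ ℂ := algebraicClosure ℚ ℂ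

/-- `f : ℂ → ℂ` is the E-function with Taylor coefficients `aₙ/n!` (the `aₙ` being
algebraic numbers): `f(z) = ∑ aₙ/n! zⁿ`; the conjugates of the `aₙ` grow at most
geometrically; the `aₙ` admit denominators growing at most geometrically; and `f`
satisfies a nonzero linear differential equation with coefficients in `ℚ̄(z)`
(equivalently, after clearing denominators, with polynomial coefficients all of
whose coefficients are algebraic). -/
def IsEFunctionWith (a : ℕ → Qbar) (f : ℂ → ℂ) : Prop :=
  (∀ z : ℂ, HasSum (fun n : ℕ => (a n : ℂ) / n.factorial * z ^ n) (f z)) ∧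
  (∃ C : ℝ, 0 < C ∧ ∀ σ : Qbar →+* ℂ, ∀ n : ℕ, ‖σ (a n)‖ ≤ C ^ (n + 1)) ∧
  (∃ D : ℝ, 0 < D ∧ ∃ d : ℕ → ℕ, (∀ n : ℕ, d n ≠ 0 ∧ (d n : ℝ) ≤ D ^ (n + 1)) ∧
    ∀ n : ℕ, ∀ m ≤ n, IsIntegral ℤ ((d n : ℂ) * (a m : ℂ))) ∧
  (∃ r : ℕ, ∃ p : Fin (r + 1) → Polynomial ℂ,
    (∀ j, ∀ i, IsAlgebraic ℚ ((p j).coeff i)) ∧ (∃ j, p j ≠ 0) ∧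
    ∀ z : ℂ, ∑ j : Fin (r + 1), (p j).eval z * iteratedDeriv (j : ℕ) f z = 0)

/-- `f : ℂ → ℂ` is an E-function. -/
def IsEFunction (f : ℂ → ℂ) : Prop := ∃ a : ℕ → Qbar, IsEFunctionWith a f

/-- The function `f` is algebraic over `ℂ(z)`: there is a nonzero two-variable
polynomial `P ∈ ℂ[z][Y]` with `P(z, f(z)) = 0` for all `z`. -/
def IsAlgebraicFunc (f : ℂ → ℂ) : Prop :=
  ∃ P : Polynomial (Polynomial ℂ), P ≠ 0 ∧
    ∀ z : ℂ, ((P.eval (Polynomial.C (f z))).eval z) = 0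

/-- A complex polynomial grows at most like a power of `‖z‖` away from the unit disc. -/
theorem norm_eval_le_mul_norm_pow (p : Polynomial ℂ) {N : ℕ} (hN : p.natDegree ≤ N) {z : ℂ}
    (hz : 1 ≤ ‖z‖) :
    ‖p.eval z‖ ≤ (∑ i ∈ Finset.range (p.natDegree + 1), ‖p.coeff i‖) * ‖z‖ ^ N := by
  rw [Polynomial.eval_eq_sum_range, Finset.sum_mul]
  refine norm_sum_le_of_le _ fun i hi => ?_
  rw [norm_mul, norm_pow]
  have : i ≤ N := by have := Finset.mem_range.1 hi; omega
  gcongr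

/-- A nonzero complex polynomial is bounded away from zero near infinity. -/
theorem exists_pos_le_norm_eval {p : Polynomial ℂ} (hp : p ≠ 0) :
    ∃ c > 0, ∀ᶠ z in Bornology.cobounded ℂ, c ≤ ‖p.eval z‖ := by
  by_cases hd : 0 < p.degree
  · exact ⟨1, one_pos,
      (p.tendsto_norm_atTop hd tendsto_norm_cobounded_atTop).eventually_ge_atTop 1⟩
  · rw [Polynomial.eq_C_of_degree_le_zero (not_lt.1 hd)] at hp ⊢
    refine ⟨‖p.coeff 0‖, norm_pos_iff.2 fun h => hp (by simp [h]), .of_forall fun z => ?_⟩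
    simp

/-- A root of a polynomial with leading coefficient bounded below by `c` satisfies
a Cauchy-type bound. -/
theorem mul_norm_le_of_sum_eq_zero {d : ℕ} {u : ℕ → ℂ} {w : ℂ} {c : ℝ}
    (hc : c ≤ ‖u d‖) (hw : 1 ≤ ‖w‖) (h : ∑ i ∈ Finset.range (d + 1), u i * w ^ i = 0) :
    c * ‖w‖ ≤ ∑ i ∈ Finset.range d, ‖u i‖ := by
  have hpos : 0 < ‖w‖ := by linarith
  rw [Finset.sum_range_succ, add_eq_zero_iff_neg_eq] at h
  rcases Nat.eq_zero_or_pos d with rfl | hd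
  · simp at h
    simp [← h] at hc ⊢
    exact mul_nonpos_of_nonpos_of_nonneg hc hpos.le
  · have key : ‖u d‖ * ‖w‖ * ‖w‖ ^ (d - 1) ≤
        (∑ i ∈ Finset.range d, ‖u i‖) * ‖w‖ ^ (d - 1) := by
      rw [mul_assoc, ← pow_succ', Nat.sub_add_cancel hd, ← norm_pow, ← norm_mul, ← h, norm_neg,
        Finset.sum_mul]
      refine norm_sum_le_of_le _ fun i hi => ?_
      rw [norm_mul, norm_pow]
      have : i ≤ d - 1 := by have := Finset.mem_range.1 hi; omega
      gcongr
    exact (mul_le_mul_of_nonneg_right hc hpos.le).trans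
      (le_of_mul_le_mul_right key (by positivity))

/-- A function algebraic over `ℂ(z)` grows at most polynomially near infinity. -/
theorem IsAlgebraicFunc.exists_norm_le {f : ℂ → ℂ} (hf : IsAlgebraicFunc f) :
    ∃ A : ℝ, ∃ N : ℕ, ∀ᶠ z in Bornology.cobounded ℂ, ‖f z‖ ≤ A * ‖z‖ ^ N := by
  obtain ⟨P, hP, h⟩ := hf
  obtain ⟨c, hc, hcz⟩ := exists_pos_le_norm_eval (Polynomial.leadingCoeff_ne_zero.2 hP)
  set N := ∑ i ∈ Finset.range P.natDegree, (P.coeff i).natDegree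
  set B := ∑ i ∈ Finset.range P.natDegree,
    ∑ k ∈ Finset.range ((P.coeff i).natDegree + 1), ‖(P.coeff i).coeff k‖
  have hB : 0 ≤ B := by positivity
  refine ⟨1 + B / c, N, ?_⟩
  filter_upwards [hcz, tendsto_norm_cobounded_atTop.eventually_ge_atTop 1] with z hz h1
  have hzN : 1 ≤ ‖z‖ ^ N := one_le_pow₀ h1
  rcases le_total ‖f z‖ 1 with hw | hw
  · have : 0 ≤ B / c := by positivity
    nlinarith
  · have hsum : ∑ i ∈ Finset.range (P.natDegree + 1), (P.coeff i).eval z * f z ^ i = 0 := by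
      simpa [Polynomial.eval_eq_sum_range (p := P), Polynomial.eval_finsetSum] using h z
    have hle : c * ‖f z‖ ≤ B * ‖z‖ ^ N :=
      (mul_norm_le_of_sum_eq_zero (u := fun i => (P.coeff i).eval z) hz hw hsum).trans <| by
        rw [Finset.sum_mul]
        refine Finset.sum_le_sum fun i hi => norm_eval_le_mul_norm_pow _ ?_ h1
        exact Finset.single_le_sum (f := fun i => (P.coeff i).natDegree)
          (fun _ _ => Nat.zero_le _) hi
    have : ‖f z‖ ≤ B / c * ‖z‖ ^ N := by
      rw [div_mul_eq_mul_div, le_div_iff₀ hc]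
      linarith
    nlinarith

/-- The everywhere convergent power series expansion of an entire function, in Mathlib's form. -/
theorem hasFPowerSeriesOnBall_ofScalars {b : ℕ → ℂ} {f : ℂ → ℂ}
    (hf : ∀ z : ℂ, HasSum (fun n => b n * z ^ n) (f z)) :
    HasFPowerSeriesOnBall f (FormalMultilinearSeries.ofScalars ℂ b) 0 ⊤ where
  r_le := ENNReal.le_of_forall_nnreal_lt fun r _ => by
    apply FormalMultilinearSeries.le_radius_of_tendsto (l := 0)
    have := (hf (r : ℝ)).summable.tendsto_atTop_zero.norm
    simpa [FormalMultilinearSeries.ofScalars_norm] using this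
  r_pos := ENNReal.zero_lt_top
  hasSum {y} _ := by
    simpa [FormalMultilinearSeries.ofScalars_apply_eq, mul_comm] using hf y

/-- Liouville's theorem for polynomial growth, in terms of Taylor coefficients. -/
theorem coeff_eq_zero_of_norm_le {b : ℕ → ℂ} {f : ℂ → ℂ}
    (hf : ∀ z : ℂ, HasSum (fun n => b n * z ^ n) (f z)) {A : ℝ} {N : ℕ}
    (hA : ∀ᶠ z in Bornology.cobounded ℂ, ‖f z‖ ≤ A * ‖z‖ ^ N) {n : ℕ} (hn : N < n) : b n = 0 := by
  have hps := hasFPowerSeriesOnBall_ofScalars hf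
  have hdiff : Differentiable ℂ f := by
    simpa [differentiableOn_univ] using hps.differentiableOn
  rw [← comap_norm_atTop, Filter.eventually_comap] at hA
  have hbound : ∀ᶠ R : ℝ in Filter.atTop, ‖b n‖ ≤ A * R⁻¹ := by
    filter_upwards [hA, Filter.eventually_ge_atTop 1] with R hR h1
    have hR0 : 0 < R := by linarith
    lift R to NNReal using hR0.le
    have heq := hps.hasFPowerSeriesAt.eq_formalMultilinearSeries
      (hdiff.hasFPowerSeriesOnBall 0 (R := R) (by exact_mod_cast hR0)).hasFPowerSeriesAt
    have hle := norm_cauchyPowerSeries_le f 0 R n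
    rw [← heq, FormalMultilinearSeries.ofScalars_norm] at hle
    have hint : ∫ θ in (0 : ℝ)..2 * Real.pi, ‖f (circleMap 0 R θ)‖ ≤
        2 * Real.pi * (A * (R : ℝ) ^ N) := by
      have hcont : Continuous fun θ : ℝ => ‖f (circleMap 0 R θ)‖ :=
        (hdiff.continuous.comp (continuous_circleMap 0 R)).norm
      have := intervalIntegral.integral_mono_on (μ := MeasureTheory.volume)
        Real.two_pi_pos.le (hcont.intervalIntegrable _ _)
        (intervalIntegrable_const (c := A * (R : ℝ) ^ N)) fun θ _ => by
          simpa using hR (circleMap 0 R θ) (by simp)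
      simpa [mul_left_comm] using this
    have hA0 : 0 ≤ A := by
      have := (norm_nonneg _).trans (hR (R : ℂ) (by simp))
      simp at this
      exact nonneg_of_mul_nonneg_left this (by positivity)
    calc ‖b n‖ ≤ _ := hle
      _ ≤ (2 * Real.pi)⁻¹ * (2 * Real.pi * (A * (R : ℝ) ^ N)) * |(R : ℝ)|⁻¹ ^ n := by gcongr
      _ = A * ((R : ℝ) ^ N * (R : ℝ)⁻¹ ^ n) := by
        rw [abs_of_pos hR0, inv_mul_cancel_left₀ Real.two_pi_pos.ne', mul_assoc]
      _ ≤ A * (R : ℝ)⁻¹ := by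
        gcongr
        rw [inv_pow, ← div_eq_mul_inv, div_le_iff₀ (by positivity), ← div_eq_inv_mul,
          le_div_iff₀ hR0, ← pow_succ]
        exact pow_le_pow_right₀ h1 hn
  have hlim : Filter.Tendsto (fun R : ℝ => A * R⁻¹) Filter.atTop (nhds 0) := by
    simpa using tendsto_inv_atTop_zero.const_mul A
  exact norm_le_zero_iff.1 (ge_of_tendsto hlim hbound)

/-- A power series with finitely many nonzero coefficients sums to a polynomial. -/
theorem exists_polynomial_eq_of_finite {b : ℕ → ℂ} {f : ℂ → ℂ}
    (hf : ∀ z : ℂ, HasSum (fun n => b n * z ^ n) (f z)) (hb : {n | b n ≠ 0}.Finite) :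
    ∃ p : Polynomial ℂ, ∀ z : ℂ, f z = p.eval z := by
  refine ⟨∑ n ∈ hb.toFinset, Polynomial.monomial n (b n), fun z => ?_⟩
  rw [Polynomial.eval_finsetSum]
  simp only [Polynomial.eval_monomial]
  refine (hf z).unique (hasSum_sum_of_ne_finset_zero fun n hn => ?_)
  have : b n = 0 := by simpa using hn
  simp [this]

/-- Polynomial functions are algebraic over `ℂ(z)`. -/
theorem isAlgebraicFunc_of_eq_eval {f : ℂ → ℂ} {p : Polynomial ℂ} (h : ∀ z, f z = p.eval z) :
    IsAlgebraicFunc f :=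
  ⟨Polynomial.X - Polynomial.C p, Polynomial.X_sub_C_ne_zero p, fun z => by simp [h]⟩

/-- An E-function `f(z) = ∑ₙ aₙ/n! zⁿ` is transcendental over `ℂ(z)` if and only if
`aₙ ≠ 0` for infinitely many `n`; equivalently, an E-function algebraic over `ℂ(z)`
is a polynomial. -/
theorem efunction_transcendental_iff (a : ℕ → Qbar) (f : ℂ → ℂ)
    (hf : IsEFunctionWith a f) :
    ((¬ IsAlgebraicFunc f) ↔ {n : ℕ | a n ≠ 0}.Infinite) ∧
    (IsAlgebraicFunc f → ∃ p : Polynomial ℂ, ∀ z : ℂ, f z = p.eval z) := by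
  have hb : {n : ℕ | (a n : ℂ) / n.factorial ≠ 0} = {n : ℕ | a n ≠ 0} := by
    ext n
    simp [Nat.factorial_ne_zero]
  have hfin : IsAlgebraicFunc f → {n : ℕ | a n ≠ 0}.Finite := fun h => by
    obtain ⟨A, N, hA⟩ := h.exists_norm_le
    rw [← hb]
    refine (Set.finite_Iic N).subset fun n hn => Set.mem_Iic.2 (not_lt.1 fun hlt => hn ?_)
    exact coeff_eq_zero_of_norm_le hf.1 hA hlt
  have hpoly : {n : ℕ | a n ≠ 0}.Finite → ∃ p : Polynomial ℂ, ∀ z : ℂ, f z = p.eval z :=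
    fun h => exists_polynomial_eq_of_finite hf.1 (hb ▸ h)
  refine ⟨not_congr ⟨hfin, fun h => ?_⟩, fun h => hpoly (hfin h)⟩
  obtain ⟨p, hp⟩ := hpoly h
  exact isAlgebraicFunc_of_eq_eval hp
end
end
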